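/- arXiv:2502.18419 — 4 statements merged into one kernel-verified Lean document; each statement's English description precedes it below -/
import Mathlib

section
/- Let n ≥ k ≥ 1 be integers, let P, Q, R, S ⊆ {1,…,n} be k-element subsets, and let A be an n×n totally nonnegative real matrix. Then det A_{P,Q} · det A_{R,S} ≤ det A_{min(P,R),min(Q,S)} · det A_{max(P,R),max(Q,S)}. -/
open Finset

/-- The minor `det A_{I,J}` of `A` with rows `I` and columns `J` taken in increasing order;
junk value `0` when `|I| ≠ |J|` (and `det A_{∅,∅} = 1`). -/
noncomputable def minor {p q : ℕ} (A : Matrix (Fin p) (Fin q) ℝ)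
    (I : Finset (Fin p)) (J : Finset (Fin q)) : ℝ :=
  if h : J.card = I.card then
    (A.submatrix (fun a : Fin I.card => ((I.orderIsoOfFin rfl) a : Fin p))
      (fun b : Fin I.card => ((J.orderIsoOfFin h) b : Fin q))).det
  else 0

/-- A real matrix is totally nonnegative: every (square) minor is nonnegative. -/
def TNN {p q : ℕ} (A : Matrix (Fin p) (Fin q) ℝ) : Prop :=
  ∀ (I : Finset (Fin p)) (J : Finset (Fin q)), 0 ≤ minor A I J

/-- Coordinatewise minimum `min(I,J) = {min(i_k, j_k)}` of two `k`-element sets,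
listed in increasing order. -/
def cmin {α : Type*} [LinearOrder α] {m : ℕ} (I J : Finset α)
    (hI : I.card = m) (hJ : J.card = m) : Finset α :=
  Finset.image (fun k : Fin m => min ((I.orderIsoOfFin hI) k : α) ((J.orderIsoOfFin hJ) k : α))
    Finset.univ

/-- Coordinatewise maximum `max(I,J) = {max(i_k, j_k)}` of two `k`-element sets,
listed in increasing order. -/
def cmax {α : Type*} [LinearOrder α] {m : ℕ} (I J : Finset α)
    (hI : I.card = m) (hJ : J.card = m) : Finset α :=
  Finset.image (fun k : Fin m => max ((I.orderIsoOfFin hI) k : α) ((J.orderIsoOfFin hJ) k : α))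
    Finset.univ


section LatticeInequality

variable {α : Type*} [Lattice α] [IsModularLattice α] [Finite α] {f : α → ℝ}

theorem mul_le_inf_mul_sup_of_inf_covBy (hf : ∀ x, 0 < f x)
    (h : ∀ x y, x ⊓ y ⋖ x → x ⊓ y ⋖ y → f x * f y ≤ f (x ⊓ y) * f (x ⊔ y)) (y : α) :
    ∀ x, x ⊓ y ⋖ x → f x * f y ≤ f (x ⊓ y) * f (x ⊔ y) := by
  intro x
  induction x using WellFoundedGT.induction with
  | ind x ih =>
    intro hx
    rcases (inf_le_right : x ⊓ y ≤ y).eq_or_lt with hy | hy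
    · have hyx : y ≤ x := inf_eq_right.mp hy
      rw [hy, sup_eq_left.mpr hyx, mul_comm]
    · obtain ⟨c, hc, hcy⟩ := exists_covBy_le_of_lt hy
      have hcx : ¬ c ≤ x := fun hcx => hc.lt.not_ge (le_inf hcx hcy)
      have hinf : x ⊓ c = x ⊓ y := by
        refine le_antisymm (inf_le_inf_left x hcy) (le_inf inf_le_left hc.le)
      have hc' : (x ⊔ c) ⊓ y = c := by
        rw [sup_comm, sup_inf_assoc_of_le x hcy, sup_eq_left]
        exact hc.le
      have hcov : c ⋖ x ⊔ c := covBy_sup_of_inf_covBy_left (hinf ▸ hx)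
      have h1 := h x c (hinf ▸ hx) (hinf ▸ hc)
      have h2 := ih (x ⊔ c) (lt_of_le_of_ne le_sup_left fun e => hcx (e ▸ le_sup_right))
        (hc'.symm ▸ hcov)
      rw [hc', sup_assoc, sup_eq_right.mpr hcy] at h2
      rw [hinf] at h1
      have h3 := mul_le_mul h1 h2 (mul_pos (hf _) (hf _)).le (mul_pos (hf _) (hf _)).le
      refine le_of_mul_le_mul_right ?_ (mul_pos (hf c) (hf (x ⊔ c)))
      linarith

/-- A positive function on a finite modular lattice which is log-supermodular on the elementary
squares of the lattice is log-supermodular. -/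
theorem mul_le_inf_mul_sup_of_covBy (hf : ∀ x, 0 < f x)
    (h : ∀ x y, x ⊓ y ⋖ x → x ⊓ y ⋖ y → f x * f y ≤ f (x ⊓ y) * f (x ⊔ y)) (x : α) :
    ∀ y, f x * f y ≤ f (x ⊓ y) * f (x ⊔ y) := by
  intro y
  induction y using WellFoundedGT.induction with
  | ind y ih =>
    rcases (inf_le_left : x ⊓ y ≤ x).eq_or_lt with hx | hx
    · rw [hx, sup_eq_right.mpr (inf_eq_left.mp hx)]
    · obtain ⟨c, hc, hcx⟩ := exists_covBy_le_of_lt hx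
      have hcy : ¬ c ≤ y := fun hcy => hc.lt.not_ge (le_inf hcx hcy)
      have hinf : c ⊓ y = x ⊓ y := by
        refine le_antisymm (inf_le_inf_right y hcx) (le_inf hc.le inf_le_right)
      have hc' : x ⊓ (c ⊔ y) = c := by
        rw [inf_comm, sup_inf_assoc_of_le y hcx, sup_eq_left, inf_comm]
        exact hc.le
      have h1 := mul_le_inf_mul_sup_of_inf_covBy hf h y c (hinf.symm ▸ hc)
      have h2 := ih (c ⊔ y) (lt_of_le_of_ne le_sup_right fun e => hcy (e ▸ le_sup_left))
      rw [hc', ← sup_assoc, sup_eq_left.mpr hcx] at h2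
      rw [hinf] at h1
      have h3 := mul_le_mul h1 h2 (mul_pos (hf _) (hf _)).le (mul_pos (hf _) (hf _)).le
      refine le_of_mul_le_mul_right ?_ (mul_pos (hf c) (hf (c ⊔ y)))
      linarith

end LatticeInequality

section DeterminantIdentities

variable {R : Type*} [CommRing R]

/-- The three-term Plücker relation. -/
theorem Matrix.det_updateCol_plucker {m : Type*} [Fintype m] [DecidableEq m] (N : Matrix m m R)
    {p q : m} (hpq : p ≠ q) (a b c d : m → R) :
    ((N.updateCol p a).updateCol q b).det * ((N.updateCol p c).updateCol q d).det =
      ((N.updateCol p c).updateCol q b).det * ((N.updateCol p a).updateCol q d).det +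
      ((N.updateCol p a).updateCol q c).det * ((N.updateCol p b).updateCol q d).det := by
  have comm (x y : m → R) :
      (N.updateCol q y).updateCol p x = (N.updateCol p x).updateCol q y := by
    ext i j
    simp only [Matrix.updateCol_apply]
    grind
  have key := congrArg (fun x => Matrix.cramer (N.updateCol q d) x p)
    (Matrix.mulVec_cramer ((N.updateCol p a).updateCol q b) c)
  simp only [Matrix.mulVec_eq_sum, op_smul_eq_smul, map_sum, map_smul, Finset.sum_apply,
    Pi.smul_apply, smul_eq_mul] at key
  simp only [Matrix.cramer_apply, comm] at key
  rw [← key, ← Finset.sum_subset (Finset.subset_univ {p, q}), Finset.sum_pair hpq]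
  · congr 3
    · rw [← comm, Matrix.updateCol_idem, comm]
    · congr 2
      ext i
      simp [hpq]
    · rw [Matrix.updateCol_idem]
    · congr 2
      ext i
      simp
  · intro r _ hr
    have hrp : r ≠ p := fun h => hr (by simp [h])
    have hrq : r ≠ q := fun h => hr (by simp [h])
    refine mul_eq_zero_of_right _ (Matrix.det_zero_of_column_eq hrp fun i => ?_)
    simp [hrp, hrq, hpq]

theorem Matrix.det_updateRow_plucker {m : Type*} [Fintype m] [DecidableEq m] (N : Matrix m m R)
    {p q : m} (hpq : p ≠ q) (a b c d : m → R) :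
    ((N.updateRow p a).updateRow q b).det * ((N.updateRow p c).updateRow q d).det =
      ((N.updateRow p c).updateRow q b).det * ((N.updateRow p a).updateRow q d).det +
      ((N.updateRow p a).updateRow q c).det * ((N.updateRow p b).updateRow q d).det := by
  have h := N.transpose.det_updateCol_plucker hpq a b c d
  simpa only [Matrix.updateCol_transpose, Matrix.det_transpose] using h

theorem Matrix.det_updateCol_swap {m : Type*} [Fintype m] [DecidableEq m] (N : Matrix m m R)
    {p q : m} (hpq : p ≠ q) (a b : m → R) :
    ((N.updateCol p a).updateCol q b).det = - ((N.updateCol p b).updateCol q a).det := by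
  have h := Matrix.det_permute' (Equiv.swap p q) ((N.updateCol p b).updateCol q a)
  rw [Equiv.Perm.sign_swap hpq] at h
  have e : ((N.updateCol p b).updateCol q a).submatrix id (Equiv.swap p q) =
      (N.updateCol p a).updateCol q b := by
    ext i j
    simp only [Matrix.submatrix_apply, Matrix.updateCol_apply, Equiv.swap_apply_def, id]
    grind
  rw [e] at h
  simpa using h

/-- The Desnanot–Jacobi identity for two adjacent rows and two adjacent columns. -/
theorem Matrix.det_desnanot_jacobi {k : ℕ} (M : Matrix (Fin (k + 2)) (Fin (k + 2)) R)
    (p q : Fin (k + 1)) :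
    (M.submatrix p.succ.succAbove q.succ.succAbove).det *
        (M.submatrix p.castSucc.succAbove q.castSucc.succAbove).det -
      (M.submatrix p.castSucc.succAbove q.succ.succAbove).det *
        (M.submatrix p.succ.succAbove q.castSucc.succAbove).det =
      M.det * ((M.submatrix p.succ.succAbove q.succ.succAbove).submatrix
        p.succAbove q.succAbove).det := by
  have adj (N : Matrix (Fin (k + 2)) (Fin (k + 2)) R) (i j : Fin (k + 2)) :
      (N.updateCol j (Pi.single i 1)).det =
        (-1) ^ (i + j : ℕ) * (N.submatrix i.succAbove j.succAbove).det := by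
    rw [← Matrix.adjugate_fin_succ_eq_det_submatrix, ← Matrix.det_transpose,
      ← Matrix.updateRow_transpose, ← Matrix.adjugate_apply, ← Matrix.adjugate_transpose,
      Matrix.transpose_apply]
  have adj' (N : Matrix (Fin (k + 1)) (Fin (k + 1)) R) (i j : Fin (k + 1)) :
      (N.updateCol j (Pi.single i 1)).det =
        (-1) ^ (i + j : ℕ) * (N.submatrix i.succAbove j.succAbove).det := by
    rw [← Matrix.adjugate_fin_succ_eq_det_submatrix, ← Matrix.det_transpose,
      ← Matrix.updateRow_transpose, ← Matrix.adjugate_apply, ← Matrix.adjugate_transpose,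
      Matrix.transpose_apply]
  have hne : q.castSucc ≠ q.succ := (Fin.castSucc_lt_succ).ne
  set e₁ : Fin (k + 2) → R := Pi.single p.castSucc 1 with he₁
  set e₂ : Fin (k + 2) → R := Pi.single p.succ 1 with he₂
  set m₁ : Fin (k + 2) → R := fun i => M i q.castSucc with hm₁
  set m₂ : Fin (k + 2) → R := fun i => M i q.succ with hm₂
  have hM₁ : M.updateCol q.castSucc m₁ = M := Matrix.updateCol_eq_self _ _
  have hM₂ (x : Fin (k + 2) → R) :
      (M.updateCol q.castSucc x).updateCol q.succ m₂ = M.updateCol q.castSucc x := by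
    ext i j
    simp only [Matrix.updateCol_apply, hm₂]
    grind
  have h := M.det_updateCol_plucker hne m₁ m₂ e₁ e₂
  have hswap : ((M.updateCol q.castSucc m₂).updateCol q.succ e₂).det =
      - (M.updateCol q.castSucc e₂).det := by
    rw [Matrix.det_updateCol_swap _ hne, hM₂]
  have hcore : ((M.updateCol q.castSucc e₁).updateCol q.succ e₂).det =
      ((M.submatrix p.succ.succAbove q.succ.succAbove).submatrix p.succAbove q.succAbove).det := by
    rw [he₂, adj]
    have : (M.updateCol q.castSucc e₁).submatrix p.succ.succAbove q.succ.succAbove =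
        (M.submatrix p.succ.succAbove q.succ.succAbove).updateCol q (Pi.single p 1) := by
      have hq : q.succ.succAbove q = q.castSucc := Fin.succAbove_succ_self q
      have hp : p.succ.succAbove p = p.castSucc := Fin.succAbove_succ_self p
      ext i j
      simp only [Matrix.submatrix_apply, Matrix.updateCol_apply, he₁, ← hq, ← hp,
        Fin.succAbove_right_injective.eq_iff, Pi.single_apply]
    rw [this, adj', ← mul_assoc, ← pow_add, Even.neg_one_pow, one_mul]
    simp only [Fin.val_succ]
    exact ⟨p + q + 1, by ring⟩
  rw [hswap, hcore, hM₂, hM₁, hM₂, adj, adj, adj, adj] at h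
  rw [h]
  have hs : ((-1 : R) ^ (p + q : ℕ)) * (-1) ^ (p + q : ℕ) = 1 := by
    rw [← pow_add, Even.neg_one_pow ⟨_, rfl⟩]
  simp only [Fin.val_succ, Fin.val_castSucc, pow_add, pow_one] at hs ⊢
  linear_combination (-(M.submatrix p.succ.succAbove q.succ.succAbove).det *
        (M.submatrix p.castSucc.succAbove q.castSucc.succAbove).det +
      (M.submatrix p.castSucc.succAbove q.succ.succAbove).det *
        (M.submatrix p.succ.succAbove q.castSucc.succAbove).det) * hs

end DeterminantIdentities

section ElementarySquares

/-- All minors of order `m` are nonnegative. -/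
def MinorsNonneg {p q : ℕ} (m : ℕ) (A : Matrix (Fin p) (Fin q) ℝ) : Prop :=
  ∀ (u : Fin m → Fin p) (v : Fin m → Fin q), StrictMono u → StrictMono v →
    0 ≤ (A.submatrix u v).det

theorem MinorsNonneg.transpose {p q m : ℕ} {A : Matrix (Fin p) (Fin q) ℝ}
    (hA : MinorsNonneg m A) : MinorsNonneg m A.transpose := by
  intro u v hu hv
  rw [← Matrix.transpose_submatrix, Matrix.det_transpose]
  exact hA v u hv hu

theorem Fin.cycleIcc_cases {k : ℕ} {p q : Fin k} (hpq : p ≤ q) (i : Fin k) :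
    ((i < p ∨ q < i) ∧ Fin.cycleIcc p q i = i) ∨
      (p ≤ i ∧ i < q ∧ (Fin.cycleIcc p q i : ℕ) = i + 1) ∨
      (i = q ∧ Fin.cycleIcc p q i = p) := by
  have : NeZero k := ⟨by have := i.isLt; omega⟩
  rcases lt_or_ge i p with h | h
  · exact Or.inl ⟨Or.inl h, Fin.cycleIcc_of_lt h⟩
  rcases lt_trichotomy i q with h' | h' | h'
  · refine Or.inr (Or.inl ⟨h, h', ?_⟩)
    rw [Fin.cycleIcc_of_ge_of_lt h h', Fin.val_add_one_of_lt' (by have := q.isLt; omega)]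
  · subst h'
    exact Or.inr (Or.inr ⟨rfl, Fin.cycleIcc_of_last h⟩)
  · exact Or.inl ⟨Or.inr h', Fin.cycleIcc_of_gt h'⟩

variable {n n' k : ℕ} {A : Matrix (Fin n) (Fin n') ℝ}

/-- Two minors with unsorted rows, whose sorting permutations are inverse cycles, have the same
sign. -/
theorem MinorsNonneg.det_mul_det_nonneg (hA : MinorsNonneg k A) {z : Fin k → Fin n}
    {v : Fin k → Fin n'} (hz : StrictMono z) (hv : StrictMono v) {p q : Fin k} (hpq : p < q)
    {a b : Fin n} (ha : (a : ℕ) = z p + 1) (hb : (b : ℕ) = z q + 1)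
    (hza : StrictMono (Function.update z p a)) (hzb : StrictMono (Function.update z q b)) :
    0 ≤ (A.submatrix (Function.update (Function.update z p a) q (z p)) v).det *
      (A.submatrix (Function.update (Function.update z p b) q (z q)) v).det := by
  set w₁ := Function.update (Function.update z p a) q (z p) with hw₁
  set w₂ := Function.update (Function.update z p b) q (z q) with hw₂
  set π := Fin.cycleIcc p q with hπ
  have e₁ (i : Fin k) : w₁ i = if i = q then z p else if i = p then a else z i := by
    simp [hw₁, Function.update_apply]
  have e₂ (i : Fin k) : w₂ i = if i = p then b else z i := by
    simp only [hw₂, Function.update_apply]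
    grind
  have ha' : ∀ j, p < j → a < z j := fun j hj => by
    simpa [Function.update_apply, hj.ne'] using hza hj
  have hb' : ∀ j, q < j → b < z j := fun j hj => by
    simpa [Function.update_apply, hj.ne'] using hzb hj
  have hza' : z p < a := by rw [Fin.lt_def]; omega
  have hzb' : z q < b := by rw [Fin.lt_def]; omega
  have hlt : ∀ i j, i < j → z i < z j := fun i j h => hz h
  have hle : ∀ i j, i ≤ j → z i ≤ z j := fun i j h => hz.monotone h
  have m₁ : StrictMono (w₁ ∘ ⇑π⁻¹) := by
    have : ∀ i j, π i < π j → w₁ i < w₁ j := by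
      intro i j hij
      have hi := Fin.cycleIcc_cases hpq.le i
      have hj := Fin.cycleIcc_cases hpq.le j
      rw [← hπ] at hi hj
      rw [e₁, e₁]
      clear_value π
      clear e₁ e₂ hw₁ hw₂
      grind
    intro i j hij
    apply this
    simpa using hij
  have m₂ : StrictMono (w₂ ∘ ⇑π) := by
    intro i j hij
    have hi := Fin.cycleIcc_cases hpq.le i
    have hj := Fin.cycleIcc_cases hpq.le j
    rw [← hπ] at hi hj
    simp only [Function.comp_apply, e₂]
    have hiq := hle (π i) q
    clear_value π
    clear e₁ e₂ hw₁ hw₂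
    grind
  have h₁ := hA _ _ m₁ hv
  have h₂ := hA _ _ m₂ hv
  have f₁ := Matrix.det_permute π⁻¹ (A.submatrix w₁ v)
  have f₂ := Matrix.det_permute π (A.submatrix w₂ v)
  rw [Matrix.submatrix_submatrix, Function.comp_id] at f₁ f₂
  rw [f₁] at h₁
  rw [f₂] at h₂
  rw [Equiv.Perm.sign_inv] at h₁
  rcases Int.units_eq_one_or (Equiv.Perm.sign π) with hs | hs
  · simp only [hs, Units.val_one, Int.cast_one, one_mul] at h₁ h₂
    exact mul_nonneg h₁ h₂
  · simp only [hs, Units.val_neg, Units.val_one, Int.cast_neg, Int.cast_one, neg_mul,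
      one_mul] at h₁ h₂
    nlinarith

theorem MinorsNonneg.rows_square_of_lt (hA : MinorsNonneg k A) {z : Fin k → Fin n}
    {v : Fin k → Fin n'} (hz : StrictMono z) (hv : StrictMono v) {p q : Fin k} (hpq : p < q)
    {a b : Fin n} (ha : (a : ℕ) = z p + 1) (hb : (b : ℕ) = z q + 1)
    (hza : StrictMono (Function.update z p a)) (hzb : StrictMono (Function.update z q b)) :
    (A.submatrix (Function.update z p a) v).det * (A.submatrix (Function.update z q b) v).det ≤
      (A.submatrix z v).det *
        (A.submatrix (Function.update (Function.update z p a) q b) v).det := by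
  have upd (w : Fin k → Fin n) (r : Fin k) (x : Fin n) :
      A.submatrix (Function.update w r x) v =
        (A.submatrix w v).updateRow r (fun j => A x (v j)) := by
    ext i j
    simp only [Matrix.submatrix_apply, Matrix.updateRow_apply, Function.update_apply]
    split_ifs <;> rfl
  have h := hA.det_mul_det_nonneg hz hv hpq ha hb hza hzb
  have hp := Matrix.det_updateRow_plucker (A.submatrix z v) hpq.ne (fun j => A a (v j))
    (fun j => A b (v j)) (fun j => A (z p) (v j)) (fun j => A (z q) (v j))
  simp only [← upd] at hp
  have hq : Function.update (Function.update z p a) q (z q) = Function.update z p a := by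
    rw [Function.update_comm hpq.ne, Function.update_eq_self]
  simp only [hq, Function.update_eq_self] at hp
  linarith

theorem Fin.eq_or_exists_succAbove {m : ℕ} (p i : Fin (m + 1)) :
    i = p ∨ ∃ j, i = p.succAbove j := by
  rcases eq_or_ne i p with h | h
  · exact Or.inl h
  · obtain ⟨j, hj⟩ := Fin.exists_succAbove_eq h
    exact Or.inr ⟨j, hj.symm⟩

theorem Fin.insertNth_succ_comp_castSucc_succAbove {m : ℕ} {β : Type*} (z : Fin (m + 1) → β)
    (p : Fin (m + 1)) (a : β) :
    Fin.insertNth (α := fun _ => β) p.succ a z ∘ p.castSucc.succAbove =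
      Function.update z p a := by
  ext i
  rcases lt_trichotomy i p with h | rfl | h
  · rw [Function.comp_apply, Fin.succAbove_castSucc_of_lt _ _ h,
      ← Fin.succAbove_succ_of_le _ _ h.le, Fin.insertNth_apply_succAbove,
      Function.update_of_ne h.ne]
  · simp
  · rw [Function.comp_apply, Fin.succAbove_castSucc_of_le _ _ h.le,
      ← Fin.succAbove_succ_of_lt _ _ h, Fin.insertNth_apply_succAbove,
      Function.update_of_ne h.ne']

theorem Fin.strictMono_insertNth_succ {m : ℕ} {β : Type*} [Preorder β] {z : Fin (m + 1) → β}
    {p : Fin (m + 1)} {a : β} (hz : StrictMono z) (hpa : z p < a)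
    (hza : StrictMono (Function.update z p a)) :
    StrictMono (Fin.insertNth (α := fun _ => β) p.succ a z) := by
  intro i j hij
  rcases Fin.eq_or_exists_succAbove p.succ i with rfl | ⟨i, rfl⟩ <;>
    rcases Fin.eq_or_exists_succAbove p.succ j with rfl | ⟨j, rfl⟩
  · exact absurd hij (lt_irrefl _)
  · rw [Fin.lt_succAbove_iff_le_castSucc, Fin.succ_le_castSucc_iff] at hij
    simpa [Function.update_apply, hij.ne'] using hza hij
  · rw [Fin.succAbove_lt_iff_castSucc_lt, Fin.castSucc_lt_succ_iff] at hij
    simpa using (hz.monotone hij).trans_lt hpa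
  · simpa using hz ((Fin.strictMono_succAbove _).lt_iff_lt.mp hij)

theorem MinorsNonneg.mixed_square {A : Matrix (Fin n) (Fin n') ℝ} (hA : MinorsNonneg k A)
    (hA' : MinorsNonneg (k + 2) A) {z : Fin (k + 1) → Fin n} {t : Fin (k + 1) → Fin n'}
    (hz : StrictMono z) (ht : StrictMono t) {p q : Fin (k + 1)} {a : Fin n} {b : Fin n'}
    (hpa : z p < a) (hqb : t q < b)
    (hza : StrictMono (Function.update z p a)) (htb : StrictMono (Function.update t q b)) :
    (A.submatrix (Function.update z p a) t).det * (A.submatrix z (Function.update t q b)).det ≤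
      (A.submatrix z t).det *
        (A.submatrix (Function.update z p a) (Function.update t q b)).det := by
  have h := Matrix.det_desnanot_jacobi (A.submatrix
    (Fin.insertNth (α := fun _ => Fin n) p.succ a z)
    (Fin.insertNth (α := fun _ => Fin n') q.succ b t)) p q
  have e {m : ℕ} {β : Type} (z : Fin (m + 1) → β) (p : Fin (m + 1)) (a : β) :
      Fin.insertNth (α := fun _ => β) p.succ a z ∘ p.succ.succAbove = z := by
    ext i
    simp
  simp only [Matrix.submatrix_submatrix, e, Fin.insertNth_succ_comp_castSucc_succAbove] at h
  have h₁ := hA' _ _ (Fin.strictMono_insertNth_succ hz hpa hza)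
    (Fin.strictMono_insertNth_succ ht hqb htb)
  have h₂ := hA _ _ (hz.comp (Fin.strictMono_succAbove p)) (ht.comp (Fin.strictMono_succAbove q))
  linarith [mul_nonneg h₁ h₂]

end ElementarySquares

section CauchyBinet

open Classical in
/-- The Cauchy–Binet formula. -/
theorem Matrix.det_mul_eq_sum_strictMono {R : Type*} [CommRing R] {k n : ℕ}
    (M : Matrix (Fin k) (Fin n) R) (N : Matrix (Fin n) (Fin k) R) :
    (M * N).det = ∑ w : Fin k → Fin n with StrictMono w,
      (M.submatrix id w).det * (N.submatrix w id).det := by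
  have expand : (M * N).det =
      ∑ r : Fin k → Fin n, (∏ i, M i (r i)) * (N.submatrix r id).det := by
    have h : M * N = fun i => ∑ j, M i j • N j := by
      ext i j
      simp [Matrix.mul_apply]
    have h' := (Matrix.detRowAlternating (n := Fin k) (R := R)).toMultilinearMap.map_sum
      (fun i j => M i j • N j)
    simp only [MultilinearMap.map_smul_univ] at h'
    rw [h]
    exact h'
  rw [expand]
  symm
  have hterm (w : Fin k → Fin n) : (M.submatrix id w).det * (N.submatrix w id).det =
      ∑ σ : Equiv.Perm (Fin k), (∏ i, M i ((w ∘ σ) i)) * (N.submatrix (w ∘ σ) id).det := by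
    rw [← Matrix.det_transpose, Matrix.det_apply', Finset.sum_mul]
    refine Finset.sum_congr rfl fun σ _ => ?_
    have := Matrix.det_permute σ (N.submatrix w id)
    rw [Matrix.submatrix_submatrix, Function.comp_id] at this
    rw [this]
    simp only [Matrix.transpose_apply, Matrix.submatrix_apply, id, Function.comp_apply]
    ring
  simp_rw [hterm]
  rw [← Finset.sum_product']
  refine Finset.sum_of_injOn (fun x => x.1 ∘ x.2) ?_ (fun _ _ => by simp) ?_ (fun _ _ => rfl)
  · rintro ⟨w, σ⟩ hw ⟨w', σ'⟩ hw' h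
    simp only [Finset.coe_product, Finset.coe_filter, Set.mem_prod, Set.mem_ofPred_eq,
      Finset.mem_univ, true_and] at hw hw'
    dsimp only at h
    have hr : w = w' := by
      refine (hw.1.range_inj hw'.1).mp ?_
      rw [← σ.surjective.range_comp w, ← σ'.surjective.range_comp w', h]
    subst hr
    congr 1
    exact Equiv.ext fun i => hw.1.injective (congrFun h i)
  · intro r _ hr
    refine mul_eq_zero_of_right _ ?_
    have hinj : ¬ Function.Injective r := by
      intro hinj
      refine hr ⟨(r ∘ Tuple.sort r, (Tuple.sort r)⁻¹), ?_, ?_⟩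
      · simpa using (Tuple.monotone_sort r).strictMono_of_injective
          (hinj.comp (Tuple.sort r).injective)
      · ext i
        simp
    obtain ⟨i, j, hij, hne⟩ : ∃ i j, r i = r j ∧ i ≠ j := by
      simpa [Function.Injective] using hinj
    exact Matrix.det_zero_of_row_eq hne (by ext; simp [hij])

open Classical in
theorem Matrix.det_submatrix_mul {R : Type*} [CommRing R] {k m n l : ℕ}
    (M : Matrix (Fin m) (Fin n) R) (N : Matrix (Fin n) (Fin l) R)
    (u : Fin k → Fin m) (v : Fin k → Fin l) :
    ((M * N).submatrix u v).det = ∑ w : Fin k → Fin n with StrictMono w,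
      (M.submatrix u w).det * (N.submatrix w v).det := by
  rw [Matrix.submatrix_mul M N u id v Function.bijective_id, Matrix.det_mul_eq_sum_strictMono]
  rfl

theorem MinorsNonneg.mul {k m n l : ℕ} {M : Matrix (Fin m) (Fin n) ℝ}
    {N : Matrix (Fin n) (Fin l) ℝ} (hM : MinorsNonneg k M) (hN : MinorsNonneg k N) :
    MinorsNonneg k (M * N) := by
  intro u v hu hv
  rw [Matrix.det_submatrix_mul]
  refine Finset.sum_nonneg fun w hw => ?_
  have hw := (Finset.mem_filter.mp hw).2
  exact mul_nonneg (hM u w hu hw) (hN w v hw hv)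

theorem MinorsNonneg.det_submatrix_mul_pos {k m n l : ℕ} {M : Matrix (Fin m) (Fin n) ℝ}
    {N : Matrix (Fin n) (Fin l) ℝ} (hM : MinorsNonneg k M) (hN : MinorsNonneg k N)
    {u : Fin k → Fin m} {w : Fin k → Fin n} {v : Fin k → Fin l} (hu : StrictMono u)
    (hw : StrictMono w) (hv : StrictMono v) (h₁ : 0 < (M.submatrix u w).det)
    (h₂ : 0 < (N.submatrix w v).det) : 0 < ((M * N).submatrix u v).det := by
  classical
  rw [Matrix.det_submatrix_mul]
  refine Finset.sum_pos' (fun w hw => ?_) ⟨w, by simpa using hw, mul_pos h₁ h₂⟩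
  have hw := (Finset.mem_filter.mp hw).2
  exact mul_nonneg (hM u w hu hw) (hN w v hw hv)

end CauchyBinet

section GaussianKernel

/-- The matrix with entries `q ^ (i - j)²`. -/
def gaussianMatrix (n : ℕ) (q : ℝ) : Matrix (Fin n) (Fin n) ℝ :=
  Matrix.of fun i j => q ^ (((i : ℤ) - (j : ℤ)).natAbs ^ 2)

theorem gaussianMatrix_zero (n : ℕ) : gaussianMatrix n 0 = 1 := by
  ext i j
  rcases eq_or_ne i j with rfl | h
  · simp [gaussianMatrix]
  · have : ((i : ℤ) - (j : ℤ)).natAbs ^ 2 ≠ 0 := by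
      have : (i : ℕ) ≠ j := fun e => h (Fin.ext e)
      refine pow_ne_zero _ ?_
      omega
    rw [gaussianMatrix, Matrix.of_apply, zero_pow this, Matrix.one_apply_ne h]

theorem continuous_gaussianMatrix (n : ℕ) : Continuous (gaussianMatrix n) := by
  refine continuous_pi fun i => continuous_pi fun j => ?_
  simp only [gaussianMatrix, Matrix.of_apply]
  fun_prop

theorem Equiv.Perm.eq_one_of_strictMono {k : ℕ} {σ : Equiv.Perm (Fin k)} (h : StrictMono σ) :
    σ = 1 := by
  refine Equiv.ext fun i => congrFun ((h.range_inj strictMono_id).mp ?_) i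
  rw [σ.surjective.range_eq, Set.range_id]

theorem sum_natAbs_sub_sq_lt {k n m : ℕ} {u : Fin k → Fin n} {v : Fin k → Fin m}
    (hu : StrictMono u) (hv : StrictMono v) {σ : Equiv.Perm (Fin k)} (hσ : σ ≠ 1) :
    ∑ i, ((u i : ℤ) - (v i : ℤ)).natAbs ^ 2 < ∑ i, ((u (σ i) : ℤ) - (v i : ℤ)).natAbs ^ 2 := by
  have hmono : Monovary (fun i => (u i : ℤ)) (fun i => (v i : ℤ)) := by
    intro i j hij
    have hij' : v i < v j := by simpa using hij
    simpa using (hu (hv.lt_iff_lt.mp hij')).le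
  have hlt : ∑ i, (u (σ i) : ℤ) * v i < ∑ i, (u i : ℤ) * v i := by
    refine hmono.sum_comp_perm_mul_lt_sum_mul_iff.mpr fun h => hσ ?_
    refine Equiv.Perm.eq_one_of_strictMono ?_
    refine Monotone.strictMono_of_injective (fun i j hij => ?_) σ.injective
    rcases hij.eq_or_lt with rfl | hij
    · exact le_rfl
    · have := @h i j (by simpa using hv hij)
      simpa [hu.le_iff_le] using this
  have hsq : ∑ i, (u (σ i) : ℤ) ^ 2 = ∑ i, (u i : ℤ) ^ 2 :=
    Equiv.sum_comp σ fun i => (u i : ℤ) ^ 2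
  zify
  simp only [sq_abs, sub_sq, Finset.sum_add_distrib, Finset.sum_sub_distrib, mul_assoc,
    ← Finset.mul_sum]
  linarith

theorem eventually_det_gaussianMatrix_pos {k n : ℕ} {u v : Fin k → Fin n}
    (hu : StrictMono u) (hv : StrictMono v) :
    ∀ᶠ q in nhdsWithin (0 : ℝ) (Set.Ioi 0), 0 < ((gaussianMatrix n q).submatrix u v).det := by
  let E (σ : Equiv.Perm (Fin k)) : ℕ := ∑ i, ((u (σ i) : ℤ) - (v i : ℤ)).natAbs ^ 2
  let h (q : ℝ) : ℝ := ∑ σ : Equiv.Perm (Fin k), (Equiv.Perm.sign σ : ℝ) * q ^ (E σ - E 1)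
  have hE (σ : Equiv.Perm (Fin k)) (hσ : σ ≠ 1) : E 1 < E σ := sum_natAbs_sub_sq_lt hu hv hσ
  have hdet (q : ℝ) : ((gaussianMatrix n q).submatrix u v).det = q ^ E 1 * h q := by
    rw [Matrix.det_apply', Finset.mul_sum]
    refine Finset.sum_congr rfl fun σ _ => ?_
    have hle : E 1 ≤ E σ := by
      rcases eq_or_ne σ 1 with rfl | hσ
      · exact le_rfl
      · exact (hE σ hσ).le
    have : ∏ i, (gaussianMatrix n q).submatrix u v (σ i) i = q ^ E σ := by
      simp only [gaussianMatrix, Matrix.submatrix_apply, Matrix.of_apply]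
      exact Finset.prod_pow_eq_pow_sum _ _ _
    rw [this, mul_left_comm, ← pow_add, Nat.add_sub_cancel' hle]
  have hcont : Continuous h := by fun_prop
  have h0 : h 0 = 1 := by
    simp only [h]
    rw [Finset.sum_eq_single 1 (fun σ _ hσ => ?_) (by simp)]
    · simp
    · rw [zero_pow (Nat.sub_ne_zero_of_lt (hE σ hσ)), mul_zero]
  have hev : ∀ᶠ q in nhdsWithin (0 : ℝ) (Set.Ioi 0), 0 < h q :=
    (hcont.tendsto 0).eventually_const_lt (h0 ▸ zero_lt_one) |>.filter_mono nhdsWithin_le_nhds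
  filter_upwards [hev, self_mem_nhdsWithin] with q hq hq0
  rw [hdet]
  exact mul_pos (pow_pos hq0 _) hq

theorem eventually_forall_det_gaussianMatrix_pos (k n : ℕ) :
    ∀ᶠ q in nhdsWithin (0 : ℝ) (Set.Ioi 0), ∀ u v : Fin k → Fin n, StrictMono u → StrictMono v →
      0 < ((gaussianMatrix n q).submatrix u v).det := by
  simp only [Filter.eventually_all]
  exact fun u v hu hv => eventually_det_gaussianMatrix_pos hu hv

end GaussianKernel

section Supermodularity

/-- The lattice of strictly increasing maps, with pointwise operations. -/
def strictMonoSublattice (k n : ℕ) : Sublattice (Fin k → Fin n) where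
  carrier := {u | StrictMono u}
  supClosed' := fun _ hu _ hv _ _ hij => max_lt_max (hu hij) (hv hij)
  infClosed' := fun _ hu _ hv _ _ hij => min_lt_min (hu hij) (hv hij)

theorem strictMonoSublattice.exists_update_of_covBy {k n : ℕ} {u w : strictMonoSublattice k n}
    (h : u ⋖ w) : ∃ (p : Fin k) (a : Fin n), (a : ℕ) = u.1 p + 1 ∧
      w.1 = Function.update u.1 p a := by
  obtain ⟨u, hu⟩ := u
  obtain ⟨w, hw⟩ := w
  have hu' : StrictMono u := hu
  have hw' : StrictMono w := hw
  have hle : u ≤ w := h.lt.le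
  have hne : (Finset.univ.filter fun i => u i < w i).Nonempty := by
    by_contra hemp
    rw [Finset.not_nonempty_iff_eq_empty, Finset.filter_eq_empty_iff] at hemp
    refine h.lt.ne (Subtype.ext (funext fun i => le_antisymm (hle i) ?_))
    exact not_lt.mp (hemp (Finset.mem_univ i))
  obtain ⟨p, hp, hmax⟩ := Finset.exists_max_image _ id hne
  simp only [Finset.mem_filter, Finset.mem_univ, true_and, id] at hp hmax
  have hlt : (u p : ℕ) + 1 < n := lt_of_le_of_lt (Fin.lt_def.mp hp) (w p).isLt
  refine ⟨p, ⟨u p + 1, hlt⟩, rfl, ?_⟩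
  set a : Fin n := ⟨u p + 1, hlt⟩ with ha
  have hua : u p < a := by rw [Fin.lt_def]; simp [ha]
  have haw : a ≤ w p := Fin.lt_def.mp hp
  have hmono : StrictMono (Function.update u p a) := by
    intro i j hij
    rcases eq_or_ne i p with rfl | hi
    · have hj : u j = w j := by
        refine le_antisymm (hle j) (not_lt.mp fun hj => ?_)
        exact (hmax j hj).not_gt hij
      rw [Function.update_self, Function.update_of_ne hij.ne', hj]
      exact haw.trans_lt (hw' hij)
    · rcases eq_or_ne j p with rfl | hj
      · rw [Function.update_self, Function.update_of_ne hi]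
        exact (hu' hij).trans hua
      · rw [Function.update_of_ne hi, Function.update_of_ne hj]
        exact hu' hij
  have h₁ : (⟨u, hu⟩ : strictMonoSublattice k n) < ⟨Function.update u p a, hmono⟩ :=
    show u < Function.update u p a by simpa using hua
  have h₂ : (⟨Function.update u p a, hmono⟩ : strictMonoSublattice k n) ≤ ⟨w, hw⟩ :=
    show Function.update u p a ≤ w from _root_.update_le_iff.mpr ⟨haw, fun j _ => hle j⟩
  exact congrArg Subtype.val (h₂.eq_or_lt.resolve_right (h.2 h₁)).symm

variable {n n' k : ℕ} {A : Matrix (Fin n) (Fin n') ℝ}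

theorem MinorsNonneg.rows_square (hA : MinorsNonneg k A) {u u' : strictMonoSublattice k n}
    {v : Fin k → Fin n'} (hv : StrictMono v) (h : u ⊓ u' ⋖ u) (h' : u ⊓ u' ⋖ u') :
    (A.submatrix u.1 v).det * (A.submatrix u'.1 v).det ≤
      (A.submatrix (u ⊓ u').1 v).det * (A.submatrix (u ⊔ u').1 v).det := by
  obtain ⟨p, a, ha, hu⟩ := strictMonoSublattice.exists_update_of_covBy h
  obtain ⟨q, b, hb, hu'⟩ := strictMonoSublattice.exists_update_of_covBy h'
  have hsup : (u ⊔ u').1 = u.1 ⊔ u'.1 := rfl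
  have hz : StrictMono (u ⊓ u').1 := (u ⊓ u').2
  have hua : StrictMono u.1 := u.2
  have hub : StrictMono u'.1 := u'.2
  have hpq : p ≠ q := by
    rintro rfl
    have : u = u' := Subtype.ext (by rw [hu, hu', Fin.ext (ha.trans hb.symm)])
    subst this
    exact h.lt.ne (inf_idem u)
  generalize (u ⊓ u').1 = z at *
  have hza : z p ≤ a := by rw [Fin.le_def]; omega
  have hzb : z q ≤ b := by rw [Fin.le_def]; omega
  have hsup' : u.1 ⊔ u'.1 = Function.update (Function.update z p a) q b := by
    ext i
    rw [hu, hu', Pi.sup_apply]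
    simp only [Function.update_apply]
    split_ifs <;> simp_all
  rw [hu] at hua
  rw [hu'] at hub
  rw [hsup, hsup', hu, hu']
  rcases lt_or_gt_of_ne hpq with hlt | hlt
  · exact hA.rows_square_of_lt hz hv hlt ha hb hua hub
  · rw [Function.update_comm hpq, mul_comm]
    exact hA.rows_square_of_lt hz hv hlt hb ha hub hua

theorem MinorsNonneg.cover_square (h₀ : MinorsNonneg k A) (h₂ : MinorsNonneg (k + 2) A)
    {z u : strictMonoSublattice (k + 1) n} {t v : strictMonoSublattice (k + 1) n'}
    (hu : z ⋖ u) (hv : t ⋖ v) :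
    (A.submatrix u.1 t.1).det * (A.submatrix z.1 v.1).det ≤
      (A.submatrix z.1 t.1).det * (A.submatrix u.1 v.1).det := by
  obtain ⟨p, a, ha, hu'⟩ := strictMonoSublattice.exists_update_of_covBy hu
  obtain ⟨q, b, hb, hv'⟩ := strictMonoSublattice.exists_update_of_covBy hv
  have hum : StrictMono u.1 := u.2
  have hvm : StrictMono v.1 := v.2
  rw [hu'] at hum ⊢
  rw [hv'] at hvm ⊢
  exact h₀.mixed_square h₂ z.2 t.2 (by rw [Fin.lt_def]; omega) (by rw [Fin.lt_def]; omega) hum hvm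

/-- The minors of order `k + 1` of a matrix are log-supermodular when they are positive and the
minors of orders `k` and `k + 2` are nonnegative. -/
theorem MinorsNonneg.det_mul_det_le (h₀ : MinorsNonneg k A) (h₂ : MinorsNonneg (k + 2) A)
    (hpos : ∀ (u : Fin (k + 1) → Fin n) (v : Fin (k + 1) → Fin n'), StrictMono u → StrictMono v →
      0 < (A.submatrix u v).det) {u u' : Fin (k + 1) → Fin n} {v v' : Fin (k + 1) → Fin n'}
    (hu : StrictMono u) (hu' : StrictMono u') (hv : StrictMono v) (hv' : StrictMono v') :
    (A.submatrix u v).det * (A.submatrix u' v').det ≤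
      (A.submatrix (u ⊓ u') (v ⊓ v')).det * (A.submatrix (u ⊔ u') (v ⊔ v')).det := by
  have h₁ : MinorsNonneg (k + 1) A := fun u v hu hv => (hpos u v hu hv).le
  let f (x : strictMonoSublattice (k + 1) n × strictMonoSublattice (k + 1) n') : ℝ :=
    (A.submatrix x.1.1 x.2.1).det
  refine mul_le_inf_mul_sup_of_covBy (f := f) (fun x => hpos _ _ x.1.2 x.2.2) ?_
    (⟨u, hu⟩, ⟨v, hv⟩) (⟨u', hu'⟩, ⟨v', hv'⟩)
  rintro ⟨u, v⟩ ⟨u', v'⟩ hx hy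
  rw [Prod.mk_inf_mk, Prod.mk_covBy_mk_iff] at hx hy
  rw [Prod.mk_inf_mk, Prod.mk_sup_mk]
  rcases hx with ⟨hx, ex⟩ | ⟨hx, ex⟩ <;> rcases hy with ⟨hy, ey⟩ | ⟨hy, ey⟩
  · obtain rfl : v = v' := ex.symm.trans ey
    rw [inf_idem, sup_idem]
    exact h₁.rows_square v.2 hx hy
  · rw [ey, ex, sup_eq_left.mpr (inf_eq_right.mp ey), sup_eq_right.mpr (inf_eq_left.mp ex)]
    rw [ey] at hx
    rw [ex] at hy
    exact h₀.cover_square h₂ hx hy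
  · rw [ey, ex, sup_eq_right.mpr (inf_eq_left.mp ex), sup_eq_left.mpr (inf_eq_right.mp ey)]
    rw [ex] at hy
    rw [ey] at hx
    rw [mul_comm]
    exact h₀.cover_square h₂ hy hx
  · obtain rfl : u = u' := ex.symm.trans ey
    rw [inf_idem, sup_idem]
    have := h₁.transpose.rows_square u.2 hx hy
    simpa only [← Matrix.transpose_submatrix, Matrix.det_transpose] using this

theorem det_submatrix_mul_le_of_minorsNonneg {A : Matrix (Fin n) (Fin n) ℝ}
    (h₀ : MinorsNonneg k A) (h₁ : MinorsNonneg (k + 1) A) (h₂ : MinorsNonneg (k + 2) A)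
    {u u' v v' : Fin (k + 1) → Fin n}
    (hu : StrictMono u) (hu' : StrictMono u') (hv : StrictMono v) (hv' : StrictMono v') :
    (A.submatrix u v).det * (A.submatrix u' v').det ≤
      (A.submatrix (u ⊓ u') (v ⊓ v')).det * (A.submatrix (u ⊔ u') (v ⊔ v')).det := by
  have hinf : StrictMono (u ⊓ u') := fun _ _ hij => min_lt_min (hu hij) (hu' hij)
  have hinf' : StrictMono (v ⊓ v') := fun _ _ hij => min_lt_min (hv hij) (hv' hij)
  have hsup : StrictMono (u ⊔ u') := fun _ _ hij => max_lt_max (hu hij) (hu' hij)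
  have hsup' : StrictMono (v ⊔ v') := fun _ _ hij => max_lt_max (hv hij) (hv' hij)
  rcases (h₁ u v hu hv).eq_or_lt with h | hpos
  · rw [← h, zero_mul]
    exact mul_nonneg (h₁ _ _ hinf hinf') (h₁ _ _ hsup hsup')
  let B (q : ℝ) : Matrix (Fin n) (Fin n) ℝ := gaussianMatrix n q * A * gaussianMatrix n q
  have hB : Continuous B :=
    ((continuous_gaussianMatrix n).matrix_mul continuous_const).matrix_mul
      (continuous_gaussianMatrix n)
  have hB0 : B 0 = A := by simp [B, gaussianMatrix_zero]
  have hdet (s t : Fin (k + 1) → Fin n) : Filter.Tendsto (fun q => ((B q).submatrix s t).det)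
      (nhdsWithin 0 (Set.Ioi 0)) (nhds (A.submatrix s t).det) := by
    have : Continuous fun q => ((B q).submatrix s t).det := (hB.matrix_submatrix s t).matrix_det
    have h := this.tendsto 0
    rw [hB0] at h
    exact h.mono_left nhdsWithin_le_nhds
  refine le_of_tendsto_of_tendsto ((hdet u v).mul (hdet u' v')) ((hdet _ _).mul (hdet _ _)) ?_
  filter_upwards [eventually_forall_det_gaussianMatrix_pos k n,
    eventually_forall_det_gaussianMatrix_pos (k + 1) n,
    eventually_forall_det_gaussianMatrix_pos (k + 2) n] with q g₀ g₁ g₂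
  have nonneg {m : ℕ} (g : ∀ u v : Fin m → Fin n, StrictMono u → StrictMono v →
      0 < ((gaussianMatrix n q).submatrix u v).det) : MinorsNonneg m (gaussianMatrix n q) :=
    fun s t hs ht => (g s t hs ht).le
  refine (((nonneg g₀).mul h₀).mul (nonneg g₀)).det_mul_det_le
    (((nonneg g₂).mul h₂).mul (nonneg g₂)) (fun s t hs ht => ?_) hu hu' hv hv'
  exact ((nonneg g₁).mul h₁).det_submatrix_mul_pos (nonneg g₁) hs hv ht
    ((nonneg g₁).det_submatrix_mul_pos h₁ hs hu hv (g₁ s u hs hu) hpos) (g₁ v t hv ht)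

end Supermodularity

section Minors

variable {p q k : ℕ}

theorem minor_eq_det_orderEmbOfFin (A : Matrix (Fin p) (Fin q) ℝ) {I : Finset (Fin p)}
    {J : Finset (Fin q)} (hI : I.card = k) (hJ : J.card = k) :
    minor A I J = (A.submatrix (I.orderEmbOfFin hI) (J.orderEmbOfFin hJ)).det := by
  subst hI
  rw [minor, dif_pos hJ]
  rfl

theorem minor_image (A : Matrix (Fin p) (Fin q) ℝ) {u : Fin k → Fin p} {v : Fin k → Fin q}
    (hu : StrictMono u) (hv : StrictMono v) :
    minor A (Finset.univ.image u) (Finset.univ.image v) = (A.submatrix u v).det := by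
  have hI : (Finset.univ.image u).card = k := by
    rw [Finset.card_image_of_injective _ hu.injective, Finset.card_fin]
  have hJ : (Finset.univ.image v).card = k := by
    rw [Finset.card_image_of_injective _ hv.injective, Finset.card_fin]
  rw [minor_eq_det_orderEmbOfFin A hI hJ,
    ← Finset.orderEmbOfFin_unique hI (fun x => Finset.mem_image_of_mem u (Finset.mem_univ x)) hu,
    ← Finset.orderEmbOfFin_unique hJ (fun x => Finset.mem_image_of_mem v (Finset.mem_univ x)) hv]

theorem TNN.minorsNonneg {A : Matrix (Fin p) (Fin q) ℝ} (hA : TNN A) (m : ℕ) :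
    MinorsNonneg m A := by
  intro u v hu hv
  rw [← minor_image A hu hv]
  exact hA _ _

end Minors

/-- Lam–Postnikov–Pylyavskyy (numerical part): for a totally nonnegative matrix `A`,
`det A_{P,Q} · det A_{R,S} ≤ det A_{min(P,R),min(Q,S)} · det A_{max(P,R),max(Q,S)}`. -/
theorem stmt_7 (n k : ℕ) (hk : 1 ≤ k) (hkn : k ≤ n)
    (P Q R S : Finset (Fin n))
    (hP : P.card = k) (hQ : Q.card = k) (hR : R.card = k) (hS : S.card = k)
    (A : Matrix (Fin n) (Fin n) ℝ) (hA : TNN A) :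
    minor A P Q * minor A R S ≤
      minor A (cmin P R hP hR) (cmin Q S hQ hS) * minor A (cmax P R hP hR) (cmax Q S hQ hS) := by
  obtain ⟨m, rfl⟩ : ∃ m, k = m + 1 := ⟨k - 1, by omega⟩
  have hinf {I J : Finset (Fin n)} (hI : I.card = m + 1) (hJ : J.card = m + 1) :
      StrictMono (⇑(I.orderEmbOfFin hI) ⊓ ⇑(J.orderEmbOfFin hJ)) := fun _ _ hij =>
    min_lt_min ((I.orderEmbOfFin hI).strictMono hij) ((J.orderEmbOfFin hJ).strictMono hij)
  have hsup {I J : Finset (Fin n)} (hI : I.card = m + 1) (hJ : J.card = m + 1) :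
      StrictMono (⇑(I.orderEmbOfFin hI) ⊔ ⇑(J.orderEmbOfFin hJ)) := fun _ _ hij =>
    max_lt_max ((I.orderEmbOfFin hI).strictMono hij) ((J.orderEmbOfFin hJ).strictMono hij)
  have h := det_submatrix_mul_le_of_minorsNonneg (hA.minorsNonneg m) (hA.minorsNonneg (m + 1))
    (hA.minorsNonneg (m + 2)) (P.orderEmbOfFin hP).strictMono (R.orderEmbOfFin hR).strictMono
    (Q.orderEmbOfFin hQ).strictMono (S.orderEmbOfFin hS).strictMono
  rw [← minor_image A (hinf hP hR) (hinf hQ hS), ← minor_image A (hsup hP hR) (hsup hQ hS),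
    ← minor_eq_det_orderEmbOfFin A hP hQ, ← minor_eq_det_orderEmbOfFin A hR hS] at h
  exact h
end

section
/- Let n ≥ 1 be an integer and let λ, μ ∈ ℝ^n satisfy λ_1 > λ_2 > ⋯ > λ_n ≥ 0, μ_1 > μ_2 > ⋯ > μ_n ≥ 0, and λ_j ≥ μ_j for all j. Let u, v ∈ ℝ^n satisfy u_1 > u_2 > ⋯ > u_n > 0, v_1 > v_2 > ⋯ > v_n > 0, and u_i ≤ v_i for all i. Then det(v_i^{λ_j})_{i,j=1}^n · det(u_i^{μ_j})_{i,j=1}^n ≥ det(u_i^{λ_j})_{i,j=1}^n · det(v_i^{μ_j})_{i,j=1}^n, where x^a denotes the real power of x > 0 by a ∈ ℝ. (This is the coordinatewise monotonicity of the ratio of generalized Vandermonde determinants u ↦ det(u_i^{λ_j})/det(u_i^{μ_j}), stated in cross-multiplied form; for Young-diagram-nested partitions λ ⊇ μ it gives the coordinatewise monotonicity of the ratio of Schur polynomials s_λ/s_μ on the positive orthant.) -/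
/-- The generalized Vandermonde determinant `det (f i ^ g j)` with nodes `f` and real
exponents `g`. -/
noncomputable def vandermondeRpow {n : ℕ} (f g : Fin n → ℝ) : ℝ :=
  (Matrix.of fun i j : Fin n => f i ^ g j).det

/-- **Descartes' rule of signs**, weak form: a linear combination of `n` distinct real powers with
`n` distinct positive zeros is trivial. -/
theorem eq_zero_of_sum_mul_rpow_eq_zero {n : ℕ} (f g c : Fin n → ℝ) (hf : StrictAnti f)
    (hpos : ∀ i, 0 < f i) (hg : Function.Injective g)
    (hz : ∀ i, ∑ j, c j * f i ^ g j = 0) : c = 0 := by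
  induction n with
  | zero => exact Subsingleton.elim _ _
  | succ n ih =>
    let F : ℝ → ℝ := fun x => ∑ j, c j * x ^ (g j - g 0)
    let F' : ℝ → ℝ := fun x => ∑ j, c j * ((g j - g 0) * x ^ (g j - g 0 - 1))
    have hF : ∀ x, 0 < x → HasDerivAt F (F' x) x := fun x hx =>
      HasDerivAt.fun_sum fun j _ =>
        (Real.hasDerivAt_rpow_const (Or.inl hx.ne')).const_mul (c j)
    have hFz : ∀ i, F (f i) = 0 := by
      intro i
      simp only [F, Real.rpow_sub (hpos i), ← mul_div_assoc]
      rw [← Finset.sum_div, hz i, zero_div]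
    have hroot : ∀ i : Fin n, ∃ t ∈ Set.Ioo (f i.succ) (f i.castSucc), F' t = 0 := by
      intro i
      refine exists_hasDerivAt_eq_zero (hf i.castSucc_lt_succ) ?_ ((hFz _).trans (hFz _).symm) ?_
      · exact fun x hx => (hF x ((hpos _).trans_le hx.1)).continuousAt.continuousWithinAt
      · exact fun x hx => hF x ((hpos _).trans hx.1)
    choose t ht ht0 using hroot
    have htanti : StrictAnti t := fun i j hij =>
      (ht j).2.trans_le ((hf.antitone (Fin.succ_le_castSucc_iff.2 hij)).trans (ht i).1.le)
    have hc := ih t (fun j => g j.succ - g 0 - 1) (fun j => c j.succ * (g j.succ - g 0)) htanti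
      (fun i => (hpos _).trans (ht i).1)
      (fun i j h => Fin.succ_injective _ (hg (by simpa using h)))
      (fun i => by simpa [F', Fin.sum_univ_succ, mul_assoc] using ht0 i)
    have hsucc : ∀ j : Fin n, c j.succ = 0 := fun j =>
      (mul_eq_zero.1 (congrFun hc j)).resolve_right
        (sub_ne_zero.2 fun h => Fin.succ_ne_zero j (hg h))
    have h0 : c 0 = 0 := by
      have h := hz 0
      rw [Fin.sum_univ_succ] at h
      simpa [hsucc, (Real.rpow_pos_of_pos (hpos 0) _).ne'] using h
    exact funext (Fin.cases h0 hsucc)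

theorem vandermondeRpow_ne_zero {n : ℕ} {f g : Fin n → ℝ} (hf : StrictAnti f)
    (hpos : ∀ i, 0 < f i) (hg : Function.Injective g) : vandermondeRpow f g ≠ 0 := by
  intro h
  obtain ⟨c, hc, hz⟩ := Matrix.exists_mulVec_eq_zero_iff.2 h
  refine hc (eq_zero_of_sum_mul_rpow_eq_zero f g c hf hpos hg fun i => ?_)
  simpa [Matrix.mulVec, dotProduct, mul_comm] using congrFun hz i

/-- Generalized Vandermonde determinants with decreasing nodes and exponents are positive: deform
the exponents to `0, -1, -2, …`, where the determinant is an ordinary Vandermonde determinant. -/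
theorem vandermondeRpow_pos {n : ℕ} {f g : Fin n → ℝ} (hf : StrictAnti f)
    (hpos : ∀ i, 0 < f i) (hg : StrictAnti g) : 0 < vandermondeRpow f g := by
  let G : ℝ → Fin n → ℝ := fun t j => (1 - t) * g j + t * (-(j : ℝ))
  have hG : ∀ t ∈ Set.Icc (0 : ℝ) 1, StrictAnti (G t) := by
    intro t ht i j hij
    have h1 := hg hij
    have h2 : (i : ℝ) < j := by exact_mod_cast hij
    simp only [G]
    rcases eq_or_lt_of_le ht.1 with rfl | h0
    · linarith
    · nlinarith [mul_nonneg (sub_nonneg.2 ht.2) (sub_nonneg.2 h1.le), mul_pos h0 (sub_pos.2 h2)]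
  have hcont : Continuous fun t => vandermondeRpow f (G t) := by
    refine Continuous.matrix_det (continuous_matrix fun i j => ?_)
    exact Continuous.rpow continuous_const (by fun_prop) fun _ => Or.inl (hpos i).ne'
  have hone : 0 < vandermondeRpow f (G 1) := by
    have h : vandermondeRpow f (G 1) = (Matrix.vandermonde fun i => (f i)⁻¹).det := by
      refine congrArg Matrix.det (Matrix.ext fun i j => ?_)
      simp [G, Matrix.vandermonde_apply]
    rw [h, Matrix.det_vandermonde]
    refine Finset.prod_pos fun i _ => Finset.prod_pos fun j hj => sub_pos.2 ?_
    exact inv_strictAnti₀ (hpos j) (hf (Finset.mem_Ioi.1 hj))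
  have hzero : G 0 = g := by ext j; simp [G]
  by_contra! hle
  obtain ⟨t, ht, h0⟩ := intermediate_value_Icc zero_le_one hcont.continuousOn
    (show (0 : ℝ) ∈ Set.Icc _ _ from ⟨by rwa [hzero], hone.le⟩)
  exact vandermondeRpow_ne_zero hf hpos (hG t ht).injective h0

theorem vandermondeRpow_insertNth {n : ℕ} (k m : Fin (n + 1)) (a b : ℝ) (p q : Fin n → ℝ) :
    vandermondeRpow (k.insertNth a p : Fin (n + 1) → ℝ) (m.insertNth b q : Fin (n + 1) → ℝ) =
      (-1) ^ ((k : ℕ) + m) *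
        vandermondeRpow (Fin.cons a p : Fin (n + 1) → ℝ) (Fin.cons b q : Fin (n + 1) → ℝ) := by
  let A : Matrix (Fin (n + 1)) (Fin (n + 1)) ℝ := Matrix.of fun i j =>
    (k.insertNth a p : Fin (n + 1) → ℝ) i ^ (m.insertNth b q : Fin (n + 1) → ℝ) j
  have h : vandermondeRpow (Fin.cons a p : Fin (n + 1) → ℝ) (Fin.cons b q : Fin (n + 1) → ℝ) =
      ((A.submatrix k.cycleRange.symm id).submatrix id m.cycleRange.symm).det := by
    rw [← Fin.insertNth_comp_cycleRange_symm k a p, ← Fin.insertNth_comp_cycleRange_symm m b q]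
    rfl
  rw [h, Matrix.det_permute', Matrix.det_permute, Equiv.Perm.sign_symm, Equiv.Perm.sign_symm,
    Fin.sign_cycleRange, Fin.sign_cycleRange]
  have hs : ∀ x y : ℕ, ((-1 : ℝ) ^ (x + y)) * ((-1) ^ y * ((-1) ^ x)) = 1 := by
    intro x y
    rw [mul_comm ((-1 : ℝ) ^ y), ← pow_add, ← mul_pow]
    simp
  have hA : vandermondeRpow (k.insertNth a p : Fin (n + 1) → ℝ)
      (m.insertNth b q : Fin (n + 1) → ℝ) = A.det := rfl
  push_cast
  linear_combination hA - A.det * hs k m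

/-- The Schur complement formula for the block of nodes and exponents indexed by `Fin n`. -/
theorem exists_vandermondeRpow_eq_mul_det {n : ℕ} (p q : Fin n → ℝ)
    (h : vandermondeRpow p q ≠ 0) :
    ∃ S : ℝ → ℝ → ℝ, ∀ (m N : ℕ) (e : Fin m ⊕ Fin n ≃ Fin N) (f g : Fin N → ℝ),
      (∀ i, f (e (Sum.inr i)) = p i) → (∀ i, g (e (Sum.inr i)) = q i) →
      vandermondeRpow f g = vandermondeRpow p q *
        (Matrix.of fun i j : Fin m => S (f (e (Sum.inl i))) (g (e (Sum.inl j)))).det := by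
  let A : Matrix (Fin n) (Fin n) ℝ := Matrix.of fun i j => p i ^ q j
  have : Invertible A := A.invertibleOfIsUnitDet (isUnit_iff_ne_zero.2 h)
  refine ⟨fun a b => a ^ b - ∑ j, (∑ i, a ^ q i * (⅟A) i j) * p j ^ b, ?_⟩
  intro m N e f g hf hg
  have hblock : (Matrix.of fun i j : Fin N => f i ^ g j).submatrix e e =
      Matrix.fromBlocks (Matrix.of fun i j => f (e (Sum.inl i)) ^ g (e (Sum.inl j)))
        (Matrix.of fun i j => f (e (Sum.inl i)) ^ q j)
        (Matrix.of fun i j => p i ^ g (e (Sum.inl j))) A := by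
    ext (i | i) (j | j) <;> simp [A, hf, hg]
  rw [vandermondeRpow, ← Matrix.det_submatrix_equiv_self e, hblock, Matrix.det_fromBlocks₂₂]
  rfl

/-- **Sylvester's determinant identity** for generalized Vandermonde determinants bordered by two
nodes and two exponents. -/
theorem vandermondeRpow_sylvester {n : ℕ} (p q : Fin n → ℝ) (h : vandermondeRpow p q ≠ 0)
    (a a' b b' : ℝ) :
    vandermondeRpow p q * vandermondeRpow (Fin.cons a (Fin.cons a' p : Fin (n + 1) → ℝ))
        (Fin.cons b (Fin.cons b' q : Fin (n + 1) → ℝ)) =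
      vandermondeRpow (Fin.cons a p : Fin (n + 1) → ℝ) (Fin.cons b q : Fin (n + 1) → ℝ) *
        vandermondeRpow (Fin.cons a' p : Fin (n + 1) → ℝ) (Fin.cons b' q : Fin (n + 1) → ℝ) -
      vandermondeRpow (Fin.cons a p : Fin (n + 1) → ℝ) (Fin.cons b' q : Fin (n + 1) → ℝ) *
        vandermondeRpow (Fin.cons a' p : Fin (n + 1) → ℝ) (Fin.cons b q : Fin (n + 1) → ℝ) := by
  obtain ⟨S, hS⟩ := exists_vandermondeRpow_eq_mul_det p q h
  let e₁ : Fin 1 ⊕ Fin n ≃ Fin (n + 1) := finSumFinEquiv.trans (finCongr (Nat.add_comm 1 n))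
  let e₂ : Fin 2 ⊕ Fin n ≃ Fin (n + 2) := finSumFinEquiv.trans (finCongr (Nat.add_comm 2 n))
  have he₁ : ∀ i, e₁ (Sum.inr i) = i.succ := fun i => Fin.ext (by simp [e₁])
  have he₁' : e₁ (Sum.inl 0) = 0 := Fin.ext (by simp [e₁])
  have he₂ : ∀ i, e₂ (Sum.inr i) = i.succ.succ := fun i =>
    Fin.ext (by simp [e₂, Nat.add_comm]; omega)
  have he₂' : e₂ (Sum.inl 0) = 0 := Fin.ext (by simp [e₂])
  have he₂'' : e₂ (Sum.inl 1) = Fin.succ 0 := Fin.ext (by simp [e₂])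
  have hborder : ∀ x y,
      vandermondeRpow (Fin.cons x p : Fin (n + 1) → ℝ) (Fin.cons y q : Fin (n + 1) → ℝ) =
        vandermondeRpow p q * S x y := by
    intro x y
    rw [hS 1 (n + 1) e₁ _ _ (fun i => by rw [he₁, Fin.cons_succ])
      (fun i => by rw [he₁, Fin.cons_succ]), Matrix.det_fin_one, Matrix.of_apply, he₁',
      Fin.cons_zero, Fin.cons_zero]
  rw [hS 2 (n + 2) e₂ _ _ (fun i => by rw [he₂, Fin.cons_succ, Fin.cons_succ])
    (fun i => by rw [he₂, Fin.cons_succ, Fin.cons_succ]), Matrix.det_fin_two]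
  simp only [Matrix.of_apply, he₂', he₂'', Fin.cons_zero, Fin.cons_succ, hborder]
  ring

theorem Fin.strictAnti_insertNth_castSucc {n : ℕ} {α : Type*} [Preorder α] {w : Fin (n + 1) → α}
    (hw : StrictAnti w) {k : Fin (n + 1)} {x : α} (hx : w k < x)
    (hwx : StrictAnti (Function.update w k x)) :
    StrictAnti (k.castSucc.insertNth x w : Fin (n + 2) → α) := by
  refine (Fin.strictMono_insertNth_iff (α := αᵒᵈ) k.castSucc x w).2
    ⟨fun _ _ hij => hw hij, fun i hi => ?_, fun i hi => ?_⟩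
  · have hik : i < k := Fin.castSucc_lt_castSucc_iff.1 hi
    have h := hwx hik
    rwa [Function.update_self, Function.update_of_ne hik.ne] at h
  · exact (hw.antitone (Fin.castSucc_le_castSucc_iff.1 hi)).trans_lt hx

/-- Raising a single node and a single exponent. -/
theorem vandermondeRpow_update_mul_le {n : ℕ} {f g : Fin n → ℝ} {k m : Fin n} {x y : ℝ}
    (hf : StrictAnti f) (hpos : ∀ i, 0 < f i) (hg : StrictAnti g) (hx : f k ≤ x) (hy : g m ≤ y)
    (hfx : StrictAnti (Function.update f k x)) (hgy : StrictAnti (Function.update g m y)) :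
    vandermondeRpow f (Function.update g m y) * vandermondeRpow (Function.update f k x) g ≤
      vandermondeRpow (Function.update f k x) (Function.update g m y) * vandermondeRpow f g := by
  rcases hx.eq_or_lt with rfl | hx
  · simp [mul_comm]
  rcases hy.eq_or_lt with rfl | hy
  · simp [mul_comm]
  obtain _ | n := n
  · exact k.elim0
  set p := k.removeNth f
  set q := m.removeNth g
  have hp_anti : StrictAnti p := hf.comp_strictMono (Fin.strictMono_succAbove k)
  have hq_anti : StrictAnti q := hg.comp_strictMono (Fin.strictMono_succAbove m)
  have hcore : 0 < vandermondeRpow p q := vandermondeRpow_pos hp_anti (fun i => hpos _) hq_anti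
  have hbig : 0 < vandermondeRpow (Fin.cons (f k) (Fin.cons x p : Fin (n + 1) → ℝ))
      (Fin.cons (g m) (Fin.cons y q : Fin (n + 1) → ℝ)) := by
    have h := vandermondeRpow_pos (Fin.strictAnti_insertNth_castSucc hf hx hfx)
      (fun i => by
        induction i using Fin.succAboveCases k.castSucc with
        | x => simpa using (hpos k).trans hx
        | p i => simpa using hpos i)
      (Fin.strictAnti_insertNth_castSucc hg hy hgy)
    have hins : ∀ (k : Fin (n + 1)) (f : Fin (n + 1) → ℝ) (x : ℝ),
        (Fin.cons x f : Fin (n + 2) → ℝ) =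
          k.succ.insertNth (f k) (Fin.cons x (k.removeNth f) : Fin (n + 1) → ℝ) := by
      intro k f x
      rw [Fin.insertNth_succ_cons, Fin.insertNth_self_removeNth]
    rw [vandermondeRpow_insertNth, hins k f x, hins m g y, vandermondeRpow_insertNth,
      ← mul_assoc, ← pow_add] at h
    rwa [Even.neg_one_pow, one_mul] at h
    simp only [Fin.val_castSucc, Fin.val_succ]
    exact ⟨k + m + 1, by ring⟩
  have hf' : f = k.insertNth (f k) p := (Fin.insertNth_self_removeNth k f).symm
  have hg' : g = m.insertNth (g m) q := (Fin.insertNth_self_removeNth m g).symm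
  have hfx' : Function.update f k x = k.insertNth x p := (Fin.insertNth_removeNth k x f).symm
  have hgy' : Function.update g m y = m.insertNth y q := (Fin.insertNth_removeNth m y g).symm
  have hsylv := vandermondeRpow_sylvester p q hcore.ne' (f k) x (g m) y
  have hsign : (((-1 : ℝ) ^ ((k : ℕ) + m)) * (-1) ^ ((k : ℕ) + m)) = 1 := by
    rw [← mul_pow]; simp
  have hdet : ∀ x y, vandermondeRpow (k.insertNth x p : Fin (n + 1) → ℝ)
      (m.insertNth y q : Fin (n + 1) → ℝ) = (-1) ^ ((k : ℕ) + m) *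
        vandermondeRpow (Fin.cons x p : Fin (n + 1) → ℝ) (Fin.cons y q : Fin (n + 1) → ℝ) :=
    fun x y => vandermondeRpow_insertNth k m x y p q
  have hfg : vandermondeRpow f g = _ := (congrArg₂ vandermondeRpow hf' hg').trans (hdet _ _)
  have hfy : vandermondeRpow f (m.insertNth y q) = _ :=
    (congrArg (vandermondeRpow · _) hf').trans (hdet _ _)
  have hxg : vandermondeRpow (k.insertNth x p) g = _ :=
    (congrArg (vandermondeRpow _ ·) hg').trans (hdet _ _)
  rw [hfx', hgy', hfg, hfy, hxg, hdet, mul_mul_mul_comm, hsign, mul_mul_mul_comm, hsign]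
  have hprod := mul_pos hcore hbig
  rw [hsylv] at hprod
  linarith

/-- A function that increases whenever a single coordinate of a strictly decreasing vector is
raised, increases whenever all coordinates are. -/
theorem le_of_forall_update_le {n : ℕ} {β : Type*} [Preorder β] {u v : Fin n → ℝ}
    (hu : StrictAnti u) (hv : StrictAnti v) (huv : ∀ i, u i ≤ v i) (φ : (Fin n → ℝ) → β)
    (hφ : ∀ w, StrictAnti w → (∀ i, u i ≤ w i) → ∀ k x, w k ≤ x →
      StrictAnti (Function.update w k x) → φ w ≤ φ (Function.update w k x)) : φ u ≤ φ v := by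
  let W : ℕ → Fin n → ℝ := fun k i => if (i : ℕ) < k then v i else u i
  have hW : ∀ k, StrictAnti (W k) := by
    intro k i j hij
    have h1 := hu hij
    have h2 := hv hij
    have h3 := huv i
    have h4 : (i : ℕ) < j := hij
    simp only [W]
    split_ifs <;> first | omega | linarith
  have huW : ∀ k i, u i ≤ W k i := by
    intro k i
    simp only [W]
    split_ifs
    exacts [huv i, le_rfl]
  have hstep : ∀ k ≤ n, φ u ≤ φ (W k) := by
    intro k
    induction k with
    | zero => intro _; simp [W]
    | succ k ih =>
      intro hk
      have hupd : Function.update (W k) ⟨k, hk⟩ (v ⟨k, hk⟩) = W (k + 1) := by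
        ext i
        rcases eq_or_ne i ⟨k, hk⟩ with rfl | hi
        · simp [W]
        · have hik : (i : ℕ) ≠ k := fun h => hi (Fin.ext h)
          rw [Function.update_of_ne hi]
          simp only [W, show (i : ℕ) < k + 1 ↔ (i : ℕ) < k by omega]
      refine (ih (by omega)).trans ?_
      rw [← hupd]
      exact hφ _ (hW k) (huW k) _ _ (by simpa [W] using huv _) (hupd ▸ hW (k + 1))
  have hWn : W n = v := by ext i; simp [W]
  exact hWn ▸ hstep n le_rfl

/-- Khare–Tao: coordinatewise monotonicity of ratios of generalized Vandermonde determinants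
(in cross-multiplied form). If `λ₁ > ⋯ > λₙ ≥ 0`, `μ₁ > ⋯ > μₙ ≥ 0`, `λⱼ ≥ μⱼ` for all `j`,
and `u₁ > ⋯ > uₙ > 0`, `v₁ > ⋯ > vₙ > 0` with `uᵢ ≤ vᵢ` for all `i`, then
`det(vᵢ^{λⱼ}) · det(uᵢ^{μⱼ}) ≥ det(uᵢ^{λⱼ}) · det(vᵢ^{μⱼ})`, where `^` is the real power. -/
theorem stmt_8 (n : ℕ) (hn : 1 ≤ n) (lam mu u v : Fin n → ℝ)
    (hlam_anti : StrictAnti lam) (hlam_nonneg : ∀ j, 0 ≤ lam j)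
    (hmu_anti : StrictAnti mu) (hmu_nonneg : ∀ j, 0 ≤ mu j)
    (hlm : ∀ j, mu j ≤ lam j)
    (hu_anti : StrictAnti u) (hu_pos : ∀ i, 0 < u i)
    (hv_anti : StrictAnti v) (hv_pos : ∀ i, 0 < v i)
    (huv : ∀ i, u i ≤ v i) :
    Matrix.det (Matrix.of fun i j : Fin n => u i ^ lam j) *
        Matrix.det (Matrix.of fun i j : Fin n => v i ^ mu j) ≤
      Matrix.det (Matrix.of fun i j : Fin n => v i ^ lam j) *
        Matrix.det (Matrix.of fun i j : Fin n => u i ^ mu j) := by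
  change vandermondeRpow u lam * vandermondeRpow v mu ≤
    vandermondeRpow v lam * vandermondeRpow u mu
  rw [← div_le_div_iff₀ (vandermondeRpow_pos hu_anti hu_pos hmu_anti)
    (vandermondeRpow_pos hv_anti hv_pos hmu_anti)]
  refine le_of_forall_update_le hu_anti hv_anti huv
    (fun w => vandermondeRpow w lam / vandermondeRpow w mu) fun w hw huw k x hx hwx => ?_
  have hw_pos : ∀ i, 0 < w i := fun i => (hu_pos i).trans_le (huw i)
  have hwx_pos : ∀ i, 0 < Function.update w k x i :=
    (Function.forall_update_iff w fun _ b => 0 < b).2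
      ⟨(hw_pos k).trans_le hx, fun i _ => hw_pos i⟩
  have hlam := le_of_forall_update_le hmu_anti hlam_anti hlm
    (fun g => vandermondeRpow (Function.update w k x) g / vandermondeRpow w g)
    fun g hg _ m y hy hgy => by
      rw [div_le_div_iff₀ (vandermondeRpow_pos hw hw_pos hg) (vandermondeRpow_pos hw hw_pos hgy),
        mul_comm]
      exact vandermondeRpow_update_mul_le hw hw_pos hg hx hy hwx hgy
  rw [div_le_div_iff₀ (vandermondeRpow_pos hw hw_pos hmu_anti)
    (vandermondeRpow_pos hw hw_pos hlam_anti)] at hlam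
  rw [div_le_div_iff₀ (vandermondeRpow_pos hw hw_pos hmu_anti)
    (vandermondeRpow_pos hwx hwx_pos hmu_anti)]
  linarith
end

section
/- Let n ≥ 2 be an integer and let 0 ≤ k ≤ ⌊n/2⌋ − 1. For 0 ≤ ℓ ≤ n set ℐ_{n,ℓ} := { P ∪ ({n+1,…,2n} ∖ {2n+1−p : p ∈ P}) : P ⊆ {1,…,n}, |P| = ℓ }. Then for every full-rank 2n×n real matrix 𝒜 all of whose Plücker coordinates are nonnegative, C(n,k)^{−1} · ∑_{I∈ℐ_{n,k}} Δ_I(𝒜) Δ_{I^c}(𝒜) ≤ C(n,k+1)^{−1} · ∑_{I∈ℐ_{n,k+1}} Δ_I(𝒜) Δ_{I^c}(𝒜), where I^c := {1,…,2n} ∖ I and C(n,ℓ) denotes the binomial coefficient. (This is the Barrett–Johnson inequality in Plücker-coordinate form.) -/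
open Finset

/-- The Plücker coordinate `Δ_I(A)`: the determinant of the `m × m` submatrix of `A`
whose rows are indexed by `I` in increasing order (and all `m` columns);
junk value `0` when `I` does not have `m` elements. -/
noncomputable def pluck {N m : ℕ} (A : Matrix (Fin N) (Fin m) ℝ) (I : Finset (Fin N)) : ℝ :=
  if h : I.card = m then (A.submatrix (fun k => ((I.orderIsoOfFin h) k : Fin N)) id).det else 0

/-- `u ↦ u* = 2n + 1 - u` (in 1-indexed terms), i.e. `u ↦ 2n - 1 - u` for `Fin (2n)`. -/
def star (n : ℕ) (u : Fin (2 * n)) : Fin (2 * n) :=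
  ⟨2 * n - 1 - (u : ℕ), by have := u.isLt; omega⟩

/-- `ℐ_{n,ℓ}`: the Plücker index sets `P ∪ ({n+1, …, 2n} ∖ {2n+1-p : p ∈ P})` for
`P ⊆ {1, …, n}` with `|P| = ℓ` (0-indexed here). -/
def princFinset (n ℓ : ℕ) : Finset (Finset (Fin (2 * n))) :=
  (((Finset.univ.filter (fun x : Fin (2 * n) => (x : ℕ) < n)).powerset).filter
      (fun P => P.card = ℓ)).image
    (fun P => P ∪ ((Finset.univ.filter (fun x : Fin (2 * n) => n ≤ (x : ℕ))) \
      P.image (star n)))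

/-- `τ` is an involution whose arcs `{x, τ x}` do not cross. -/
structure IsNoncrossing {ι : Type*} [LinearOrder ι] (τ : ι → ι) : Prop where
  invol : ∀ x, τ (τ x) = x
  nested : ∀ x y, x < y → y < τ x → x < τ y ∧ τ y < τ x

/-- `(I, J)` is compatible with `τ` and `S`: on the fixed points of `τ` both agree with `S`,
and `I` and `J` contain complementary elements of each arc `{x, τ x}`. -/
def Compatible {ι : Type*} (τ : ι → ι) (S I J : Finset ι) : Prop :=
  ∀ x, (x ∈ J ↔ τ x ∈ I) ∧ (τ x = x → (x ∈ I ↔ x ∈ S)) ∧ (τ x ≠ x → (τ x ∈ I ↔ x ∉ I))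

/-- Make `a` and `b` fixed points and join their partners by an arc. -/
def joinArcs {ι : Type*} [DecidableEq ι] (τ : ι → ι) (a b : ι) : ι → ι := fun x =>
  if x = a ∨ x = b then x else if τ x = a then τ b else if τ x = b then τ a else τ x

theorem IsNoncrossing.joinArcs {ι : Type*} [LinearOrder ι] {τ : ι → ι}
    (h : IsNoncrossing τ) {a b : ι} (hab : a < b) (ha : τ a ≠ a) (hb : τ b ≠ b)
    (hc : ∀ x, a < x → x < b → τ x = x) :
    IsNoncrossing (joinArcs τ a b) := by
  obtain ⟨h1, h2⟩ := h
  have ha' := h1 a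
  have hb' := h1 b
  constructor
  · intro x
    have := h1 x
    unfold _root_.joinArcs
    grind
  · intro x y hxy
    have := h1 x
    have := h1 y
    have := h2 x y
    have := h2 y x
    have := h2 a x
    have := h2 a y
    have := h2 x a
    have := h2 y a
    have := h2 b x
    have := h2 b y
    have := h2 x b
    have := h2 y b
    have := h2 a b
    have := h2 b a
    have := h2 (τ a) x
    have := h2 (τ a) y
    have := h2 (τ b) x
    have := h2 (τ b) y
    have := h2 x (τ a)
    have := h2 x (τ b)
    have := h2 y (τ a)
    have := h2 y (τ b)
    have := hc x
    have := hc (τ x)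
    have := hc (τ y)
    have := hc y
    have := lt_trichotomy (τ x) a
    have := lt_trichotomy (τ x) b
    have := lt_trichotomy (τ y) a
    have := lt_trichotomy (τ y) b
    have := lt_trichotomy x a
    have := lt_trichotomy x b
    have := lt_trichotomy y a
    have := lt_trichotomy y b
    have := lt_trichotomy x (τ a)
    have := lt_trichotomy x (τ b)
    have := lt_trichotomy y (τ a)
    have := lt_trichotomy y (τ b)
    have := lt_trichotomy (τ a) b
    have := lt_trichotomy (τ b) a
    have := h2 a (τ y)
    have := h2 b (τ y)
    have := h2 (τ y) a
    have := h2 (τ y) b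
    clear h1 h2 hc
    unfold _root_.joinArcs
    grind

/-- The conjugate of `τ` by the transposition of `a` and `b`. -/
def conjSwap {ι : Type*} [DecidableEq ι] (τ : ι → ι) (a b : ι) : ι → ι := fun x =>
  Equiv.swap a b (τ (Equiv.swap a b x))

theorem IsNoncrossing.conjSwap {ι : Type*} [LinearOrder ι] {τ : ι → ι}
    (h : IsNoncrossing τ) {a b : ι} (hab : a < b) (hf : τ a = a ∨ τ b = b)
    (hc : ∀ x, a < x → x < b → τ x = x) :
    IsNoncrossing (conjSwap τ a b) := by
  obtain ⟨h1, h2⟩ := h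
  have ha' := h1 a
  have hb' := h1 b
  constructor
  · intro x
    simp [_root_.conjSwap, h1]
  · intro x y hxy
    have := h1 x
    have := h1 y
    have := h2 x y
    have := h2 y x
    have := h2 a x
    have := h2 a y
    have := h2 x a
    have := h2 y a
    have := h2 b x
    have := h2 b y
    have := h2 x b
    have := h2 y b
    have := h2 a b
    have := h2 b a
    have := hc x
    have := hc (τ x)
    have := hc (τ y)
    have := hc y
    have := hc (τ a)
    have := hc (τ b)
    have := lt_trichotomy (τ x) a
    have := lt_trichotomy (τ x) b
    have := lt_trichotomy (τ y) a
    have := lt_trichotomy (τ y) b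
    have := lt_trichotomy x a
    have := lt_trichotomy x b
    have := lt_trichotomy y a
    have := lt_trichotomy y b
    clear h1 h2 hc
    simp only [_root_.conjSwap, Equiv.swap_apply_def]
    grind

/-- Add the arc `{a, b}` if `a` and `b` are fixed, remove it if it is present. -/
def toggleArc {ι : Type*} [DecidableEq ι] (τ : ι → ι) (a b : ι) : ι → ι := fun x =>
  τ (Equiv.swap a b x)

theorem IsNoncrossing.addArc {ι : Type*} [LinearOrder ι] {τ : ι → ι}
    (h : IsNoncrossing τ) {a b : ι} (hab : a < b) (ha : τ a = a) (hb : τ b = b)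
    (hc : ∀ x, a < x → x < b → τ x = x) :
    IsNoncrossing (toggleArc τ a b) := by
  obtain ⟨h1, h2⟩ := h
  constructor
  · intro x
    have := h1 x
    simp only [toggleArc, Equiv.swap_apply_def]
    grind
  · intro x y hxy
    have := h1 x
    have := h1 y
    have := h2 x y
    have := h2 x a
    have := h2 y a
    have := h2 x b
    have := h2 y b
    have := hc x
    have := hc (τ x)
    have := hc (τ y)
    have := hc y
    have := lt_trichotomy (τ x) a
    have := lt_trichotomy (τ x) b
    have := lt_trichotomy (τ y) a
    have := lt_trichotomy (τ y) b
    have := lt_trichotomy x a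
    have := lt_trichotomy x b
    have := lt_trichotomy y a
    have := lt_trichotomy y b
    clear h1 h2 hc
    simp only [toggleArc, Equiv.swap_apply_def]
    grind

theorem IsNoncrossing.removeArc {ι : Type*} [LinearOrder ι] {τ : ι → ι}
    (h : IsNoncrossing τ) {a b : ι} (ha : τ a = b) : IsNoncrossing (toggleArc τ a b) := by
  obtain ⟨h1, h2⟩ := h
  constructor
  · intro x
    have := h1 x
    have := h1 a
    simp only [toggleArc, Equiv.swap_apply_def]
    grind
  · intro x y hxy
    have := h1 x
    have := h1 y
    have := h1 a
    have := h2 x y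
    clear h2
    simp only [toggleArc, Equiv.swap_apply_def]
    grind

open scoped Classical in
/-- The indicator function of the pairs compatible with `τ` and `S`. -/
noncomputable def arcIndicator {ι : Type*} (τ : ι → ι) (S I J : Finset ι) : ℝ :=
  if Compatible τ S I J then 1 else 0

open scoped NNReal in
/-- The cone spanned by the indicator functions of noncrossing involutions. -/
def noncrossingCone (ι : Type*) [LinearOrder ι] : Submodule ℝ≥0 (Finset ι → Finset ι → ℝ) :=
  Submodule.span ℝ≥0 {f | ∃ τ S, IsNoncrossing τ ∧ f = arcIndicator τ S}

/-- Replace `b` by `a` in `I`. -/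
def moveElem {ι : Type*} [DecidableEq ι] (a b : ι) (I : Finset ι) : Finset ι :=
  insert a (I.erase b)

/-- The effect on Plücker coordinates of adding `t` times row `a` to the adjacent row `b`. -/
def bridge {ι : Type*} [DecidableEq ι] (a b : ι) (t : ℝ) (p : Finset ι → ℝ) (I : Finset ι) : ℝ :=
  p I + if b ∈ I ∧ a ∉ I then t * p (moveElem a b I) else 0

/-- `bridge` applied in both arguments. -/
def bridgePair {ι : Type*} [DecidableEq ι] (a b : ι) (t : ℝ)
    (f : Finset ι → Finset ι → ℝ) (I J : Finset ι) : ℝ :=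
  bridge a b t (fun I' => bridge a b t (f I') J) I

section

variable {ι : Type*} {τ : ι → ι} {S I J : Finset ι} {a b : ι} {t : ℝ}

theorem Compatible.symm (hτ : ∀ x, τ (τ x) = x) (h : Compatible τ S I J) :
    Compatible τ S J I := fun x => by
  have := h x
  have := h (τ x)
  have := hτ x
  grind

theorem Compatible.of_fixed (h : Compatible τ S I J) {x : ι} (hx : τ x = x) :
    (x ∈ I ↔ x ∈ S) ∧ (x ∈ J ↔ x ∈ S) := by
  have := h x
  grind

theorem Compatible.of_matched (h : Compatible τ S I J) {x : ι} (hx : τ x ≠ x) :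
    x ∈ I ↔ x ∉ J := by
  have := h x
  grind

variable [LinearOrder ι]

theorem bridgePair_of_fixed_notMem (ha : τ a = a) (haS : a ∉ S) :
    bridgePair a b t (arcIndicator τ S) = arcIndicator τ S := by
  funext I J
  have h1 : ∀ J, ¬ Compatible τ S (moveElem a b I) J := fun J h => by
    have := (h.of_fixed ha).1
    simp [moveElem, haS] at this
  have h2 : ∀ I, ¬ Compatible τ S I (moveElem a b J) := fun J h => by
    have := (h.of_fixed ha).2
    simp [moveElem, haS] at this
  simp [bridgePair, bridge, arcIndicator, h1, h2]

theorem bridgePair_of_fixed_mem (hab : a ≠ b) (hb : τ b = b) (hbS : b ∈ S) :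
    bridgePair a b t (arcIndicator τ S) = arcIndicator τ S := by
  funext I J
  have h1 : ∀ J, ¬ Compatible τ S (moveElem a b I) J := fun J h => by
    have := (h.of_fixed hb).1
    simp [moveElem, hbS, hab.symm] at this
  have h2 : ∀ I, ¬ Compatible τ S I (moveElem a b J) := fun J h => by
    have := (h.of_fixed hb).2
    simp [moveElem, hbS, hab.symm] at this
  simp [bridgePair, bridge, arcIndicator, h1, h2]

theorem bridgePair_arc (h : IsNoncrossing τ) (hab : a ≠ b) (ha : τ a = b) :
    bridgePair a b t (arcIndicator τ S) =
      arcIndicator τ S + (2 * t) • arcIndicator (toggleArc τ a b) (insert b (S.erase a)) := by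
  have hba : τ b = a := by rw [← ha, h.invol]
  have h0 : ∀ I J, ¬ Compatible τ S (moveElem a b I) (moveElem a b J) := fun I J h => by
    have := h.of_matched (x := a) (by grind)
    simp [moveElem] at this
  have h1 : ∀ I J, ((b ∈ I ∧ a ∉ I) ∧ Compatible τ S (moveElem a b I) J) ↔
      Compatible (toggleArc τ a b) (insert b (S.erase a)) I J := fun I J => by
    simp only [moveElem, Compatible, toggleArc, Equiv.swap_apply_def]
    have := h.invol
    constructor
    · rintro ⟨⟨h1, h2⟩, h3⟩ x
      have := h3 x
      have := h3 (τ x)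
      have := h3 a
      have := h3 b
      grind
    · intro h3
      have := h3 a
      have := h3 b
      refine ⟨by grind, fun x => ?_⟩
      have := h3 x
      have := h3 (τ x)
      grind
  have h2 : ∀ I J, ((b ∈ J ∧ a ∉ J) ∧ Compatible τ S I (moveElem a b J)) ↔
      Compatible (toggleArc τ a b) (insert b (S.erase a)) I J := fun I J => by
    have hinv : ∀ x, toggleArc τ a b (toggleArc τ a b x) = x := fun x => by
      have := h.invol x
      simp only [toggleArc, Equiv.swap_apply_def]
      grind
    have := h1 J I
    exact ⟨fun h' => (this.1 ⟨h'.1, h'.2.symm h.invol⟩).symm hinv,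
      fun h' => have h3 := this.2 (h'.symm hinv); ⟨h3.1, h3.2.symm h.invol⟩⟩
  funext I J
  have := h0 I J
  have := h1 I J
  have := h2 I J
  simp only [bridgePair, bridge, arcIndicator, Pi.add_apply, Pi.smul_apply, smul_eq_mul]
  grind

theorem bridgePair_eq_add_smul {τ' : ι → ι} {S' : Finset ι}
    (h0 : ∀ I J, ¬ Compatible τ S (moveElem a b I) (moveElem a b J))
    (h1 : ∀ I J, ¬ (((b ∈ I ∧ a ∉ I) ∧ Compatible τ S (moveElem a b I) J) ∧
      ((b ∈ J ∧ a ∉ J) ∧ Compatible τ S I (moveElem a b J))))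
    (h2 : ∀ I J, (((b ∈ I ∧ a ∉ I) ∧ Compatible τ S (moveElem a b I) J) ∨
      ((b ∈ J ∧ a ∉ J) ∧ Compatible τ S I (moveElem a b J))) ↔ Compatible τ' S' I J) :
    bridgePair a b t (arcIndicator τ S) = arcIndicator τ S + t • arcIndicator τ' S' := by
  funext I J
  have := h0 I J
  have := h1 I J
  have := h2 I J
  simp only [bridgePair, bridge, arcIndicator, Pi.add_apply, Pi.smul_apply, smul_eq_mul]
  grind

theorem bridgePair_fixed_matched (h : IsNoncrossing τ) (hab : a ≠ b) (ha : τ a = a) (haS : a ∈ S)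
    (hb : τ b ≠ b) :
    bridgePair a b t (arcIndicator τ S) =
      arcIndicator τ S + t • arcIndicator (conjSwap τ a b) (insert b (S.erase a)) := by
  apply bridgePair_eq_add_smul
  · intro I J h
    have := h.of_matched hb
    simp [moveElem, hab.symm] at this
  · rintro I J ⟨⟨h1, h2⟩, h3, h4⟩
    have := h2 a
    have := h2 b
    have := h4 a
    have := h4 b
    simp only [moveElem] at *
    grind
  · intro I J
    simp only [moveElem, Compatible, conjSwap, Equiv.swap_apply_def]
    have := h.invol
    have := h.invol b
    constructor
    · rintro (⟨⟨h1, h2⟩, h3⟩ | ⟨⟨h1, h2⟩, h3⟩) x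
      · have := h3 x
        have := h3 a
        have := h3 b
        grind
      · have := h3 x
        have := h3 a
        have := h3 b
        grind
    · intro h3
      have := h3 a
      have := h3 b
      rcases (by grind : (b ∈ I ∧ a ∉ I) ∨ (b ∈ J ∧ a ∉ J)) with h4 | h4
      · refine .inl ⟨h4, fun x => ?_⟩
        have := h3 x
        have := h3 (τ b)
        grind
      · refine .inr ⟨h4, fun x => ?_⟩
        have := h3 x
        have := h3 (τ b)
        grind

theorem bridgePair_matched_fixed (h : IsNoncrossing τ) (hab : a ≠ b) (ha : τ a ≠ a) (hb : τ b = b)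
    (hbS : b ∉ S) :
    bridgePair a b t (arcIndicator τ S) =
      arcIndicator τ S + t • arcIndicator (conjSwap τ a b) (insert b (S.erase a)) := by
  apply bridgePair_eq_add_smul
  · intro I J h
    have := h.of_matched ha
    simp [moveElem] at this
  · rintro I J ⟨⟨h1, h2⟩, h3, h4⟩
    have := h2 a
    have := h2 b
    have := h4 a
    have := h4 b
    simp only [moveElem] at *
    grind
  · intro I J
    simp only [moveElem, Compatible, conjSwap, Equiv.swap_apply_def]
    have := h.invol
    have := h.invol a
    constructor
    · rintro (⟨⟨h1, h2⟩, h3⟩ | ⟨⟨h1, h2⟩, h3⟩) x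
      · have := h3 x
        have := h3 a
        have := h3 b
        grind
      · have := h3 x
        have := h3 a
        have := h3 b
        grind
    · intro h3
      have := h3 a
      have := h3 b
      rcases (by grind : (b ∈ I ∧ a ∉ I) ∨ (b ∈ J ∧ a ∉ J)) with h4 | h4
      · refine .inl ⟨h4, fun x => ?_⟩
        have := h3 x
        have := h3 (τ a)
        grind
      · refine .inr ⟨h4, fun x => ?_⟩
        have := h3 x
        have := h3 (τ a)
        grind

theorem bridgePair_matched_matched (h : IsNoncrossing τ) (hab : a ≠ b) (ha : τ a ≠ a)
    (hb : τ b ≠ b) (hne : τ a ≠ b) :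
    bridgePair a b t (arcIndicator τ S) =
      arcIndicator τ S + t • arcIndicator (joinArcs τ a b) (insert b (S.erase a)) := by
  apply bridgePair_eq_add_smul
  · intro I J h
    have := h.of_matched ha
    simp [moveElem] at this
  · rintro I J ⟨⟨h1, h2⟩, h3, h4⟩
    have := h2 a
    have := h4 a
    have := h2 (τ a)
    have := h4 (τ a)
    have := h.invol a
    have := h.invol b
    simp only [moveElem] at *
    grind
  · intro I J
    simp only [moveElem, Compatible, joinArcs]
    have := h.invol
    have := h.invol a
    have := h.invol b
    constructor
    · rintro (⟨⟨h1, h2⟩, h3⟩ | ⟨⟨h1, h2⟩, h3⟩) x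
      · have := h3 x
        have := h3 a
        have := h3 b
        have := h3 (τ a)
        have := h3 (τ b)
        grind
      · have := h3 x
        have := h3 a
        have := h3 b
        have := h3 (τ a)
        have := h3 (τ b)
        grind
    · intro h3
      have := h3 a
      have := h3 b
      have := h3 (τ a)
      have := h3 (τ b)
      by_cases h4 : τ b ∈ I
      · refine .inl ⟨by grind, fun x => ?_⟩
        have := h3 x
        grind
      · refine .inr ⟨by grind, fun x => ?_⟩
        have := h3 x
        grind

theorem bridgePair_fixed_fixed (h : IsNoncrossing τ) (hab : a ≠ b) (ha : τ a = a) (haS : a ∈ S)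
    (hb : τ b = b) (hbS : b ∉ S) :
    bridgePair a b t (arcIndicator τ S) =
      arcIndicator τ S + t • arcIndicator (toggleArc τ a b) (insert b (S.erase a)) +
        (t ^ 2) • arcIndicator τ (insert b (S.erase a)) := by
  have h0 : ∀ I J, ((b ∈ I ∧ a ∉ I) ∧ (b ∈ J ∧ a ∉ J) ∧
      Compatible τ S (moveElem a b I) (moveElem a b J)) ↔
      Compatible τ (insert b (S.erase a)) I J := fun I J => by
    simp only [moveElem, Compatible]
    have := h.invol
    constructor
    · rintro ⟨h1, h2, h3⟩ x
      have := h3 x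
      grind
    · intro h3
      have := h3 a
      have := h3 b
      refine ⟨by grind, by grind, fun x => ?_⟩
      have := h3 x
      grind
  have h1 : ∀ I J, ¬ (((b ∈ I ∧ a ∉ I) ∧ Compatible τ S (moveElem a b I) J) ∧
      ((b ∈ J ∧ a ∉ J) ∧ Compatible τ S I (moveElem a b J))) := fun I J => by
    rintro ⟨⟨h1, h2⟩, h3, h4⟩
    have := h2 a
    have := h4 a
    simp only [moveElem] at *
    grind
  have h2 : ∀ I J, (((b ∈ I ∧ a ∉ I) ∧ Compatible τ S (moveElem a b I) J) ∨
      ((b ∈ J ∧ a ∉ J) ∧ Compatible τ S I (moveElem a b J))) ↔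
      Compatible (toggleArc τ a b) (insert b (S.erase a)) I J := fun I J => by
    simp only [moveElem, Compatible, toggleArc, Equiv.swap_apply_def]
    have := h.invol
    constructor
    · rintro (⟨⟨h1, h2⟩, h3⟩ | ⟨⟨h1, h2⟩, h3⟩) x
      · have := h3 x
        have := h3 a
        have := h3 b
        grind
      · have := h3 x
        have := h3 a
        have := h3 b
        grind
    · intro h3
      have := h3 a
      have := h3 b
      rcases (by grind : (b ∈ I ∧ a ∉ I) ∨ (b ∈ J ∧ a ∉ J)) with h4 | h4
      · refine .inl ⟨h4, fun x => ?_⟩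
        have := h3 x
        grind
      · refine .inr ⟨h4, fun x => ?_⟩
        have := h3 x
        grind
  funext I J
  have := h0 I J
  have := h1 I J
  have := h2 I J
  simp only [bridgePair, bridge, arcIndicator, Pi.add_apply, Pi.smul_apply, smul_eq_mul]
  grind

theorem arcIndicator_mem (h : IsNoncrossing τ) : arcIndicator τ S ∈ noncrossingCone ι :=
  Submodule.subset_span ⟨τ, S, h, rfl⟩

theorem smul_mem_noncrossingCone {f : Finset ι → Finset ι → ℝ} (hf : f ∈ noncrossingCone ι)
    (ht : 0 ≤ t) : t • f ∈ noncrossingCone ι :=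
  (noncrossingCone ι).smul_mem ⟨t, ht⟩ hf

theorem bridgePair_arcIndicator_mem (h : IsNoncrossing τ) (hab : a < b)
    (hc : ∀ x, a < x → ¬ x < b) (ht : 0 ≤ t) :
    bridgePair a b t (arcIndicator τ S) ∈ noncrossingCone ι := by
  have hc' : ∀ x, a < x → x < b → τ x = x := fun x h1 h2 => (hc x h1 h2).elim
  by_cases ha : τ a = a
  · by_cases haS : a ∈ S
    · by_cases hb : τ b = b
      · by_cases hbS : b ∈ S
        · rw [bridgePair_of_fixed_mem hab.ne hb hbS]
          exact arcIndicator_mem h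
        · rw [bridgePair_fixed_fixed h hab.ne ha haS hb hbS]
          exact add_mem (add_mem (arcIndicator_mem h) (smul_mem_noncrossingCone
            (arcIndicator_mem (h.addArc hab ha hb hc')) ht))
            (smul_mem_noncrossingCone (arcIndicator_mem h) (sq_nonneg t))
      · rw [bridgePair_fixed_matched h hab.ne ha haS hb]
        exact add_mem (arcIndicator_mem h) (smul_mem_noncrossingCone
            (arcIndicator_mem (h.conjSwap hab (.inl ha) hc')) ht)
    · rw [bridgePair_of_fixed_notMem ha haS]
      exact arcIndicator_mem h
  · by_cases hb : τ b = b
    · by_cases hbS : b ∈ S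
      · rw [bridgePair_of_fixed_mem hab.ne hb hbS]
        exact arcIndicator_mem h
      · rw [bridgePair_matched_fixed h hab.ne ha hb hbS]
        exact add_mem (arcIndicator_mem h) (smul_mem_noncrossingCone
            (arcIndicator_mem (h.conjSwap hab (.inr hb) hc')) ht)
    · by_cases hne : τ a = b
      · rw [bridgePair_arc h hab.ne hne]
        exact add_mem (arcIndicator_mem h) (smul_mem_noncrossingCone
            (arcIndicator_mem (h.removeArc hne)) (by positivity))
      · rw [bridgePair_matched_matched h hab.ne ha hb hne]
        exact add_mem (arcIndicator_mem h) (smul_mem_noncrossingCone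
            (arcIndicator_mem (h.joinArcs hab ha hb hc')) ht)

theorem bridgePair_add (f g : Finset ι → Finset ι → ℝ) :
    bridgePair a b t (f + g) = bridgePair a b t f + bridgePair a b t g := by
  funext I J
  simp only [bridgePair, bridge, Pi.add_apply]
  split_ifs <;> ring

theorem bridgePair_smul (c : ℝ) (f : Finset ι → Finset ι → ℝ) :
    bridgePair a b t (c • f) = c • bridgePair a b t f := by
  funext I J
  simp only [bridgePair, bridge, Pi.smul_apply, smul_eq_mul]
  split_ifs <;> ring

/-- The cone is stable under adding a nonnegative multiple of a row to the next one. -/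
theorem bridgePair_mem {f : Finset ι → Finset ι → ℝ} (hf : f ∈ noncrossingCone ι) (hab : a < b)
    (hc : ∀ x, a < x → ¬ x < b) (ht : 0 ≤ t) : bridgePair a b t f ∈ noncrossingCone ι := by
  induction hf using Submodule.span_induction with
  | mem f hf =>
    obtain ⟨τ, S, hτ, rfl⟩ := hf
    exact bridgePair_arcIndicator_mem hτ hab hc ht
  | zero =>
    convert zero_mem (noncrossingCone ι)
    funext I J
    simp [bridgePair, bridge]
  | add f g _ _ hf hg =>
    rw [bridgePair_add]
    exact add_mem hf hg
  | smul c f _ hf =>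
    have : bridgePair a b t (c • f) = (c : ℝ) • bridgePair a b t f := bridgePair_smul _ _
    rw [this]
    exact smul_mem_noncrossingCone hf c.2

theorem bridgePair_mul (p : Finset ι → ℝ) :
    bridgePair a b t (fun I J => p I * p J) = fun I J => bridge a b t p I * bridge a b t p J := by
  funext I J
  simp only [bridgePair, bridge]
  split_ifs <;> ring

end

section

variable {N n m : ℕ}

theorem pluck_of_card_ne (A : Matrix (Fin N) (Fin n) ℝ) {I : Finset (Fin N)} (h : I.card ≠ n) :
    pluck A I = 0 := by
  simp [pluck, h]

theorem pluck_image (A : Matrix (Fin N) (Fin n) ℝ) {v : Fin n → Fin N} (hv : StrictMono v) :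
    pluck A (univ.image v) = (A.submatrix v id).det := by
  have hc : (univ.image v).card = n := by simp [card_image_of_injective _ hv.injective]
  have hu : v = (univ.image v).orderEmbOfFin hc :=
    orderEmbOfFin_unique hc (fun x => mem_image_of_mem _ (mem_univ x)) hv
  rw [pluck, dif_pos hc]
  congr 1
  ext i j
  conv_rhs => rw [hu]
  rfl

theorem exists_strictMono_image {I : Finset (Fin N)} (h : I.card = n) :
    ∃ v : Fin n → Fin N, StrictMono v ∧ univ.image v = I :=
  ⟨I.orderEmbOfFin h, (I.orderEmbOfFin h).strictMono, by
    rw [← coe_inj, coe_image, coe_univ, Set.image_univ, range_orderEmbOfFin]⟩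

theorem pluck_updateRow_add_smul (A : Matrix (Fin N) (Fin n) ℝ) {a b : Fin N} (hab : a ≠ b)
    (hc : ∀ x, x ≠ a → x ≠ b → (x < a ↔ x < b)) (t : ℝ) (I : Finset (Fin N)) :
    pluck (A.updateRow b (A.row b + t • A.row a)) I = bridge a b t (pluck A) I := by
  by_cases h : I.card = n
  swap
  · have h' : b ∈ I → a ∉ I → (moveElem a b I).card ≠ n := by
      intro hb ha
      rw [moveElem, card_insert_of_notMem (by simp [ha]), card_erase_of_mem hb]
      have := card_pos.2 ⟨b, hb⟩
      omega
    rw [bridge, pluck_of_card_ne _ h, pluck_of_card_ne _ h]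
    split_ifs with hh
    · rw [pluck_of_card_ne _ (h' hh.1 hh.2)]; simp
    · simp
  obtain ⟨v, hv, rfl⟩ := exists_strictMono_image h
  rw [pluck_image _ hv, bridge, pluck_image _ hv]
  by_cases hb : ∃ k, v k = b
  swap
  · have hb' : ∀ k, v k ≠ b := by simpa using hb
    have : (A.updateRow b (A.row b + t • A.row a)).submatrix v id = A.submatrix v id := by
      ext i j; simp [Matrix.updateRow_ne (hb' i)]
    simp [hb', this]
  obtain ⟨k, hk⟩ := hb
  have key : (A.updateRow b (A.row b + t • A.row a)).submatrix v id =
      (A.submatrix v id).updateRow k ((A.submatrix v id).row k + t • A.row a) := by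
    ext i j
    by_cases hik : i = k
    · subst hik; simp [hk]
    · have : v i ≠ b := fun h => hik (hv.injective (h.trans hk.symm))
      simp [Matrix.updateRow_ne this, Matrix.updateRow_ne hik]
  have hself : (A.submatrix v id).updateRow k ((A.submatrix v id).row k) = A.submatrix v id :=
    Matrix.updateRow_eq_self _ _
  rw [key, Matrix.det_updateRow_add, Matrix.det_updateRow_smul, hself]
  by_cases ha : ∃ l, v l = a
  · obtain ⟨l, hl⟩ := ha
    have hlk : l ≠ k := by rintro rfl; exact hab (hl.symm.trans hk)
    have hz : ((A.submatrix v id).updateRow k (A.row a)).det = 0 :=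
      Matrix.det_zero_of_row_eq hlk (by
        ext j
        rw [Matrix.updateRow_ne hlk, Matrix.updateRow_self]
        simp [hl])
    rw [hz, if_neg (by simp [← hl])]
    simp
  have ha' : ∀ k, v k ≠ a := by simpa using ha
  have hw : StrictMono (Function.update v k a) := by
    intro i j hij
    have hvij := hv hij
    have h1 := hc (v i)
    have h2 := hc (v j)
    have h3 := ha' i
    have h4 := ha' j
    have hi : v i = b → i = k := fun h => hv.injective (h.trans hk.symm)
    have hj : v j = b → j = k := fun h => hv.injective (h.trans hk.symm)
    simp only [Function.update_apply]
    grind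
  have hI : moveElem a b (univ.image v) = univ.image (Function.update v k a) := by
    ext x
    simp only [moveElem, mem_insert, mem_erase, mem_image, mem_univ, true_and]
    constructor
    · rintro (rfl | ⟨hx, i, rfl⟩)
      · exact ⟨k, by simp⟩
      · exact ⟨i, by rw [Function.update_of_ne]; rintro rfl; exact hx hk⟩
    · rintro ⟨i, rfl⟩
      by_cases hik : i = k
      · subst hik; simp
      · right
        rw [Function.update_of_ne hik]
        exact ⟨fun h => hik (hv.injective (h.trans hk.symm)), i, rfl⟩
  rw [if_pos (by simpa [ha'] using ⟨k, hk⟩), hI, pluck_image _ hw]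
  congr 3
  ext i j
  by_cases hik : i = k
  · subst hik; simp
  · simp [hik]

/-- The sign of moving `b` past the smaller elements of `S`. -/
def insertSign (S : Finset (Fin N)) (b : Fin N) : ℝ := (-1) ^ #{y ∈ S | y < b}

/-- The signed Plücker coordinate obtained by prepending `b` to `S`. -/
noncomputable def prependPluck (A : Matrix (Fin N) (Fin n) ℝ) (S : Finset (Fin N))
    (b : Fin N) : ℝ :=
  if b ∈ S then 0 else insertSign S b * pluck A (insert b S)

theorem insertSign_mul_self (S : Finset (Fin N)) (b : Fin N) :
    insertSign S b * insertSign S b = 1 := by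
  rw [insertSign, ← pow_add, Even.neg_one_pow ⟨_, rfl⟩]

theorem insertSign_image {v : Fin n → Fin N} (hv : StrictMono v) (k : Fin n) :
    insertSign (univ.image v) (v k) = (-1) ^ (k : ℕ) := by
  rw [insertSign]
  congr 1
  have : ({y ∈ univ.image v | y < v k} : Finset (Fin N)) = (Finset.Iio k).image v := by
    ext y
    simp only [mem_filter, mem_image, mem_univ, true_and, mem_Iio]
    constructor
    · rintro ⟨⟨i, rfl⟩, h⟩; exact ⟨i, hv.lt_iff_lt.1 h, rfl⟩
    · rintro ⟨i, h, rfl⟩; exact ⟨⟨i, rfl⟩, hv h⟩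
  rw [this, card_image_of_injective _ hv.injective, Fin.card_Iio]

theorem det_insertNth (x : Fin (m + 1) → ℝ) (p : Fin (m + 1)) (u : Fin m → Fin (m + 1) → ℝ) :
    (Matrix.of (p.insertNth x u : Fin (m + 1) → Fin (m + 1) → ℝ)).det =
      (-1) ^ (p : ℕ) * (Matrix.of (Fin.cons x u : Fin (m + 1) → Fin (m + 1) → ℝ)).det := by
  have h := (Matrix.detRowAlternating (n := Fin (m + 1)) (R := ℝ)).map_insertNth p x u
  rw [zsmul_eq_mul] at h
  push_cast at h
  exact h

theorem image_succAbove {v : Fin (m + 1) → Fin N} (hv : StrictMono v) (k : Fin (m + 1)) :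
    univ.image (fun j => v (k.succAbove j)) = (univ.image v).erase (v k) := by
  ext x
  simp only [mem_image, mem_univ, true_and, mem_erase]
  constructor
  · rintro ⟨j, rfl⟩
    exact ⟨fun h => Fin.succAbove_ne k j (hv.injective h), _, rfl⟩
  · rintro ⟨h, i, rfl⟩
    have : i ≠ k := by rintro rfl; exact h rfl
    obtain ⟨j, rfl⟩ := Fin.exists_succAbove_eq this
    exact ⟨j, rfl⟩

theorem insertSign_insert (S : Finset (Fin N)) (b : Fin N) :
    insertSign (insert b S) b = insertSign S b := by
  rw [insertSign, insertSign]
  congr 2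
  ext y
  simp only [mem_filter, mem_insert]
  grind

theorem prependPluck_image (A : Matrix (Fin N) (Fin (m + 1)) ℝ) {u : Fin m → Fin N}
    (hu : StrictMono u) (b : Fin N) :
    prependPluck A (univ.image u) b =
      (Matrix.of (Fin.cons (A.row b) (fun j => A.row (u j)) :
        Fin (m + 1) → Fin (m + 1) → ℝ)).det := by
  rw [prependPluck]
  split_ifs with hb
  · obtain ⟨j, -, rfl⟩ := mem_image.1 hb
    exact (Matrix.det_zero_of_row_eq (i := 0) (j := j.succ) (Fin.succ_ne_zero j).symm
      (by ext; simp)).symm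
  · have hcard : (insert b (univ.image u)).card = m + 1 := by
      simp [card_insert_of_notMem hb, card_image_of_injective _ hu.injective]
    obtain ⟨v, hv, hvI⟩ := exists_strictMono_image hcard
    obtain ⟨k, -, rfl⟩ := mem_image.1 (hvI ▸ mem_insert_self b _)
    have hsucc : (fun j => v (k.succAbove j)) = u := by
      have h1 : StrictMono fun j => v (k.succAbove j) := hv.comp (Fin.strictMono_succAbove k)
      have h2 : univ.image (fun j => v (k.succAbove j)) = univ.image u := by
        rw [image_succAbove hv, hvI, erase_insert hb]
      have hc : (univ.image u).card = m := by simp [card_image_of_injective _ hu.injective]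
      exact (orderEmbOfFin_unique hc (fun x => h2 ▸ mem_image_of_mem _ (mem_univ x)) h1).trans
        (orderEmbOfFin_unique hc (fun x => mem_image_of_mem _ (mem_univ x)) hu).symm
    have hd : A.submatrix v id = Matrix.of
        (k.insertNth (A.row (v k)) (fun j => A.row (u j)) : Fin (m + 1) → Fin (m + 1) → ℝ) := by
      rw [← hsucc]
      exact (Fin.insertNth_self_removeNth k (fun i => A.row (v i))).symm
    rw [← insertSign_insert, ← hvI, pluck_image _ hv, insertSign_image hv, hd, det_insertNth,
      ← mul_assoc, ← pow_add, Even.neg_one_pow ⟨_, rfl⟩, one_mul]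

/-- The Plücker relations. -/
theorem pluck_mul_prependPluck (A : Matrix (Fin N) (Fin (m + 1)) ℝ) {I S : Finset (Fin N)}
    (hI : I.card = m + 1) (hS : S.card = m) (b : Fin N) :
    pluck A I * prependPluck A S b =
      ∑ i ∈ I, insertSign I i * prependPluck A (I.erase i) b * prependPluck A S i := by
  obtain ⟨v, hv, rfl⟩ := exists_strictMono_image hI
  obtain ⟨u, hu, rfl⟩ := exists_strictMono_image hS
  rw [sum_image (fun _ _ _ _ h => hv.injective h), pluck_image _ hv]
  set X : Matrix (Fin (m + 1)) (Fin (m + 1)) ℝ := A.submatrix v id with hX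
  set f : (Fin (m + 1) → ℝ) →ₗ[ℝ] ℝ :=
    (Matrix.detRowAlternating (n := Fin (m + 1)) (R := ℝ)).toMultilinearMap.toLinearMap
      (Fin.cons 0 (fun j => A.row (u j))) 0 with hf
  have hfq : ∀ x, prependPluck A (univ.image u) x = f (A.row x) := by
    intro x
    rw [prependPluck_image A hu, hf]
    simp only [MultilinearMap.toLinearMap_apply, Fin.update_cons_zero]
    rfl
  have hcr := Matrix.mulVec_cramer X.transpose (A.row b)
  rw [Matrix.det_transpose] at hcr
  have hvec : X.det • A.row b = ∑ k, (X.updateRow k (A.row b)).det • X.row k := by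
    rw [← hcr, Matrix.mulVec_eq_sum]
    simp only [Matrix.cramer_transpose_apply, op_smul_eq_smul, Matrix.transpose_transpose]
    rfl
  have := congrArg f hvec
  rw [map_smul, map_sum] at this
  rw [hfq, ← smul_eq_mul, this]
  refine sum_congr rfl fun k _ => ?_
  have hk : X.updateRow k (A.row b) = Matrix.of (k.insertNth (A.row b)
      (fun j => A.row (v (k.succAbove j))) : Fin (m + 1) → Fin (m + 1) → ℝ) := by
    ext i l
    refine Fin.succAboveCases k ?_ (fun j => ?_) i
    · simp
    · simp [Fin.succAbove_ne, Matrix.updateRow_ne, hX]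
  rw [map_smul, smul_eq_mul, hfq, insertSign_image hv, ← image_succAbove hv,
    prependPluck_image A (u := fun j => v (k.succAbove j))
      (hv.comp (Fin.strictMono_succAbove k)), ← det_insertNth, hk]
  rfl

end

section

variable {N r : ℕ}

theorem insertSign_insert_of_lt {S : Finset (Fin N)} {a b : Fin N} (ha : a ∉ S) (hab : a < b) :
    insertSign (insert a S) b = -insertSign S b := by
  rw [insertSign, insertSign, filter_insert, if_pos hab, card_insert_of_notMem (by simp [ha])]
  ring

theorem insertSign_insert_of_gt {S : Finset (Fin N)} {a b : Fin N} (hab : b < a) :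
    insertSign (insert a S) b = insertSign S b := by
  rw [insertSign, insertSign, filter_insert, if_neg hab.not_gt]

theorem insertSign_eq_of_adjacent {S : Finset (Fin N)} {c d : Fin N} (hcd : (d : ℕ) = c + 1)
    (hc : c ∉ S) : insertSign S c = insertSign S d := by
  rw [insertSign, insertSign]
  congr 2
  refine filter_congr fun y hy => ?_
  have : y ≠ c := fun h => hc (h ▸ hy)
  rw [ne_eq, Fin.ext_iff] at this
  rw [Fin.lt_def, Fin.lt_def]
  omega

theorem prependPluck_of_mem (A : Matrix (Fin N) (Fin (r + 1)) ℝ) {S : Finset (Fin N)} {b : Fin N}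
    (h : b ∈ S) : prependPluck A S b = 0 := if_pos h

theorem prependPluck_of_notMem (A : Matrix (Fin N) (Fin (r + 1)) ℝ) {S : Finset (Fin N)} {b : Fin N}
    (h : b ∉ S) : prependPluck A S b = insertSign S b * pluck A (insert b S) := if_neg h

/-- The three-term Plücker relation. -/
theorem pluck_three_term (A : Matrix (Fin N) (Fin (r + 1)) ℝ) {R : Finset (Fin N)}
    (hR : R.card + 1 = r) {s c d t : Fin N} (hs : s ∉ R) (hc : c ∉ R) (hd : d ∉ R) (ht : t ∉ R)
    (hsc : s < c) (hcd : c < d) (hdt : d < t) :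
    pluck A (insert d (insert s R)) * pluck A (insert c (insert t R)) =
      pluck A (insert c (insert s R)) * pluck A (insert d (insert t R)) +
        pluck A (insert t (insert s R)) * pluck A (insert d (insert c R)) := by
  have hsd := hsc.trans hcd
  have hct := hcd.trans hdt
  have hst := hsd.trans hdt
  have hds : d ∉ insert s R := by simp [hd, hsd.ne']
  have hI : (insert d (insert s R)).card = r + 1 := by
    rw [card_insert_of_notMem hds, card_insert_of_notMem hs, hR]
  have hS : (insert c R).card = r := by rw [card_insert_of_notMem hc, hR]
  have key := pluck_mul_prependPluck A hI hS t
  have hzero : ∑ i ∈ R, insertSign (insert d (insert s R)) i *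
      prependPluck A ((insert d (insert s R)).erase i) t * prependPluck A (insert c R) i = 0 :=
    sum_eq_zero fun i hi => by
      rw [prependPluck_of_mem A (mem_insert_of_mem hi), mul_zero]
  have e1 : (insert d (insert s R)).erase s = insert d R := by
    rw [Finset.insert_comm, erase_insert (by simp [hs, hsd.ne])]
  rw [sum_insert hds, sum_insert hs, hzero, erase_insert hds, e1, insertSign_insert,
    insertSign_insert_of_lt hs hsd, insertSign_insert_of_gt hsd, insertSign_insert,
    prependPluck_of_notMem A (S := insert c R) (b := t) (by simp [ht, hct.ne']),
    prependPluck_of_notMem A (S := insert d R) (b := t) (by simp [ht, hdt.ne']),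
    prependPluck_of_notMem A (S := insert s R) (b := t) (by simp [ht, hst.ne']),
    prependPluck_of_notMem A (S := insert c R) (b := s) (by simp [hs, hsc.ne]),
    prependPluck_of_notMem A (S := insert c R) (b := d) (by simp [hd, hcd.ne']),
    insertSign_insert_of_lt hc hct, insertSign_insert_of_lt hd hdt, insertSign_insert_of_lt hs hst,
    insertSign_insert_of_gt hsc, insertSign_insert_of_lt hc hcd] at key
  have h1 := insertSign_mul_self R s
  have h2 := insertSign_mul_self R t
  have h3 := insertSign_mul_self R d
  rw [Finset.insert_comm c t R, Finset.insert_comm c s R, Finset.insert_comm d t R]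
  linear_combination (-insertSign R t) * key -
    (pluck A (insert d (insert s R)) * pluck A (insert t (insert c R))) * h2 +
    (pluck A (insert s (insert c R)) * pluck A (insert t (insert d R))) *
      (insertSign R t * insertSign R t * h1 + h2) +
    (pluck A (insert t (insert s R)) * pluck A (insert d (insert c R))) *
      (insertSign R t * insertSign R t * h3 + h2)

theorem pluck_mul_pluck_of_prependPluck_eq_zero (A : Matrix (Fin N) (Fin (r + 1)) ℝ)
    {S Z : Finset (Fin N)} (hS : S.card = r) (hZ : Z.card = r) {c d : Fin N}
    (hcd : (d : ℕ) = c + 1) (hcS : c ∉ S) (hdS : d ∉ S) (hcZ : c ∉ Z) (hdZ : d ∉ Z)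
    (hz : ∀ x ∈ S, prependPluck A Z x = 0) :
    pluck A (insert d S) * pluck A (insert c Z) = pluck A (insert d Z) * pluck A (insert c S) := by
  have key := pluck_mul_prependPluck A (I := insert d S)
    (by rw [card_insert_of_notMem hdS, hS]) hZ c
  rw [sum_insert hdS, sum_eq_zero (s := S) (fun i hi => by rw [hz i hi, mul_zero]),
    erase_insert hdS, insertSign_insert, prependPluck_of_notMem A hcZ,
    prependPluck_of_notMem A hdZ, prependPluck_of_notMem A hcS,
    insertSign_eq_of_adjacent hcd hcS, insertSign_eq_of_adjacent hcd hcZ] at key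
  have h1 := insertSign_mul_self S d
  have h2 := insertSign_mul_self Z d
  linear_combination insertSign Z d * key -
    (pluck A (insert d S) * pluck A (insert c Z)) * h2 +
    (pluck A (insert d Z) * pluck A (insert c S)) * (insertSign Z d * insertSign Z d * h1 + h2)

/-- The positivity pattern of the maximal minors during the elimination: `pluck A I` is positive
if `I` contains the first `j` rows and another row of index at most `m`, and vanishes otherwise. -/
structure HasPattern (A : Matrix (Fin N) (Fin (r + 1)) ℝ) (j m : ℕ) : Prop where
  pos : ∀ I : Finset (Fin N), I.card = r + 1 → (∀ x : Fin N, (x : ℕ) < j → x ∈ I) →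
    (∃ x ∈ I, j ≤ (x : ℕ) ∧ (x : ℕ) ≤ m) → 0 < pluck A I
  zero : ∀ I : Finset (Fin N), ¬ ((∀ x : Fin N, (x : ℕ) < j → x ∈ I) ∧
    (∃ x ∈ I, j ≤ (x : ℕ) ∧ (x : ℕ) ≤ m)) → pluck A I = 0

/-- The first `j` and the last `r - j` indices. -/
def outerRows (N r j : ℕ) : Finset (Fin N) :=
  univ.filter fun x => (x : ℕ) < j ∨ N - r + j ≤ (x : ℕ)

theorem card_outerRows {j : ℕ} (hj : j ≤ r) (hr : r ≤ N) : (outerRows N r j).card = r := by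
  have h : (outerRows N r j).map Fin.valEmbedding = range j ∪ Ico (N - r + j) N := by
    ext x
    simp only [outerRows, mem_map, mem_filter, mem_univ, true_and, Fin.valEmbedding_apply,
      mem_union, mem_range, mem_Ico]
    constructor
    · rintro ⟨y, hy, rfl⟩
      omega
    · intro hx
      exact ⟨⟨x, by omega⟩, by simpa using by omega, rfl⟩
  rw [← card_map Fin.valEmbedding, h, card_union_of_disjoint, card_range, Nat.card_Ico]
  · omega
  · rw [disjoint_left]
    intro x hx hx'
    rw [mem_range] at hx
    rw [mem_Ico] at hx'
    omega

theorem exists_mem_middle {I : Finset (Fin N)} {j : ℕ} (hI : I.card = r + 1) (hj : j ≤ r) :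
    ∃ x ∈ I, j ≤ (x : ℕ) ∧ (x : ℕ) ≤ N - r - 1 + j := by
  have hr : r + 1 ≤ N := by simpa [hI] using card_le_univ I
  by_contra! h
  have : I ⊆ outerRows N r j := by
    intro x hx
    have := h x hx
    simp only [outerRows, mem_filter, mem_univ, true_and]
    omega
  have := card_le_card this
  rw [card_outerRows hj (by omega)] at this
  omega

theorem HasPattern.pluck_mul_pluck {A : Matrix (Fin N) (Fin (r + 1)) ℝ} {j : ℕ} {c d : Fin N}
    (h : HasPattern A j d) (hj : j ≤ r) (hr : r + 1 ≤ N) (hcd : (d : ℕ) = c + 1)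
    (hjc : j ≤ (c : ℕ)) (hd : (d : ℕ) < N - r + j) {S : Finset (Fin N)} (hS : S.card = r)
    (hjS : ∀ x : Fin N, (x : ℕ) < j → x ∈ S) (hcS : c ∉ S) (hdS : d ∉ S) :
    ((∀ x ∈ S, ¬ (j ≤ (x : ℕ) ∧ (x : ℕ) < d)) →
      pluck A (insert d S) * pluck A (insert c (outerRows N r j)) =
        pluck A (insert d (outerRows N r j)) * pluck A (insert c S)) ∧
    ((∃ x ∈ S, j ≤ (x : ℕ) ∧ (x : ℕ) < d) →
      pluck A (insert d (outerRows N r j)) * pluck A (insert c S) <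
        pluck A (insert d S) * pluck A (insert c (outerRows N r j))) := by
  have hcZ : c ∉ outerRows N r j := by simp [outerRows]; omega
  have hdZ : d ∉ outerRows N r j := by simp [outerRows]; omega
  have hZ := card_outerRows (N := N) hj (by omega : r ≤ N)
  have hjZ : ∀ x : Fin N, (x : ℕ) < j → x ∈ outerRows N r j := fun x hx => by simp [outerRows, hx]
  generalize hq : #(S.filter fun x : Fin N => j ≤ (x : ℕ) ∧ (x : ℕ) < d) = q
  induction q using Nat.strong_induction_on generalizing S with
  | _ q ih =>
  constructor
  · intro hx
    refine pluck_mul_pluck_of_prependPluck_eq_zero A hS hZ hcd hcS hdS hcZ hdZ fun x hxS => ?_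
    by_cases hxZ : x ∈ outerRows N r j
    · exact prependPluck_of_mem A hxZ
    · rw [prependPluck_of_notMem A hxZ, h.zero, mul_zero]
      rintro ⟨-, y, hy, hy1, hy2⟩
      have hxd : x ≠ d := fun h => hdS (h ▸ hxS)
      rw [ne_eq, Fin.ext_iff] at hxd
      have := hx x hxS
      simp only [outerRows, mem_filter, mem_univ, true_and] at hxZ
      rcases mem_insert.1 hy with rfl | hy
      · omega
      · simp only [outerRows, mem_filter, mem_univ, true_and] at hy
        omega
  · rintro ⟨s, hsS, hs1, hs2⟩
    have hsc : s < c := by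
      have : s ≠ c := fun h => hcS (h ▸ hsS)
      rw [ne_eq, Fin.ext_iff] at this
      rw [Fin.lt_def]; omega
    have hsZ : s ∉ outerRows N r j := by simp [outerRows]; omega
    obtain ⟨t, htZ, htS⟩ : ∃ t ∈ outerRows N r j, t ∉ S := by
      by_contra! hsub
      have := eq_of_subset_of_card_le (show outerRows N r j ⊆ S from hsub) (by omega)
      exact hsZ (this ▸ hsS)
    have hdt : d < t := by
      have := mt (hjS t) htS
      simp only [outerRows, mem_filter, mem_univ, true_and] at htZ
      rw [Fin.lt_def]; omega
    have hcd' : c < d := by rw [Fin.lt_def]; omega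
    obtain ⟨R, hsR, rfl⟩ : ∃ R, s ∉ R ∧ insert s R = S :=
      ⟨S.erase s, notMem_erase s S, insert_erase hsS⟩
    have hsd := hsc.trans hcd'
    have hct := hcd'.trans hdt
    have hcR : c ∉ R := fun h => hcS (mem_insert_of_mem h)
    have hdR : d ∉ R := fun h => hdS (mem_insert_of_mem h)
    have htR : t ∉ R := fun h => htS (mem_insert_of_mem h)
    have hRc : R.card + 1 = r := by rw [← hS, card_insert_of_notMem hsR]
    have hjR : ∀ x : Fin N, (x : ℕ) < j → x ∈ R := fun x hx => by
      have := hjS x hx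
      rcases mem_insert.1 this with rfl | h
      · omega
      · exact h
    have hlt : #((insert t R).filter fun x : Fin N => j ≤ (x : ℕ) ∧ (x : ℕ) < d) < q := by
      rw [← hq, filter_insert, filter_insert, if_neg (by rw [Fin.lt_def] at hdt; omega),
        if_pos ⟨hs1, hs2⟩,
        card_insert_of_notMem (by simp [hsR])]
      omega
    have hT := ih _ hlt (S := insert t R) (by rw [card_insert_of_notMem htR, hRc])
      (fun x hx => mem_insert_of_mem (hjR x hx)) (by simp [hcR, hct.ne]) (by simp [hdR, hdt.ne]) rfl
    have hle : pluck A (insert d (outerRows N r j)) * pluck A (insert c (insert t R)) ≤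
        pluck A (insert d (insert t R)) * pluck A (insert c (outerRows N r j)) := by
      by_cases hex : ∃ x ∈ insert t R, j ≤ (x : ℕ) ∧ (x : ℕ) < d
      · exact (hT.2 hex).le
      · push Not at hex
        exact (hT.1 (by simpa using hex)).ge
    have h3 := pluck_three_term A hRc hsR hcR hdR htR hsc hcd' hdt
    have hpos2 : ∀ x y : Fin N, x ∉ R → y ∉ R → x ≠ y → j ≤ (y : ℕ) → (y : ℕ) ≤ d →
        0 < pluck A (insert x (insert y R)) := fun x y hx hy hxy h1 h2 =>
      h.pos _ (by rw [card_insert_of_notMem (by simp [hx, hxy]), card_insert_of_notMem hy, hRc])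
        (fun z hz => mem_insert_of_mem (mem_insert_of_mem (hjR z hz))) ⟨y, by simp, h1, h2⟩
    have p1 := hpos2 c s hcR hsR hsc.ne' hs1 hs2.le
    have p2 := hpos2 t s htR hsR (hsd.trans hdt).ne' hs1 hs2.le
    have p3 := hpos2 d c hdR hcR hcd'.ne' hjc (by omega)
    have p4 := hpos2 t c htR hcR hct.ne' hjc (by omega)
    rw [Finset.insert_comm] at p4
    have p5 : 0 < pluck A (insert c (outerRows N r j)) :=
      h.pos _ (by rw [card_insert_of_notMem hcZ, hZ]) (fun z hz => mem_insert_of_mem (hjZ z hz))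
        ⟨c, by simp, hjc, by omega⟩
    refine lt_of_mul_lt_mul_right ?_ p4.le
    have m1 := mul_le_mul_of_nonneg_left hle p1.le
    have m2 := mul_pos (mul_pos p2 p3) p5
    have m3 := congrArg (· * pluck A (insert c (outerRows N r j))) h3
    beta_reduce at m3
    linarith

theorem updateRow_add_smul_cancel (A : Matrix (Fin N) (Fin (r + 1)) ℝ) {c d : Fin N} (h : c ≠ d)
    (t : ℝ) : (A.updateRow d (A.row d + (-t) • A.row c)).updateRow d
      ((A.updateRow d (A.row d + (-t) • A.row c)).row d +
        t • (A.updateRow d (A.row d + (-t) • A.row c)).row c) = A := by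
  ext i j
  by_cases hi : i = d
  · subst hi
    simp [Matrix.updateRow_ne h]
  · simp [hi]

theorem HasPattern.mem_noncrossingCone_of_succ {j : ℕ} {c d : Fin N} (hj : j ≤ r) (hr : r + 1 ≤ N)
    (hcd : (d : ℕ) = c + 1) (hjc : j ≤ (c : ℕ)) (hd : (d : ℕ) < N - r + j)
    (ih : ∀ A : Matrix (Fin N) (Fin (r + 1)) ℝ, HasPattern A j c →
      (fun I J => pluck A I * pluck A J) ∈ noncrossingCone (Fin N))
    {A : Matrix (Fin N) (Fin (r + 1)) ℝ} (h : HasPattern A j d) :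
    (fun I J => pluck A I * pluck A J) ∈ noncrossingCone (Fin N) := by
  have hlt : c < d := by rw [Fin.lt_def]; omega
  have hcZ : c ∉ outerRows N r j := by simp [outerRows]; omega
  have hdZ : d ∉ outerRows N r j := by simp [outerRows]; omega
  have hZ := card_outerRows (N := N) hj (by omega : r ≤ N)
  have hjZ : ∀ x : Fin N, (x : ℕ) < j → x ∈ outerRows N r j := fun x hx => by simp [outerRows, hx]
  have pc : 0 < pluck A (insert c (outerRows N r j)) :=
    h.pos _ (by rw [card_insert_of_notMem hcZ, hZ]) (fun z hz => mem_insert_of_mem (hjZ z hz))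
      ⟨c, by simp, hjc, by omega⟩
  have pd : 0 < pluck A (insert d (outerRows N r j)) :=
    h.pos _ (by rw [card_insert_of_notMem hdZ, hZ]) (fun z hz => mem_insert_of_mem (hjZ z hz))
      ⟨d, by simp, by omega, le_rfl⟩
  set t := pluck A (insert d (outerRows N r j)) / pluck A (insert c (outerRows N r j)) with ht
  have ht0 : 0 < t := div_pos pd pc
  have htd : pluck A (insert d (outerRows N r j)) = t * pluck A (insert c (outerRows N r j)) := by
    rw [ht, div_mul_cancel₀ _ pc.ne']
  have hadj : ∀ x : Fin N, x ≠ c → x ≠ d → (x < c ↔ x < d) := fun x h1 h2 => by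
    rw [ne_eq, Fin.ext_iff] at h1 h2
    rw [Fin.lt_def, Fin.lt_def]
    omega
  set B := A.updateRow d (A.row d + (-t) • A.row c) with hB
  have hBp : ∀ I, pluck B I = bridge c d (-t) (pluck A) I :=
    pluck_updateRow_add_smul A hlt.ne hadj (-t)
  have hAB : pluck A = bridge c d t (pluck B) := by
    funext I
    rw [← pluck_updateRow_add_smul B hlt.ne hadj t, updateRow_add_smul_cancel A hlt.ne t]
  have hBpat : HasPattern B j c := by
    refine ⟨fun I hI hjI hex => ?_, fun I hI => ?_⟩
    · rw [hBp, bridge]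
      split_ifs with hh
      · obtain ⟨S, hdS, rfl⟩ : ∃ S, d ∉ S ∧ insert d S = I :=
          ⟨I.erase d, notMem_erase d I, insert_erase hh.1⟩
        rw [card_insert_of_notMem hdS] at hI
        have hS : S.card = r := by omega
        have hcS : c ∉ S := fun h => hh.2 (mem_insert_of_mem h)
        have hjS : ∀ x : Fin N, (x : ℕ) < j → x ∈ S := fun x hx => by
          rcases mem_insert.1 (hjI x hx) with rfl | h
          · omega
          · exact h
        have := (h.pluck_mul_pluck hj hr hcd hjc hd hS hjS hcS hdS).2 (by
          obtain ⟨x, hx, h1, h2⟩ := hex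
          rcases mem_insert.1 hx with rfl | hx
          · omega
          · exact ⟨x, hx, h1, by omega⟩)
        rw [htd, mul_right_comm] at this
        have := lt_of_mul_lt_mul_right this pc.le
        rw [moveElem, erase_insert hdS]
        linarith
      · rw [add_zero]
        obtain ⟨x, hx, h1, h2⟩ := hex
        exact h.pos I hI hjI ⟨x, hx, h1, by omega⟩
    · rw [hBp, bridge]
      split_ifs with hh
      · by_cases hI' : I.card = r + 1
        swap
        · rw [pluck_of_card_ne _ hI', pluck_of_card_ne]
          · simp
          · rw [moveElem, card_insert_of_notMem (by simp [hh.2]), card_erase_of_mem hh.1]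
            have := card_pos.2 ⟨d, hh.1⟩
            omega
        obtain ⟨S, hdS, rfl⟩ : ∃ S, d ∉ S ∧ insert d S = I :=
          ⟨I.erase d, notMem_erase d I, insert_erase hh.1⟩
        rw [card_insert_of_notMem hdS] at hI'
        have hS : S.card = r := by omega
        have hcS : c ∉ S := fun h => hh.2 (mem_insert_of_mem h)
        rw [moveElem, erase_insert hdS]
        by_cases hjS : ∀ x : Fin N, (x : ℕ) < j → x ∈ S
        · have := (h.pluck_mul_pluck hj hr hcd hjc hd hS hjS hcS hdS).1 fun x hx hxj =>
            hI ⟨fun z hz => mem_insert_of_mem (hjS z hz),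
              x, mem_insert_of_mem hx, hxj.1, by omega⟩
          rw [htd, mul_right_comm] at this
          have := mul_right_cancel₀ pc.ne' this
          linarith
        · push Not at hjS
          obtain ⟨x, hx, hxS⟩ := hjS
          have hxc : x ≠ c := by rintro rfl; omega
          have hxd : x ≠ d := by rintro rfl; omega
          rw [h.zero _ fun hh => by simpa [hxS, hxd] using hh.1 x hx,
            h.zero _ fun hh => by simpa [hxS, hxc] using hh.1 x hx]
          simp
      · rw [add_zero]
        refine h.zero I fun ⟨h1, x, hx, h2, h3⟩ => hI ⟨h1, ?_⟩
        by_cases hdI : d ∈ I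
        · exact ⟨c, by by_contra hc; exact hh ⟨hdI, hc⟩, hjc, le_rfl⟩
        · have : x ≠ d := fun h => hdI (h ▸ hx)
          rw [ne_eq, Fin.ext_iff] at this
          exact ⟨x, hx, h2, by omega⟩
  have hmem := bridgePair_mem (ih B hBpat) hlt (fun x h1 h2 => by
    rw [Fin.lt_def] at h1 h2; omega) ht0.le
  rwa [bridgePair_mul, ← hAB] at hmem

theorem HasPattern.mem_noncrossingCone_of_le {j : ℕ} (hj : j ≤ r) (hr : r + 1 ≤ N)
    (ih : ∀ A : Matrix (Fin N) (Fin (r + 1)) ℝ, HasPattern A j j →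
      (fun I J => pluck A I * pluck A J) ∈ noncrossingCone (Fin N)) {m : ℕ} (hjm : j ≤ m) :
    m < N - r + j → ∀ A : Matrix (Fin N) (Fin (r + 1)) ℝ, HasPattern A j m →
      (fun I J => pluck A I * pluck A J) ∈ noncrossingCone (Fin N) := by
  induction m, hjm using Nat.le_induction with
  | base => exact fun _ => ih
  | succ m hjm ihm =>
    intro hm A hA
    exact HasPattern.mem_noncrossingCone_of_succ (c := ⟨m, by omega⟩) (d := ⟨m + 1, by omega⟩)
      hj hr rfl hjm hm (ihm (by omega)) hA

theorem HasPattern.mem_noncrossingCone {i : ℕ} (hi : i ≤ r) (hr : r + 1 ≤ N) :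
    ∀ A : Matrix (Fin N) (Fin (r + 1)) ℝ, HasPattern A (r - i) (N - r - 1 + (r - i)) →
      (fun I J => pluck A I * pluck A J) ∈ noncrossingCone (Fin N) := by
  induction i with
  | zero =>
    refine HasPattern.mem_noncrossingCone_of_le (by omega) hr (fun A hA => ?_) (by omega) (by omega)
    have hval : ∀ I, pluck A I = if I = univ.filter (fun x : Fin N => (x : ℕ) < r + 1) then
        pluck A (univ.filter fun x : Fin N => (x : ℕ) < r + 1) else 0 := by
      intro I
      split_ifs with hI
      · rw [hI]
      · by_cases hc : I.card = r + 1
        · refine hA.zero I fun ⟨h1, x, hx, h2, h3⟩ => hI ?_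
          symm
          refine eq_of_subset_of_card_le (fun y hy => ?_) ?_
          · rw [mem_filter] at hy
            by_cases hyr : (y : ℕ) < r
            · exact h1 y hyr
            · have : y = x := by rw [Fin.ext_iff]; omega
              exact this ▸ hx
          · rw [hc, Fin.card_filter_val_lt]
            omega
        · exact pluck_of_card_ne A hc
    convert smul_mem_noncrossingCone (arcIndicator_mem (ι := Fin N) (τ := id)
      (S := univ.filter fun x : Fin N => (x : ℕ) < r + 1) ⟨fun _ => rfl, fun x y h1 h2 =>
        absurd h1 (lt_asymm h2)⟩)
      (mul_self_nonneg (pluck A (univ.filter fun x : Fin N => (x : ℕ) < r + 1))) using 1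
    funext I J
    rw [hval I, hval J, Pi.smul_apply, Pi.smul_apply, arcIndicator]
    have : Compatible id (univ.filter fun x : Fin N => (x : ℕ) < r + 1) I J ↔
        I = (univ.filter fun x : Fin N => (x : ℕ) < r + 1) ∧
        J = (univ.filter fun x : Fin N => (x : ℕ) < r + 1) := by
      rw [Compatible, Finset.ext_iff, Finset.ext_iff, ← forall_and]
      refine forall_congr' fun x => ?_
      simp only [id]
      tauto
    clear hval
    simp only [this]
    split_ifs <;> simp_all
  | succ i ih =>
    refine HasPattern.mem_noncrossingCone_of_le (by omega) hr (fun A hA => ?_) (by omega) (by omega)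
    refine ih (by omega) A ⟨fun I hI h1 h2 => ?_, fun I hI => ?_⟩
    · exact hA.pos I hI (fun x hx => h1 x (by omega))
        ⟨⟨r - (i + 1), by omega⟩, h1 _ (by simp only; omega), le_rfl, le_rfl⟩
    · by_cases hc : I.card = r + 1
      · refine hA.zero I fun ⟨h1, x, hx, h2, h3⟩ => hI ⟨fun y hy => ?_, ?_⟩
        · by_cases hyr : (y : ℕ) < r - (i + 1)
          · exact h1 y hyr
          · have : y = x := by rw [Fin.ext_iff]; omega
            exact this ▸ hx
        · exact exists_mem_middle hc (by omega)
      · exact pluck_of_card_ne A hc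

theorem pluck_mul_pluck_mem_noncrossingCone (A : Matrix (Fin N) (Fin (r + 1)) ℝ)
    (hA : ∀ I, I.card = r + 1 → 0 < pluck A I) :
    (fun I J => pluck A I * pluck A J) ∈ noncrossingCone (Fin N) := by
  by_cases hr : r + 1 ≤ N
  · refine HasPattern.mem_noncrossingCone le_rfl hr A ⟨fun I hI _ _ => hA I hI, fun I hI => ?_⟩
    by_cases hc : I.card = r + 1
    · exact absurd ⟨fun x hx => by omega, exists_mem_middle hc (by omega)⟩ hI
    · exact pluck_of_card_ne A hc
  · have : (fun I J : Finset (Fin N) => pluck A I * pluck A J) = 0 := by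
      funext I J
      have : I.card ≠ r + 1 := by
        have := card_le_univ I
        rw [Fintype.card_fin] at this
        omega
      rw [pluck_of_card_ne A this, zero_mul]
      rfl
    rw [this]
    exact zero_mem _

end

section

open Polynomial

variable {ι : Type*} [LinearOrder ι] {s τ : ι → ι} {E : Finset ι}

/-- `I` contains exactly one element of each of the pairs `{x, s x}` and `{x, τ x}` in `E`. -/
def IsColoring (s τ : ι → ι) (E I : Finset ι) : Prop :=
  ∀ x ∈ E, (s x ∈ I ↔ x ∉ I) ∧ (τ x ∈ I ↔ x ∉ I)

noncomputable instance : DecidablePred (IsColoring s τ E) := Classical.decPred _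

/-- The number of elements of `I` in the lower half. -/
def lowerCard (s : ι → ι) (I : Finset ι) : ℕ := #(I.filter fun x => x < s x)

/-- The generating polynomial of the colorings of `E` by the number of lower elements. -/
noncomputable def colorPoly (s τ : ι → ι) (E : Finset ι) : ℕ[X] :=
  ∑ I ∈ E.powerset with IsColoring s τ E I, X ^ lowerCard s I

theorem lowerCard_union (s : ι → ι) {I T : Finset ι} (h : Disjoint I T) :
    lowerCard s (I ∪ T) = lowerCard s I + lowerCard s T := by
  rw [lowerCard, filter_union, card_union_of_disjoint (disjoint_filter_filter h)]
  rfl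

theorem sum_powerset_filter_eq {D T : Finset ι} {P Q : Finset ι → Prop} [DecidablePred P]
    [DecidablePred Q] (hD : D ⊆ E) (hT : T ⊆ D)
    (hPQ : ∀ I, I ⊆ E \ D → (Q I ↔ P (I ∪ T))) (hP : ∀ I, I ⊆ E → P I → I ∩ D = T) :
    ∑ I ∈ E.powerset with P I, (X : ℕ[X]) ^ lowerCard s I =
      X ^ lowerCard s T * ∑ I ∈ (E \ D).powerset with Q I, X ^ lowerCard s I := by
  have hdisj : ∀ I, I ⊆ E \ D → Disjoint I T := fun I hI =>
    (disjoint_sdiff_self_left (x := D) (y := E)).mono hI hT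
  have hrec : ∀ I, I ⊆ E → P I → I \ D ∪ T = I := fun I hI hPI => by
    rw [← hP I hI hPI, sdiff_union_inter]
  rw [mul_sum]
  symm
  refine sum_nbij' (fun I => I ∪ T) (fun I => I \ D) ?_ ?_ ?_ ?_ ?_
  · intro I hI
    rw [mem_filter, mem_powerset] at hI ⊢
    exact ⟨union_subset (hI.1.trans sdiff_subset) (hT.trans hD), (hPQ I hI.1).1 hI.2⟩
  · intro I hI
    rw [mem_filter, mem_powerset] at hI ⊢
    have h1 := sdiff_subset_sdiff hI.1 (le_refl D)
    exact ⟨h1, (hPQ _ h1).2 (by rw [hrec I hI.1 hI.2]; exact hI.2)⟩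
  · intro I hI
    rw [mem_filter, mem_powerset] at hI
    ext x
    have := @hI.1 x
    have := @hT x
    simp only [mem_sdiff, mem_union] at *
    tauto
  · intro I hI
    rw [mem_filter, mem_powerset] at hI
    exact hrec I hI.1 hI.2
  · intro I hI
    rw [mem_filter, mem_powerset] at hI
    rw [lowerCard_union s (hdisj I hI.1), pow_add, mul_comm]

theorem sum_filter_mem_add (P : Finset ι → Prop) [DecidablePred P] (a : ι) (F : Finset (Finset ι)) :
    ∑ I ∈ F with P I, (X : ℕ[X]) ^ lowerCard s I =
      ∑ I ∈ F with P I ∧ a ∈ I, (X : ℕ[X]) ^ lowerCard s I +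
        ∑ I ∈ F with P I ∧ a ∉ I, (X : ℕ[X]) ^ lowerCard s I := by
  rw [← sum_filter_add_sum_filter_not _ (fun I => a ∈ I), filter_filter, filter_filter]

theorem exists_adjacent_arc (h : IsNoncrossing τ) (hE : E.Nonempty)
    (hτ : ∀ x ∈ E, τ x ∈ E ∧ τ x ≠ x) :
    ∃ a ∈ E, a < τ a ∧ ∀ x ∈ E, a < x → ¬ x < τ a := by
  have hne : (E.filter fun a => a < τ a).Nonempty := by
    obtain ⟨x, hx⟩ := hE
    obtain ⟨h1, h2⟩ := hτ x hx
    rcases h2.lt_or_gt with h3 | h3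
    · exact ⟨τ x, by simp [h1, h.invol, h3]⟩
    · exact ⟨x, by simp [hx, h3]⟩
  obtain ⟨a, ha, hmin⟩ := exists_min_image _
    (fun a => #(E.filter fun y => a < y ∧ y < τ a)) hne
  rw [mem_filter] at ha
  refine ⟨a, ha.1, ha.2, fun x hx hax hxa => ?_⟩
  have hx' := hτ x hx
  have hn := h.nested a x hax hxa
  have hxx := h.invol x
  have key : ∀ y ∈ E, a < y → y < τ a → y < τ y → a < τ y → τ y < τ a → False := by
    intro y hy h1 h2 h3 h4 h5
    refine (hmin y (by simp [hy, h3])).not_gt (card_lt_card ?_)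
    rw [ssubset_iff_of_subset]
    · exact ⟨y, by simp [hy, h1, h2], by simp⟩
    · intro z hz
      rw [mem_filter] at hz ⊢
      exact ⟨hz.1, h1.trans hz.2.1, hz.2.2.trans h5⟩
  rcases hx'.2.lt_or_gt with h3 | h3
  · exact key (τ x) hx'.1 hn.1 hn.2 (by rwa [hxx]) (by rwa [hxx]) (by rwa [hxx])
  · exact key x hx hax hxa h3 hn.1 hn.2

/-- `E` is a union of `s`-pairs and of `τ`-arcs, and `τ` has no other arcs. -/
structure IsSupport (s τ : ι → ι) (E : Finset ι) : Prop where
  star : ∀ x ∈ E, s x ∈ E ∧ s x ≠ x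
  arc : ∀ x ∈ E, τ x ∈ E ∧ τ x ≠ x
  fixed : ∀ x, x ∉ E → τ x = x

theorem colorPoly_of_star_arc (h : IsNoncrossing τ) (hs : ∀ x, s (s x) = x)
    (hE : IsSupport s τ E) {a : ι} (ha : a ∈ E) (hab : a < τ a) (hsa : s a = τ a) :
    colorPoly s τ E = (X + 1) * colorPoly s (toggleArc τ a (τ a)) (E \ {a, τ a}) := by
  have hD : {a, τ a} ⊆ E := by
    intro x; have := hE.arc a ha; simp only [mem_insert, mem_singleton]; grind
  have h1 : lowerCard s {a} = 1 := by simp [lowerCard, filter_singleton, hsa, hab]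
  have h2 : lowerCard s {τ a} = 0 := by
    simp [lowerCard, filter_singleton, ← hsa, hs, (hsa ▸ hab).not_gt]
  have hτs := h.invol
  have key : ∀ c, (c = a ∨ c = τ a) → ∀ I, I ⊆ E \ {a, τ a} →
      (IsColoring s (toggleArc τ a (τ a)) (E \ {a, τ a}) I ↔
        IsColoring s τ E (I ∪ {c}) ∧ c ∈ I ∪ {c}) := by
    intro c hc I hI
    have hI' : ∀ x ∈ I, x ∈ E ∧ x ≠ a ∧ x ≠ τ a := fun x hx => by simpa using hI hx
    constructor
    · intro H
      refine ⟨fun x hx => ?_, by simp⟩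
      have H1 := H x
      have := hs x
      have := hs a
      have := hτs x
      have := hτs a
      simp only [mem_sdiff, mem_insert, mem_singleton, mem_union, toggleArc,
        Equiv.swap_apply_def] at H1 ⊢
      grind
    · rintro ⟨H, -⟩ x hx
      have H1 := H x
      have := hs x
      have := hs a
      have := hτs x
      have := hτs a
      simp only [mem_sdiff, mem_insert, mem_singleton, mem_union, toggleArc,
        Equiv.swap_apply_def] at hx H1 ⊢
      grind
  have hP1 : ∀ I, I ⊆ E → IsColoring s τ E I ∧ a ∈ I → I ∩ {a, τ a} = {a} := by
    rintro I - ⟨H, haI⟩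
    have := H a ha
    ext x
    simp only [mem_inter, mem_insert, mem_singleton]
    grind
  have hP2 : ∀ I, I ⊆ E → IsColoring s τ E I ∧ a ∉ I → I ∩ {a, τ a} = {τ a} := by
    rintro I - ⟨H, haI⟩
    have := H a ha
    ext x
    simp only [mem_inter, mem_insert, mem_singleton]
    grind
  rw [colorPoly, sum_filter_mem_add (IsColoring s τ E) a,
    sum_powerset_filter_eq hD (by simp) (key a (Or.inl rfl)) hP1,
    sum_powerset_filter_eq hD (T := {τ a}) (by simp)
      (fun I hI => (key (τ a) (Or.inr rfl) I hI).trans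
      ⟨fun ⟨H, H'⟩ => ⟨H, fun H'' => ((H a ha).2.1 H') H''⟩,
        fun ⟨H, _⟩ => ⟨H, by simp⟩⟩) hP2,
    h1, h2, colorPoly]
  ring

theorem arc_sameSide (hs : ∀ x, s (s x) = x) (hanti : StrictAnti s)
    (hE : IsSupport s τ E) {a : ι} (ha : a ∈ E) (hab : a < τ a) (hsa : s a ≠ τ a)
    (hadj : ∀ x ∈ E, a < x → ¬ x < τ a) : a < s a ↔ τ a < s (τ a) := by
  have h1 := hE.arc a ha
  have h2 := hE.star a ha
  have h3 := hE.star _ h1.1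
  have h4 := hanti hab
  constructor
  · intro h5
    have := hadj _ h2.1 h5
    by_contra h6
    have h7 := hadj _ h3.1
    have h8 : s (τ a) ≠ a := fun h => hsa (by rw [← h, hs, h])
    have h9 := hanti.lt_iff_gt (a := s (τ a)) (b := a)
    rw [hs] at h9
    grind
  · intro h5
    exact hab.trans (h5.trans h4)

theorem lowerCard_pair (hs : ∀ x, s (s x) = x) {a b : ι}
    (ha : s a ≠ a) (hb : s b ≠ b) (hside : a < s a ↔ b < s b) : lowerCard s {a, s b} = 1 := by
  rw [lowerCard, filter_insert, filter_singleton, hs]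
  rcases ha.lt_or_gt with h1 | h1 <;> rcases hb.lt_or_gt with h2 | h2 <;>
    simp [h1, h2, h1.not_gt, h2.not_gt] <;> grind

theorem IsColoring.inter_eq {a : ι} (hE : IsSupport s τ E)
    (ha : a ∈ E) {I : Finset ι} (H : IsColoring s τ E I) :
    (a ∈ I → I ∩ {a, τ a, s a, s (τ a)} = {a, s (τ a)}) ∧
      (a ∉ I → I ∩ {a, τ a, s a, s (τ a)} = {τ a, s a}) := by
  have h1 := H a ha
  have h2 := H _ (hE.arc a ha).1
  constructor <;>
  · intro haI
    ext x
    simp only [mem_inter, mem_insert, mem_singleton]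
    grind

theorem colorPoly_of_parallel_arcs (h : IsNoncrossing τ) (hs : ∀ x, s (s x) = x)
    (hanti : StrictAnti s) (hE : IsSupport s τ E) {a : ι} (ha : a ∈ E) (hab : a < τ a)
    (hsa : s a ≠ τ a) (hadj : ∀ x ∈ E, a < x → ¬ x < τ a) (hp : τ (s a) = s (τ a)) :
    colorPoly s τ E = 2 * X *
      colorPoly s (toggleArc (toggleArc τ a (τ a)) (s (τ a)) (s a))
        (E \ {a, τ a, s a, s (τ a)}) := by
  have e1 := hE.arc a ha
  have e2 := hE.star a ha
  have e3 := hE.star _ e1.1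
  have hτs := h.invol
  have hD : {a, τ a, s a, s (τ a)} ⊆ E := by
    intro x; simp only [mem_insert, mem_singleton]; grind
  have hside := arc_sameSide hs hanti hE ha hab hsa hadj
  have h1 : lowerCard s {a, s (τ a)} = 1 := lowerCard_pair hs e2.2 e3.2 hside
  have h2 : lowerCard s {τ a, s a} = 1 := lowerCard_pair hs e3.2 e2.2 hside.symm
  have key : ∀ c d, (c = a ∧ d = τ a ∨ c = τ a ∧ d = a) → ∀ I, I ⊆ E \ {a, τ a, s a, s (τ a)} →
      (IsColoring s (toggleArc (toggleArc τ a (τ a)) (s (τ a)) (s a))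
        (E \ {a, τ a, s a, s (τ a)}) I ↔
        IsColoring s τ E (I ∪ {c, s d}) ∧ c ∈ I ∪ {c, s d}) := by
    intro c d hc I hI
    have hI' : ∀ x ∈ I, x ∈ E ∧ x ≠ a ∧ x ≠ τ a ∧ x ≠ s a ∧ x ≠ s (τ a) := fun x hx => by
      simpa using hI hx
    have a1 := hs a
    have a2 := hs (τ a)
    have a3 := hτs a
    have a4 := hτs (s a)
    constructor
    · intro H
      refine ⟨fun x hx => ?_, by simp⟩
      have H1 := H x
      have := hs x
      have := hτs x
      simp only [mem_sdiff, mem_insert, mem_singleton, mem_union, toggleArc,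
        Equiv.swap_apply_def] at H1 ⊢
      clear hs hτs hadj h1 h2 hside H hI hD hanti hE h hab
      by_cases x1 : x = a
      · subst x1; grind
      by_cases x2 : x = τ a
      · subst x2; grind
      by_cases x3 : x = s a
      · subst x3; grind
      by_cases x4 : x = s (τ a)
      · subst x4; grind
      rcases hc with ⟨rfl, rfl⟩ | ⟨rfl, rfl⟩ <;> grind
    · rintro ⟨H, -⟩ x hx
      have H1 := H x
      have := hs x
      have := hτs x
      simp only [mem_sdiff, mem_insert, mem_singleton, mem_union, toggleArc,
        Equiv.swap_apply_def] at hx H1 ⊢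
      grind
  rw [colorPoly, sum_filter_mem_add (IsColoring s τ E) a,
    sum_powerset_filter_eq hD (T := {a, s (τ a)}) (by intro x; simp; tauto)
      (key a (τ a) (Or.inl ⟨rfl, rfl⟩)) (fun I _ H => (H.1.inter_eq hE ha).1 H.2),
    sum_powerset_filter_eq hD (T := {τ a, s a}) (by intro x; simp; tauto)
      (fun I hI => (key (τ a) a (Or.inr ⟨rfl, rfl⟩) I hI).trans
      ⟨fun ⟨H, H'⟩ => ⟨H, fun H'' => ((H a ha).2.1 H') H''⟩,
        fun ⟨H, _⟩ => ⟨H, by simp⟩⟩) (fun I _ H => (H.1.inter_eq hE ha).2 H.2),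
    h1, h2, colorPoly]
  ring

theorem colorPoly_of_joinArcs (h : IsNoncrossing τ) (hs : ∀ x, s (s x) = x)
    (hanti : StrictAnti s) (hE : IsSupport s τ E) {a : ι} (ha : a ∈ E) (hab : a < τ a)
    (hsa : s a ≠ τ a) (hadj : ∀ x ∈ E, a < x → ¬ x < τ a) (hp : τ (s a) ≠ s (τ a)) :
    colorPoly s τ E = X *
      colorPoly s (joinArcs (toggleArc τ a (τ a)) (s (τ a)) (s a))
        (E \ {a, τ a, s a, s (τ a)}) := by
  have e1 := hE.arc a ha
  have e2 := hE.star a ha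
  have e3 := hE.star _ e1.1
  have e4 := hE.arc _ e2.1
  have e5 := hE.arc _ e3.1
  have hτs := h.invol
  have hD : {a, τ a, s a, s (τ a)} ⊆ E := by
    intro x; simp only [mem_insert, mem_singleton]; grind
  have hside := arc_sameSide hs hanti hE ha hab hsa hadj
  have h1 : lowerCard s {a, s (τ a)} = 1 := lowerCard_pair hs e2.2 e3.2 hside
  have h2 : lowerCard s {τ a, s a} = 1 := lowerCard_pair hs e3.2 e2.2 hside.symm
  have a1 := hs a
  have a2 := hs (τ a)
  have a3 := hτs a
  have a4 := hτs (s a)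
  have a5 := hτs (s (τ a))
  have hopp : ∀ I, IsColoring s (joinArcs (toggleArc τ a (τ a)) (s (τ a)) (s a))
      (E \ {a, τ a, s a, s (τ a)}) I → (τ (s (τ a)) ∈ I ↔ τ (s a) ∉ I) := by
    intro I H
    have H2 := H (τ (s a))
    simp only [mem_sdiff, mem_insert, mem_singleton, toggleArc, joinArcs,
      Equiv.swap_apply_def] at H2
    grind
  have key : ∀ c d, (c = a ∧ d = τ a ∨ c = τ a ∧ d = a) → ∀ I, I ⊆ E \ {a, τ a, s a, s (τ a)} →
      (IsColoring s (joinArcs (toggleArc τ a (τ a)) (s (τ a)) (s a))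
        (E \ {a, τ a, s a, s (τ a)}) I ∧ τ (s c) ∈ I ↔
        IsColoring s τ E (I ∪ {c, s d}) ∧ c ∈ I ∪ {c, s d}) := by
    intro c d hc I hI
    have hI' : ∀ x ∈ I, x ∈ E ∧ x ≠ a ∧ x ≠ τ a ∧ x ≠ s a ∧ x ≠ s (τ a) := fun x hx => by
      simpa using hI hx
    constructor
    · rintro ⟨H, H0⟩
      refine ⟨fun x hx => ?_, by simp⟩
      have H1 := H x
      have H2 := hopp I H
      have := hs x
      have := hτs x
      simp only [mem_sdiff, mem_insert, mem_singleton, mem_union, toggleArc, joinArcs,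
        Equiv.swap_apply_def] at H1 ⊢
      clear hopp hs hτs hadj h1 h2 hside H hI hD hanti hE h hab
      by_cases x1 : x = a
      · subst x1; grind
      by_cases x2 : x = τ a
      · subst x2; grind
      by_cases x3 : x = s a
      · subst x3; rcases hc with ⟨rfl, rfl⟩ | ⟨rfl, rfl⟩ <;> grind
      by_cases x4 : x = s (τ a)
      · subst x4; rcases hc with ⟨rfl, rfl⟩ | ⟨rfl, rfl⟩ <;> grind
      rcases hc with ⟨rfl, rfl⟩ | ⟨rfl, rfl⟩ <;> grind
    · rintro ⟨H, -⟩
      have H2 := H (s a)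
      have H3 := H (s (τ a))
      refine ⟨fun x hx => ?_, ?_⟩
      · have H1 := H x
        have := hs x
        have := hτs x
        simp only [mem_sdiff, mem_insert, mem_singleton, mem_union, toggleArc, joinArcs,
          Equiv.swap_apply_def] at hx H1 H2 H3 ⊢
        grind
      · simp only [mem_insert, mem_singleton, mem_union] at H2 H3
        grind
  have hsplit := sum_filter_mem_add (s := s)
    (IsColoring s (joinArcs (toggleArc τ a (τ a)) (s (τ a)) (s a)) (E \ {a, τ a, s a, s (τ a)}))
    (τ (s a)) (E \ {a, τ a, s a, s (τ a)}).powerset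
  rw [colorPoly, sum_filter_mem_add (IsColoring s τ E) a,
    sum_powerset_filter_eq hD (T := {a, s (τ a)}) (by intro x; simp; tauto)
      (key a (τ a) (Or.inl ⟨rfl, rfl⟩)) (fun I _ H => (H.1.inter_eq hE ha).1 H.2),
    sum_powerset_filter_eq hD (T := {τ a, s a}) (by intro x; simp; tauto)
      (fun I hI => (and_congr_right fun H => (hopp I H).symm).trans
        ((key (τ a) a (Or.inr ⟨rfl, rfl⟩) I hI).trans
      ⟨fun ⟨H, H'⟩ => ⟨H, fun H'' => ((H a ha).2.1 H') H''⟩,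
        fun ⟨H, _⟩ => ⟨H, by simp⟩⟩)) (fun I _ H => (H.1.inter_eq hE ha).2 H.2),
    h1, h2, colorPoly, hsplit]
  ring

theorem lowerCard_sdiff_add {D : Finset ι} (hD : D ⊆ E) :
    lowerCard s (E \ D) + lowerCard s D = lowerCard s E := by
  rw [← lowerCard_union s disjoint_sdiff_self_left, sdiff_union_of_subset hD]

theorem IsSupport.removeParallelArcs (hE : IsSupport s τ E) (h : IsNoncrossing τ)
    (hs : ∀ x, s (s x) = x)
    {a : ι} (ha : a ∈ E) (hsa : s a ≠ τ a) (hp : τ (s a) = s (τ a)) :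
    IsSupport s (toggleArc (toggleArc τ a (τ a)) (s (τ a)) (s a))
        (E \ {a, τ a, s a, s (τ a)}) := by
  have e1 := hE.arc a ha
  have e2 := hE.star a ha
  have e3 := hE.star _ e1.1
  have e4 := hE.arc _ e2.1
  have e5 := hE.arc _ e3.1
  have hτs := h.invol
  have a1 := hs a
  have a2 := hs (τ a)
  have a3 := hτs a
  have a4 := hτs (s a)
  have a5 := hτs (s (τ a))
  refine ⟨fun x hx => ?_, fun x hx => ?_, fun x hx => ?_⟩ <;>
  · have f1 := hE.star x
    have f2 := hE.arc x
    have f3 := hE.fixed x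
    have := hs x
    have := hτs x
    simp only [mem_sdiff, mem_insert, mem_singleton, toggleArc, Equiv.swap_apply_def] at hx ⊢
    clear hs hτs hE h
    grind

theorem IsSupport.joinArcs (hE : IsSupport s τ E) (h : IsNoncrossing τ) (hs : ∀ x, s (s x) = x)
    {a : ι} (ha : a ∈ E) (hsa : s a ≠ τ a) (hp : τ (s a) ≠ s (τ a)) :
    IsSupport s (joinArcs (toggleArc τ a (τ a)) (s (τ a)) (s a))
        (E \ {a, τ a, s a, s (τ a)}) := by
  have e1 := hE.arc a ha
  have e2 := hE.star a ha
  have e3 := hE.star _ e1.1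
  have e4 := hE.arc _ e2.1
  have e5 := hE.arc _ e3.1
  have hτs := h.invol
  have a1 := hs a
  have a2 := hs (τ a)
  have a3 := hτs a
  have a4 := hτs (s a)
  have a5 := hτs (s (τ a))
  refine ⟨fun x hx => ?_, fun x hx => ?_, fun x hx => ?_⟩ <;>
  · have f1 := hE.star x
    have f2 := hE.arc x
    have f3 := hE.fixed x
    have := hs x
    have := hτs x
    simp only [mem_sdiff, mem_insert, mem_singleton, toggleArc, _root_.joinArcs,
      Equiv.swap_apply_def] at hx ⊢
    clear hs hτs hE h
    grind

theorem IsSupport.removeStarArc (hE : IsSupport s τ E) (h : IsNoncrossing τ) (hs : ∀ x, s (s x) = x)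
    {a : ι} (ha : a ∈ E) (hsa : s a = τ a) :
    IsSupport s (toggleArc τ a (τ a)) (E \ {a, τ a}) := by
  have e1 := hE.arc a ha
  have e2 := hE.star a ha
  have e3 := hE.star _ e1.1
  have e4 := hE.arc _ e2.1
  have e5 := hE.arc _ e3.1
  have hτs := h.invol
  have a1 := hs a
  have a2 := hs (τ a)
  have a3 := hτs a
  have a4 := hτs (s a)
  have a5 := hτs (s (τ a))
  refine ⟨fun x hx => ?_, fun x hx => ?_, fun x hx => ?_⟩ <;>
  · have f1 := hE.star x
    have f2 := hE.arc x
    have f3 := hE.fixed x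
    have := hs x
    have := hτs x
    simp only [mem_sdiff, mem_insert, mem_singleton, toggleArc, Equiv.swap_apply_def] at hx ⊢
    clear hs hτs hE h
    grind

theorem exists_colorPoly_eq (hs : ∀ x, s (s x) = x) (hanti : StrictAnti s)
    (h : IsNoncrossing τ) (hE : IsSupport s τ E) :
    ∃ c m o : ℕ, 2 * m + o = lowerCard s E ∧
      colorPoly s τ E = (c : ℕ[X]) * (X ^ m * (1 + X) ^ o) := by
  generalize hq : #E = q
  induction q using Nat.strong_induction_on generalizing E τ with
  | _ q ih =>
  rcases E.eq_empty_or_nonempty with rfl | hne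
  · refine ⟨1, 0, 0, by simp [lowerCard], ?_⟩
    have : IsColoring s τ ∅ ∅ := fun x hx => by simp at hx
    simp [colorPoly, filter_singleton, this, lowerCard]
  obtain ⟨a, ha, hab, hadj⟩ := exists_adjacent_arc h hne hE.arc
  have e1 := hE.arc a ha
  have e2 := hE.star a ha
  have e3 := hE.star _ e1.1
  have hτs := h.invol
  have a1 := hs a
  have a2 := hs (τ a)
  have a3 := hτs a
  have a4 := hτs (s a)
  have a5 := hτs (s (τ a))
  have hn1 := h.removeArc (a := a) rfl
  by_cases hsa : s a = τ a
  · have hD : {a, τ a} ⊆ E := by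
      intro x; simp only [mem_insert, mem_singleton]; grind
    have hcard := lowerCard_sdiff_add (s := s) hD
    have h1 : lowerCard s {a, τ a} = 1 := by
      simp [lowerCard, filter_insert, filter_singleton, ← hsa, hs, (hsa ▸ hab).not_gt, hsa ▸ hab]
    have hE' := hE.removeStarArc h hs ha hsa
    have hlt : #(E \ {a, τ a}) < q :=
      hq ▸ card_lt_card (sdiff_ssubset hD ⟨a, by simp⟩)
    obtain ⟨c, m, o, hmo, hc⟩ := ih _ hlt hn1 hE' rfl
    refine ⟨c, m, o + 1, by omega, ?_⟩
    rw [colorPoly_of_star_arc h hs hE ha hab hsa, hc]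
    ring
  have hside := arc_sameSide hs hanti hE ha hab hsa hadj
  have hD : {a, τ a, s a, s (τ a)} ⊆ E := by
    intro x; simp only [mem_insert, mem_singleton]; grind
  have hcard := lowerCard_sdiff_add (s := s) hD
  have h1 : lowerCard s {a, s (τ a)} = 1 := lowerCard_pair hs e2.2 e3.2 hside
  have h2 : lowerCard s {τ a, s a} = 1 := lowerCard_pair hs e3.2 e2.2 hside.symm
  have hDu : ({a, τ a, s a, s (τ a)} : Finset ι) = {a, s (τ a)} ∪ {τ a, s a} := by
    ext x; simp; tauto
  rw [hDu, lowerCard_union s (by simp; grind), h1, h2, ← hDu] at hcard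
  have hlt : #(E \ {a, τ a, s a, s (τ a)}) < q :=
    hq ▸ card_lt_card (sdiff_ssubset hD ⟨a, by simp⟩)
  have hss : s (τ a) < s a := hanti hab
  by_cases hp : τ (s a) = s (τ a)
  · have hE' := hE.removeParallelArcs h hs ha hsa hp
    have hn2 := hn1.removeArc (a := s (τ a)) (b := s a) (by
      simp only [toggleArc, Equiv.swap_apply_def]
      clear ih hadj hs hτs
      grind)
    obtain ⟨c, m, o, hmo, hc⟩ := ih _ hlt hn2 hE' rfl
    refine ⟨2 * c, m + 1, o, by omega, ?_⟩
    rw [colorPoly_of_parallel_arcs h hs hanti hE ha hab hsa hadj hp, hc]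
    push_cast
    ring
  · have e4 := hE.arc _ e2.1
    have e5 := hE.arc _ e3.1
    have hE' := hE.joinArcs h hs ha hsa hp
    have hn2 := hn1.joinArcs hss
      (by simp only [toggleArc, Equiv.swap_apply_def]; clear ih hadj hs hτs; grind)
      (by simp only [toggleArc, Equiv.swap_apply_def]; clear ih hadj hs hτs; grind)
      (fun x hx1 hx2 => by
        have f1 := hE.star x
        have f3 := hE.fixed x
        have g1 := hadj (s x)
        have g2 := hanti hx1
        have g3 := hanti hx2
        rw [hs] at g2 g3
        simp only [toggleArc, Equiv.swap_apply_def]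
        clear ih hadj hs hτs
        grind)
    obtain ⟨c, m, o, hmo, hc⟩ := ih _ hlt hn2 hE' rfl
    refine ⟨c, m + 1, o, by omega, ?_⟩
    rw [colorPoly_of_joinArcs h hs hanti hE ha hab hsa hadj hp, hc]
    ring

end

section

open Polynomial

variable {n k : ℕ}

theorem star_apply_star (x : Fin (2 * n)) : star n (star n x) = x := by
  rw [Fin.ext_iff]
  simp only [_root_.star]
  omega

theorem star_strictAnti : StrictAnti (star n) := by
  intro x y hxy
  rw [Fin.lt_def] at hxy ⊢
  simp only [_root_.star]
  omega

theorem star_ne_self (x : Fin (2 * n)) : star n x ≠ x := by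
  rw [ne_eq, Fin.ext_iff]
  simp only [_root_.star]
  omega

theorem lt_star_iff (x : Fin (2 * n)) : x < star n x ↔ (x : ℕ) < n := by
  rw [Fin.lt_def]
  simp only [_root_.star]
  omega

theorem le_star_iff (x : Fin (2 * n)) : n ≤ (star n x : ℕ) ↔ (x : ℕ) < n := by
  simp only [_root_.star]
  omega

theorem mem_princFinset {l : ℕ} {I : Finset (Fin (2 * n))} :
    I ∈ princFinset n l ↔ (∀ x, star n x ∈ I ↔ x ∉ I) ∧ lowerCard (star n) I = l := by
  have hup : ∀ P : Finset (Fin (2 * n)), (∀ x ∈ P, (x : ℕ) < n) → ∀ x : Fin (2 * n),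
      (x ∈ P ∪ ((univ.filter fun x : Fin (2 * n) => n ≤ (x : ℕ)) \ P.image (star n)) ↔
        x ∈ P ∨ n ≤ (x : ℕ) ∧ star n x ∉ P) := by
    intro P hP x
    simp only [mem_union, mem_sdiff, mem_filter, mem_univ, true_and, mem_image, not_exists, not_and]
    refine or_congr_right (and_congr_right fun _ => ⟨fun h h' => h _ h' (star_apply_star x), ?_⟩)
    rintro h y hy rfl
    exact h (by rwa [star_apply_star])
  have hlow : ∀ I : Finset (Fin (2 * n)), lowerCard (star n) I =
      #(I.filter fun x : Fin (2 * n) => (x : ℕ) < n) := fun I => by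
    rw [lowerCard]
    simp only [lt_star_iff]
  rw [hlow]
  simp only [princFinset, mem_image, mem_filter, mem_powerset]
  constructor
  · rintro ⟨P, ⟨hP, rfl⟩, rfl⟩
    have hP' : ∀ x ∈ P, (x : ℕ) < n := fun x hx => by simpa using hP hx
    refine ⟨fun x => ?_, ?_⟩
    · rw [hup P hP', hup P hP', star_apply_star, le_star_iff]
      have h1 := hP' x
      have h2 := hP' (star n x)
      have h3 := le_star_iff x
      by_cases hx : (x : ℕ) < n
      · have : star n x ∉ P := fun h => by have := h2 h; omega
        simp [this, hx]
      · have : x ∉ P := fun h => hx (h1 h)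
        simp [this, hx]
        omega
    · congr 1
      ext x
      rw [mem_filter, hup P hP']
      constructor
      · rintro ⟨h | h, h'⟩
        · exact h
        · omega
      · exact fun h => ⟨Or.inl h, hP' x h⟩
  · rintro ⟨h1, rfl⟩
    have hP' : ∀ x ∈ I.filter (fun x : Fin (2 * n) => (x : ℕ) < n), (x : ℕ) < n :=
      fun x hx => (mem_filter.1 hx).2
    refine ⟨I.filter (fun x : Fin (2 * n) => (x : ℕ) < n),
      ⟨fun x hx => by simp [hP' x hx], rfl⟩, ?_⟩
    ext x
    rw [hup _ hP', mem_filter, mem_filter]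
    have h2 := h1 x
    have h3 := le_star_iff (star n x)
    rw [star_apply_star] at h3
    by_cases hx : (x : ℕ) < n
    · simp [hx]
    · simp [hx, h2, h3.1 (by omega)]
      omega

theorem coeff_colorPoly {ι : Type*} [LinearOrder ι] (s τ : ι → ι) (E : Finset ι) (l : ℕ) :
    (colorPoly s τ E).coeff l = #{I ∈ E.powerset | IsColoring s τ E I ∧ lowerCard s I = l} := by
  rw [colorPoly, finsetSum_coeff]
  simp only [coeff_X_pow]
  rw [sum_boole, filter_filter]
  simp [eq_comm]

theorem sum_princFinset_arcIndicator {τ : Fin (2 * n) → Fin (2 * n)} (hτ : ∀ x, τ x ≠ x)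
    (S : Finset (Fin (2 * n))) (l : ℕ) :
    ∑ I ∈ princFinset n l, arcIndicator τ S I Iᶜ = (colorPoly (star n) τ univ).coeff l := by
  classical
  simp only [arcIndicator]
  rw [sum_boole, coeff_colorPoly]
  norm_cast
  congr 1
  ext I
  simp only [mem_filter, mem_princFinset, powerset_univ, mem_univ, true_and, IsColoring, Compatible,
    mem_compl, hτ, IsEmpty.forall_iff, ne_eq, not_false_eq_true, forall_const, forall_and]
  constructor
  · rintro ⟨⟨h1, h2⟩, h3, h4⟩
    exact ⟨⟨h1, fun x => (h3 x).symm⟩, h2⟩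
  · rintro ⟨⟨h1, h3⟩, h2⟩
    exact ⟨⟨h1, h2⟩, fun x => (h3 x).symm, h3⟩

theorem choose_mul_choose_succ_le {m o j : ℕ} (hmo : 2 * m + o = n) (hk : 2 * k + 1 ≤ n)
    (hj : j + m = k) : o.choose j * n.choose (k + 1) ≤ o.choose (j + 1) * n.choose k := by
  obtain ⟨d, rfl⟩ : ∃ d, n = 2 * k + 1 + d := ⟨n - (2 * k + 1), by omega⟩
  subst hj
  obtain rfl : o = 2 * j + 1 + d := by omega
  have h1 := Nat.choose_succ_right_eq (2 * (j + m) + 1 + d) (j + m)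
  have h2 := Nat.choose_succ_right_eq (2 * j + 1 + d) j
  rw [show 2 * (j + m) + 1 + d - (j + m) = j + m + 1 + d by omega] at h1
  rw [show 2 * j + 1 + d - j = j + 1 + d by omega] at h2
  generalize (2 * (j + m) + 1 + d).choose (j + m + 1) = a at *
  generalize (2 * (j + m) + 1 + d).choose (j + m) = b at *
  generalize (2 * j + 1 + d).choose (j + 1) = e at *
  generalize (2 * j + 1 + d).choose j = f at *
  refine Nat.le_of_mul_le_mul_right (c := (j + m + 1) * (j + 1)) ?_ (by positivity)
  calc f * a * ((j + m + 1) * (j + 1)) = f * (j + 1) * (a * (j + m + 1)) := by ring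
    _ = f * b * ((j + 1) * (j + m + 1 + d)) := by rw [h1]; ring
    _ ≤ f * b * ((j + 1 + d) * (j + m + 1)) := by
        refine Nat.mul_le_mul_left _ ?_
        nlinarith [Nat.zero_le (m * d)]
    _ = (e * (j + 1)) * b * (j + m + 1) := by rw [h2]; ring
    _ = e * b * ((j + m + 1) * (j + 1)) := by ring

theorem sum_princFinset_le_of_mem_noncrossingCone (hk : k + 1 ≤ n / 2)
    {f : Finset (Fin (2 * n)) → Finset (Fin (2 * n)) → ℝ} (hf : f ∈ noncrossingCone (Fin (2 * n))) :
    (n.choose k : ℝ)⁻¹ * ∑ I ∈ princFinset n k, f I Iᶜ ≤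
      (n.choose (k + 1) : ℝ)⁻¹ * ∑ I ∈ princFinset n (k + 1), f I Iᶜ := by
  induction hf using Submodule.span_induction with
  | zero => simp
  | add f g _ _ hf hg =>
    simp only [Pi.add_apply, sum_add_distrib, mul_add]
    exact add_le_add hf hg
  | smul c f _ hf =>
    have h : ∀ l, ∑ I ∈ princFinset n l, (c • f) I Iᶜ = (c : ℝ) * ∑ I ∈ princFinset n l, f I Iᶜ :=
      fun l => by rw [mul_sum]; rfl
    rw [h, h, mul_left_comm, mul_left_comm _ (c : ℝ)]
    exact mul_le_mul_of_nonneg_left hf c.2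
  | mem f hf =>
    obtain ⟨τ, S, hτ, rfl⟩ := hf
    by_cases hfix : ∀ x, τ x ≠ x
    swap
    · push Not at hfix
      obtain ⟨x, hx⟩ := hfix
      have : ∀ I : Finset (Fin (2 * n)), arcIndicator τ S I Iᶜ = 0 := fun I => by
        rw [arcIndicator, if_neg]
        intro hI
        have := (hI x).1
        rw [hx, mem_compl] at this
        tauto
      simp [this]
    obtain ⟨c, m, o, hmo, hc⟩ := exists_colorPoly_eq (s := star n) (E := univ) star_apply_star
      star_strictAnti hτ ⟨fun x _ => ⟨mem_univ _, star_ne_self x⟩,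
        fun x _ => ⟨mem_univ _, hfix x⟩, fun x hx => absurd (mem_univ x) hx⟩
    have hcard : lowerCard (star n) univ = n := by
      rw [lowerCard]
      simp only [lt_star_iff]
      rw [Fin.card_filter_val_lt]
      omega
    rw [hcard] at hmo
    rw [sum_princFinset_arcIndicator hfix, sum_princFinset_arcIndicator hfix, hc,
      ← C_eq_natCast, coeff_C_mul, coeff_C_mul, coeff_X_pow_mul', coeff_X_pow_mul',
      coeff_one_add_X_pow, coeff_one_add_X_pow]
    by_cases hm : m ≤ k
    swap
    · rw [if_neg hm]
      simp only [mul_zero, Nat.cast_zero]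
      positivity
    rw [if_pos hm, if_pos (by omega), show k + 1 - m = (k - m) + 1 by omega]
    have h := choose_mul_choose_succ_le (k := k) hmo (by omega) (Nat.sub_add_cancel hm)
    have p1 : (0 : ℝ) < n.choose k := by exact_mod_cast Nat.choose_pos (by omega)
    have p2 : (0 : ℝ) < n.choose (k + 1) := by exact_mod_cast Nat.choose_pos (by omega)
    rw [inv_mul_le_iff₀ p1, mul_left_comm, ← div_eq_inv_mul, le_div_iff₀ p2]
    simp only [Nat.cast_id]
    exact_mod_cast show c * o.choose (k - m) * n.choose (k + 1) ≤
        n.choose k * (c * o.choose (k - m + 1)) by nlinarith [Nat.mul_le_mul_left c h]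

end

section

variable {N n : ℕ}

theorem moveElem_moveElem {ι : Type*} [DecidableEq ι] {a b : ι} {I : Finset ι} (hb : b ∈ I)
    (ha : a ∉ I) : moveElem b a (moveElem a b I) = I := by
  have : a ≠ b := fun h => ha (h ▸ hb)
  rw [moveElem, moveElem, erase_insert (by simp [ha]), insert_erase hb]

theorem card_moveElem {ι : Type*} [DecidableEq ι] {a b : ι} {I : Finset ι} (hb : b ∈ I)
    (ha : a ∉ I) : (moveElem a b I).card = I.card := by
  rw [moveElem, card_insert_of_notMem (by simp [ha]), card_erase_of_mem hb]
  have := card_pos.2 ⟨b, hb⟩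
  omega

/-- Subsets of a given size are connected under moves to adjacent positions. -/
theorem iff_of_forall_moveElem {Z : Finset (Fin N) → Prop}
    (hZ : ∀ a b : Fin N, ((a : ℕ) + 1 = b ∨ (b : ℕ) + 1 = a) → ∀ I, I.card = n → b ∈ I → a ∉ I →
      Z I → Z (moveElem a b I)) {I : Finset (Fin N)} (hI : I.card = n) :
    Z I ↔ Z (univ.filter fun x : Fin N => (x : ℕ) < n) := by
  generalize hq : ∑ x ∈ I, (x : ℕ) = q
  induction q using Nat.strong_induction_on generalizing I with
  | _ q ih =>
  by_cases hex : ∃ a b : Fin N, (a : ℕ) + 1 = b ∧ b ∈ I ∧ a ∉ I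
  · obtain ⟨a, b, hab, hb, ha⟩ := hex
    have hc := (card_moveElem hb ha).trans hI
    have hsum : ∑ x ∈ moveElem a b I, (x : ℕ) < q := by
      rw [moveElem, sum_insert (by simp [ha]), ← hq, ← add_sum_erase I _ hb]
      omega
    rw [← ih _ hsum hc rfl]
    refine ⟨hZ a b (Or.inl hab) I hI hb ha, fun h => ?_⟩
    have := hZ b a (Or.inr hab) _ hc (mem_insert_self a _)
      (by simp [moveElem, show b ≠ a from fun h => ha (h ▸ hb)]) h
    rwa [moveElem_moveElem hb ha] at this
  · push Not at hex
    have hdown : ∀ q : ℕ, ∀ x y : Fin N, (y : ℕ) + q = x → x ∈ I → y ∈ I := by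
      intro q
      induction q with
      | zero => intro x y h hx; rwa [show y = x from Fin.ext (by omega)]
      | succ q ihq =>
        intro x y h hx
        exact hex y ⟨y + 1, by omega⟩ rfl (ihq x ⟨y + 1, by omega⟩ (by simp only; omega) hx)
    have hle : n ≤ N := by simpa [hI] using card_le_univ I
    have : I = univ.filter fun x : Fin N => (x : ℕ) < n := by
      refine eq_of_subset_of_card_le (fun x hx => ?_) ?_
      · by_contra hxn
        simp only [mem_filter, mem_univ, true_and, not_lt] at hxn
        have hsub : Finset.Iic x ⊆ I := fun y hy => by
          rw [mem_Iic, Fin.le_def] at hy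
          exact hdown (x - y) x y (by omega) hx
        have := card_le_card hsub
        rw [Fin.card_Iic] at this
        omega
      · rw [hI, Fin.card_filter_val_lt]
        omega
    rw [← this]

end

section

variable {n k : ℕ}

theorem inv_choose_mul_sum_le (hn : 1 ≤ n) (hk : k + 1 ≤ n / 2)
    (A : Matrix (Fin (2 * n)) (Fin n) ℝ) (hpos : ∀ K, 0 ≤ pluck A K) :
    (n.choose k : ℝ)⁻¹ * ∑ I ∈ princFinset n k, pluck A I * pluck A Iᶜ ≤
      (n.choose (k + 1) : ℝ)⁻¹ * ∑ I ∈ princFinset n (k + 1), pluck A I * pluck A Iᶜ := by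
  generalize hq : #{I | I.card = n ∧ pluck A I = 0} = q
  induction q using Nat.strong_induction_on generalizing A with
  | _ q ih =>
  by_cases hall : ∀ I, I.card = n → 0 < pluck A I
  · obtain ⟨r, rfl⟩ : ∃ r, n = r + 1 := ⟨n - 1, by omega⟩
    exact sum_princFinset_le_of_mem_noncrossingCone hk (pluck_mul_pluck_mem_noncrossingCone A hall)
  by_cases hnone : ∀ I, pluck A I = 0
  · simp [hnone]
  push Not at hall hnone
  obtain ⟨I₁, hI₁, h₁⟩ := hall
  obtain ⟨I₂, h₂⟩ := hnone
  have hI₂ : I₂.card = n := by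
    by_contra h
    exact h₂ (pluck_of_card_ne A h)
  obtain ⟨a, b, hab, I, hI, hb, ha, hz, hnz⟩ : ∃ a b : Fin (2 * n),
      ((a : ℕ) + 1 = b ∨ (b : ℕ) + 1 = a) ∧ ∃ I, I.card = n ∧ b ∈ I ∧ a ∉ I ∧ pluck A I = 0 ∧
        pluck A (moveElem a b I) ≠ 0 := by
    by_contra! hcon
    have hiff := fun (I : Finset (Fin (2 * n))) (hI : I.card = n) =>
      iff_of_forall_moveElem (Z := fun I => pluck A I = 0) (n := n) hcon hI
    exact h₂ ((hiff I₂ hI₂).2 ((hiff I₁ hI₁).1 (h₁.antisymm (hpos I₁))))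
  have hne : a ≠ b := fun h => ha (h ▸ hb)
  have hadj : ∀ x : Fin (2 * n), x ≠ a → x ≠ b → (x < a ↔ x < b) := fun x h1 h2 => by
    rw [ne_eq, Fin.ext_iff] at h1 h2
    rw [Fin.lt_def, Fin.lt_def]
    omega
  have hbr : ∀ (t : ℝ), pluck (A.updateRow b (A.row b + t • A.row a)) = bridge a b t (pluck A) :=
    fun t => funext fun J => pluck_updateRow_add_smul A hne hadj t J
  have hle : ∀ t : ℝ, 0 ≤ t → ∀ J, pluck A J ≤ bridge a b t (pluck A) J := fun t ht J => by
    rw [bridge, le_add_iff_nonneg_right]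
    split_ifs
    · exact mul_nonneg ht (hpos _)
    · exact le_rfl
  have hstep : ∀ t : ℝ, 0 < t →
      (n.choose k : ℝ)⁻¹ * ∑ I ∈ princFinset n k,
        bridge a b t (pluck A) I * bridge a b t (pluck A) Iᶜ ≤
      (n.choose (k + 1) : ℝ)⁻¹ * ∑ I ∈ princFinset n (k + 1),
        bridge a b t (pluck A) I * bridge a b t (pluck A) Iᶜ := by
    intro t ht
    have hlt : #{I | I.card = n ∧ pluck (A.updateRow b (A.row b + t • A.row a)) I = 0} < q := by
      rw [← hq]
      refine card_lt_card ((ssubset_iff_of_subset fun J hJ => ?_).2 ⟨I, by simp [hI, hz], ?_⟩)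
      · rw [mem_filter] at hJ ⊢
        rw [hbr] at hJ
        exact ⟨mem_univ _, hJ.2.1, (hJ.2.2 ▸ hle t ht.le J).antisymm (hpos J)⟩
      · rw [mem_filter, hbr, bridge, hz, if_pos ⟨hb, ha⟩]
        simp [ht.ne', hnz]
    have := ih _ hlt (A.updateRow b (A.row b + t • A.row a))
      (fun K => by rw [hbr]; exact (hpos K).trans (hle t ht.le K)) rfl
    rwa [hbr] at this
  have hcont : ∀ J, Continuous fun t : ℝ => bridge a b t (pluck A) J := fun J => by
    simp only [bridge]
    split_ifs <;> fun_prop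
  have hzero : bridge a b 0 (pluck A) = pluck A := by
    funext J
    simp [bridge]
  have hlim : ∀ l, Filter.Tendsto (fun t : ℝ => (n.choose l : ℝ)⁻¹ * ∑ I ∈ princFinset n l,
      bridge a b t (pluck A) I * bridge a b t (pluck A) Iᶜ) (nhdsWithin 0 (Set.Ioi 0))
      (nhds ((n.choose l : ℝ)⁻¹ * ∑ I ∈ princFinset n l, pluck A I * pluck A Iᶜ)) := by
    intro l
    have hc : Continuous fun t : ℝ => (n.choose l : ℝ)⁻¹ * ∑ I ∈ princFinset n l,
      bridge a b t (pluck A) I * bridge a b t (pluck A) Iᶜ :=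
      continuous_const.mul (continuous_finsetSum _ fun I _ => (hcont I).mul (hcont Iᶜ))
    have := (hc.tendsto 0).mono_left (nhdsWithin_le_nhds (s := Set.Ioi 0))
    rwa [hzero] at this
  exact le_of_tendsto_of_tendsto (hlim k) (hlim (k + 1))
    (Filter.eventually_of_mem self_mem_nhdsWithin fun t ht => hstep t ht)

end

/-- The Barrett–Johnson inequality in Plücker-coordinate form: for `0 ≤ k ≤ ⌊n/2⌋ - 1`,
`C(n,k)⁻¹ ∑_{I ∈ ℐ_{n,k}} Δ_I Δ_{Iᶜ} ≤ C(n,k+1)⁻¹ ∑_{I ∈ ℐ_{n,k+1}} Δ_I Δ_{Iᶜ}`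
over `Gr^{≥0}(n, 2n)`. -/
theorem stmt_9 (n k : ℕ) (hn : 2 ≤ n) (hk : k + 1 ≤ n / 2)
    (A : Matrix (Fin (2 * n)) (Fin n) ℝ) (hrank : A.rank = n)
    (hpos : ∀ K : Finset (Fin (2 * n)), 0 ≤ pluck A K) :
    ((n.choose k : ℝ))⁻¹ * ∑ I ∈ princFinset n k, pluck A I * pluck A Iᶜ ≤
      ((n.choose (k + 1) : ℝ))⁻¹ * ∑ I ∈ princFinset n (k + 1), pluck A I * pluck A Iᶜ := by
  exact inv_choose_mul_sum_le (by omega) hk A hpos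
end

section
/- Let 1 ≤ m ≤ n be integers and let A be an n×m real matrix. Let Ā be the (m+n)×m matrix obtained by stacking A on top of W_0. For P ⊆ {1,…,n} and Q ⊆ {1,…,m} with |P| = |Q|, set I := P ∪ {m+n+1−j : j ∈ {1,…,m} ∖ Q}. Then I has exactly m elements, det A_{P,Q} = Δ_I(Ā) (with the convention det A_{∅,∅} = 1), and the assignment (P,Q) ↦ I is a bijection from pairs of equal-size subsets P ⊆ {1,…,n}, Q ⊆ {1,…,m} onto the m-element subsets of {1,…,m+n}. -/
open Finset

/-- The `m × m` matrix `W₀` with `(W₀)_{i,j} = (-1)^{i+1}` if `j = m - i + 1` and `0`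
otherwise (1-indexed); 0-indexed: entry `(-1)^i` at `j = m - 1 - i`. -/
def W0 (m : ℕ) : Matrix (Fin m) (Fin m) ℝ :=
  fun i j => if (j : ℕ) = m - 1 - (i : ℕ) then (-1 : ℝ) ^ (i : ℕ) else 0

/-- The `(m+n) × m` matrix obtained by stacking the `n × m` matrix `A` on top of the
`m × m` matrix `B`. -/
def stack {m n : ℕ} (A : Matrix (Fin n) (Fin m) ℝ) (B : Matrix (Fin m) (Fin m) ℝ) :
    Matrix (Fin (m + n)) (Fin m) ℝ :=
  fun i j =>
    if h : (i : ℕ) < n then A ⟨(i : ℕ), h⟩ j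
    else B ⟨(i : ℕ) - n, by have := i.isLt; omega⟩ j

/-- The index set `I = P ∪ {m+n+1-j : j ∈ {1,…,m} ∖ Q}` (0-indexed). -/
def embedIdx (m n : ℕ) (P : Finset (Fin n)) (Q : Finset (Fin m)) : Finset (Fin (m + n)) :=
  P.image (fun p : Fin n => (⟨(p : ℕ), by have := p.isLt; omega⟩ : Fin (m + n))) ∪
    Qᶜ.image (fun j : Fin m => (⟨m + n - 1 - (j : ℕ), by have := j.isLt; omega⟩ : Fin (m + n)))

/-- A square matrix whose bottom rows each have a single nonzero entry, at columns `g t` that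
strictly decrease, with the sign given by the cofactor expansion, has the determinant of the
submatrix on the top rows and the remaining columns. -/
theorem det_eq_det_submatrix_of_bottom_rows {k : ℕ} (c : ℕ)
    (M : Matrix (Fin (k + c)) (Fin (k + c)) ℝ)
    (e : Fin k → Fin (k + c)) (he : StrictMono e)
    (g : Fin c → Fin (k + c)) (hg : StrictAnti g) (hne : ∀ a t, e a ≠ g t)
    (hM : ∀ t j, M (Fin.natAdd k t) j =
      if j = g t then (-1 : ℝ) ^ (k + c - 1 - (g t : ℕ)) else 0) :
    M.det = (M.submatrix (Fin.castAdd c) e).det := by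
  induction c with
  | zero =>
    have h : e = id := by
      have h1 := Finset.orderEmbOfFin_unique (s := (univ : Finset (Fin k))) (by simp)
        (f := e) (fun x => mem_univ _) he
      have h2 := Finset.orderEmbOfFin_unique (s := (univ : Finset (Fin k))) (by simp)
        (f := id) (fun x => mem_univ _) strictMono_id
      exact h1.trans h2.symm
    subst h
    rfl
  | succ c ih =>
    set j₀ : Fin (k + c + 1) := g (Fin.last c) with hj₀
    have hlt (t : Fin c) : j₀ < g t.castSucc := hg (Fin.castSucc_lt_last t)
    choose g' hg' using fun t : Fin c => Fin.exists_succAbove_eq (hlt t).ne'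
    choose e' he' using fun a : Fin k => Fin.exists_succAbove_eq (hne a (Fin.last c))
    have hval (t : Fin c) : (g t.castSucc : ℕ) = (g' t : ℕ) + 1 := by
      have h := hlt t
      rw [← hg' t] at h ⊢
      rw [Fin.succAbove_of_le_castSucc _ _ (Fin.lt_succAbove_iff_le_castSucc _ _ |>.1 h)]
      rfl
    have hexp : M.det = (M.submatrix (Fin.last (k + c)).succAbove j₀.succAbove).det := by
      rw [Matrix.det_succ_row (n := k + c) M (Fin.last (k + c)), Finset.sum_eq_single j₀]
      · have h := hM (Fin.last c) j₀
        rw [if_pos hj₀] at h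
        have h' : M (Fin.last (k + c)) j₀ = (-1 : ℝ) ^ (k + (c + 1) - 1 - (j₀ : ℕ)) := h
        rw [h', ← pow_add, Even.neg_one_pow, one_mul]
        have := j₀.isLt
        rw [Fin.val_last]
        exact ⟨k + c, by omega⟩
      · intro j _ hj
        have h : M (Fin.last (k + c)) j = 0 := (hM (Fin.last c) j).trans (if_neg hj)
        rw [h]
        simp
      · simp
    rw [hexp, ih _ e' ?_ g' ?_ ?_ ?_]
    · rw [Matrix.submatrix_submatrix]
      congr 2
      · funext a
        simp only [Function.comp_apply, Fin.succAbove_last]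
        rfl
      · exact funext he'
    · intro a b hab
      have h := he hab
      rw [← he' a, ← he' b] at h
      exact (Fin.strictMono_succAbove _).lt_iff_lt.1 h
    · intro a b hab
      have h := hg (Fin.castSucc_lt_castSucc_iff.2 hab)
      rw [← hg' a, ← hg' b] at h
      exact (Fin.strictMono_succAbove _).lt_iff_lt.1 h
    · intro a t h
      apply hne a t.castSucc
      rw [← he' a, ← hg' t, h]
    · intro t j
      have h := hM t.castSucc (j₀.succAbove j)
      have hr : (Fin.last (k + c)).succAbove (Fin.natAdd k t) = Fin.natAdd k t.castSucc := by
        rw [Fin.succAbove_last]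
        rfl
      rw [Matrix.submatrix_apply, hr]
      refine h.trans ?_
      have hiff : j₀.succAbove j = g t.castSucc ↔ j = g' t := by
        rw [← hg' t]
        exact Fin.succAbove_right_injective.eq_iff
      have hexpo : k + (c + 1) - 1 - (g t.castSucc : ℕ) = k + c - 1 - (g' t : ℕ) := by
        rw [hval t]
        omega
      rw [hexpo]
      exact if_congr hiff rfl rfl

theorem mem_embedIdx {m n : ℕ} {P : Finset (Fin n)} {Q : Finset (Fin m)} {x : Fin (m + n)} :
    x ∈ embedIdx m n P Q ↔
      (∃ p ∈ P, (p : ℕ) = x) ∨ ∃ j, j ∉ Q ∧ m + n - 1 - (j : ℕ) = x := by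
  simp [embedIdx, Fin.ext_iff]

theorem card_embedIdx {m n : ℕ} (P : Finset (Fin n)) (Q : Finset (Fin m)) :
    (embedIdx m n P Q).card = P.card + Qᶜ.card := by
  rw [embedIdx, card_union_of_disjoint, card_image_of_injective, card_image_of_injective]
  · intro a b h
    simp only [Fin.mk.injEq] at h
    omega
  · intro a b h
    simp only [Fin.mk.injEq] at h
    omega
  · simp only [disjoint_left, mem_image, not_exists, not_and]
    rintro _ ⟨p, -, rfl⟩ j - h
    simp only [Fin.mk.injEq] at h
    omega

theorem castLE_mem_embedIdx {m n : ℕ} {P : Finset (Fin n)} {Q : Finset (Fin m)} (p : Fin n) :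
    Fin.castLE (Nat.le_add_left n m) p ∈ embedIdx m n P Q ↔ p ∈ P := by
  rw [mem_embedIdx]
  constructor
  · rintro (⟨q, hq, h⟩ | ⟨j, -, h⟩)
    · rwa [← Fin.ext (a := q) (b := p) h]
    · simp only [Fin.val_castLE] at h
      omega
  · exact fun h => Or.inl ⟨p, h, rfl⟩

theorem rev_castLE_mem_embedIdx {m n : ℕ} {P : Finset (Fin n)} {Q : Finset (Fin m)}
    (j : Fin m) :
    (Fin.castLE (Nat.le_add_right m n) j).rev ∈ embedIdx m n P Q ↔ j ∉ Q := by
  rw [mem_embedIdx]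
  simp only [Fin.val_rev, Fin.val_castLE]
  constructor
  · rintro (⟨q, hq, h⟩ | ⟨i, hi, h⟩)
    · omega
    · rwa [← Fin.ext (a := i) (b := j) (by omega)]
  · exact fun h => Or.inr ⟨j, h, by omega⟩

theorem embedIdx_injective {m n : ℕ} {P P' : Finset (Fin n)} {Q Q' : Finset (Fin m)}
    (h : embedIdx m n P Q = embedIdx m n P' Q') : P = P' ∧ Q = Q' := by
  constructor
  · ext p
    rw [← castLE_mem_embedIdx (Q := Q), h, castLE_mem_embedIdx]
  · ext j
    rw [← not_iff_not, ← rev_castLE_mem_embedIdx (P := P), h, rev_castLE_mem_embedIdx]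

theorem exists_embedIdx_eq {m n : ℕ} (K : Finset (Fin (m + n))) :
    ∃ (P : Finset (Fin n)) (Q : Finset (Fin m)), embedIdx m n P Q = K := by
  refine ⟨univ.filter fun p => Fin.castLE (Nat.le_add_left n m) p ∈ K,
    univ.filter fun j => (Fin.castLE (Nat.le_add_right m n) j).rev ∉ K, ?_⟩
  ext x
  by_cases hx : (x : ℕ) < n
  · have h : x = Fin.castLE (Nat.le_add_left n m) ⟨x, hx⟩ := rfl
    rw [h, castLE_mem_embedIdx]
    simp
  · have h : x = (Fin.castLE (Nat.le_add_right m n) ⟨m + n - 1 - x, by omega⟩).rev := by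
      ext
      simp only [Fin.val_rev, Fin.val_castLE]
      omega
    rw [h, rev_castLE_mem_embedIdx]
    simp

theorem stack_castLE {m n : ℕ} (A : Matrix (Fin n) (Fin m) ℝ) (B : Matrix (Fin m) (Fin m) ℝ)
    (p : Fin n) : stack A B (Fin.castLE (Nat.le_add_left n m) p) = A p := by
  funext j
  simp [stack]

theorem stack_W0_rev_castLE {m n : ℕ} (A : Matrix (Fin n) (Fin m) ℝ) (i j : Fin m) :
    stack A (W0 m) (Fin.castLE (Nat.le_add_right m n) i).rev j =
      if j = i then (-1 : ℝ) ^ (m - 1 - (i : ℕ)) else 0 := by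
  have h : ¬ m + n - (i + 1) < n := by omega
  have h₁ : m + n - ((i : ℕ) + 1) - n = m - 1 - i := by omega
  have h₂ : m - 1 - (m - 1 - (i : ℕ)) = i := by omega
  simp [stack, W0, h, h₁, h₂, Fin.ext_iff]

theorem minor_eq_pluck_embedIdx {m n : ℕ} (A : Matrix (Fin n) (Fin m) ℝ)
    (P : Finset (Fin n)) (Q : Finset (Fin m)) (hPQ : P.card = Q.card) :
    minor A P Q = pluck (stack A (W0 m)) (embedIdx m n P Q) := by
  obtain ⟨c, rfl⟩ : ∃ c, m = P.card + c :=
    Nat.exists_eq_add_of_le (hPQ ▸ by simpa using card_le_univ Q)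
  have hc : Qᶜ.card = c := by
    rw [card_compl, Fintype.card_fin]
    omega
  have hI : (embedIdx (P.card + c) n P Q).card = P.card + c := by rw [card_embedIdx, hc]
  set g : Fin c → Fin (P.card + c) := fun t => Qᶜ.orderEmbOfFin hc t.rev
  have hgQ (t : Fin c) : g t ∉ Q := mem_compl.1 (orderEmbOfFin_mem _ hc _)
  have hg : StrictAnti g := fun a b hab =>
    (Qᶜ.orderEmbOfFin hc).strictMono (Fin.rev_lt_rev.2 hab)
  set f : Fin (P.card + c) → Fin (P.card + c + n) := Fin.addCases
    (fun a => Fin.castLE (Nat.le_add_left _ _) (P.orderEmbOfFin rfl a))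
    (fun t => (Fin.castLE (Nat.le_add_right _ _) (g t)).rev)
  have hfl (a : Fin P.card) : f (Fin.castAdd c a) =
      Fin.castLE (Nat.le_add_left _ _) (P.orderEmbOfFin rfl a) := by
    exact Fin.addCases_left a
  have hfr (t : Fin c) : f (Fin.natAdd P.card t) =
      (Fin.castLE (Nat.le_add_right _ _) (g t)).rev := by
    exact Fin.addCases_right t
  have hfmem (x) : f x ∈ embedIdx (P.card + c) n P Q := by
    induction x using Fin.addCases with
    | left a => rw [hfl, castLE_mem_embedIdx]; exact orderEmbOfFin_mem _ _ _
    | right t => rw [hfr, rev_castLE_mem_embedIdx]; exact hgQ t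
  have hfmono : StrictMono f := by
    intro x y hxy
    induction x using Fin.addCases with
    | left a =>
      induction y using Fin.addCases with
      | left b =>
        rw [hfl, hfl]
        exact (P.orderEmbOfFin rfl).strictMono hxy
      | right t =>
        rw [hfl, hfr, Fin.lt_def, Fin.val_rev, Fin.val_castLE, Fin.val_castLE]
        omega
    | right s =>
      induction y using Fin.addCases with
      | left b =>
        rw [Fin.lt_def, Fin.val_natAdd, Fin.val_castAdd] at hxy
        omega
      | right t =>
        rw [hfr, hfr, Fin.rev_lt_rev]
        exact hg ((Fin.natAdd_lt_natAdd_iff _).1 hxy)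
  have hf := orderEmbOfFin_unique hI hfmem hfmono
  rw [minor, dif_pos hPQ.symm, pluck, dif_pos hI]
  change (A.submatrix (P.orderEmbOfFin rfl) (Q.orderEmbOfFin hPQ.symm)).det =
    ((stack A (W0 _)).submatrix ((embedIdx _ n P Q).orderEmbOfFin hI) id).det
  rw [← hf, det_eq_det_submatrix_of_bottom_rows c _ (Q.orderEmbOfFin hPQ.symm)
    (Q.orderEmbOfFin hPQ.symm).strictMono g hg]
  · congr 1
    ext a b
    simp only [Matrix.submatrix_apply, hfl, stack_castLE, id]
  · intro a t h
    exact hgQ t (h ▸ orderEmbOfFin_mem _ _ _)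
  · intro t j
    rw [Matrix.submatrix_apply, hfr, id, stack_W0_rev_castLE]

/-- The embedding of minors of `A` into Plücker coordinates of `Ā = (A over W₀)`:
`I = P ∪ {m+n+1-j : j ∉ Q}` has `m` elements, `det A_{P,Q} = Δ_I(Ā)`, and `(P,Q) ↦ I` is a
bijection from pairs of equal-size subsets onto the `m`-element subsets of `{1,…,m+n}`. -/
theorem stmt_11 (m n : ℕ) (hm : 1 ≤ m) (hmn : m ≤ n)
    (A : Matrix (Fin n) (Fin m) ℝ)
    (P : Finset (Fin n)) (Q : Finset (Fin m)) (hPQ : P.card = Q.card) :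
    (embedIdx m n P Q).card = m ∧
      minor A P Q = pluck (stack A (W0 m)) (embedIdx m n P Q) ∧
      (∀ K : Finset (Fin (m + n)), K.card = m →
        ∃! pq : Finset (Fin n) × Finset (Fin m),
          pq.1.card = pq.2.card ∧ embedIdx m n pq.1 pq.2 = K) := by
  have hcard (P : Finset (Fin n)) (Q : Finset (Fin m)) :
      (embedIdx m n P Q).card = m ↔ P.card = Q.card := by
    have hQ : Q.card ≤ m := by simpa using card_le_univ Q
    rw [card_embedIdx, card_compl, Fintype.card_fin]
    omega
  refine ⟨(hcard P Q).2 hPQ, minor_eq_pluck_embedIdx A P Q hPQ, fun K hK => ?_⟩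
  obtain ⟨P', Q', rfl⟩ := exists_embedIdx_eq K
  refine ⟨(P', Q'), ⟨(hcard P' Q').1 hK, rfl⟩, ?_⟩
  rintro ⟨P₁, Q₁⟩ ⟨-, h⟩
  exact Prod.ext_iff.2 (embedIdx_injective h)
end
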